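/- arXiv:1812.08078 — 2 statements merged into one kernel-verified Lean document; each statement's English description precedes it below -/
import Mathlib

section
/- There exist absolute constants c₁, c₂, C₁, C₂ > 0 such that for all sequences p_n ≥ 1, σ_n > 0, Δ_n > 0 and all sufficiently large n, C₁ e^{−c₁ r_n²} ≤ Ψ_{Δ_n} ≤ C₂ e^{−c₂ r_n²}. -/
open MeasureTheory ProbabilityTheory Filter Finset Asymptotics
open scoped ENNReal

noncomputable section

/-- Euclidean norm on `Fin p → ℝ`. -/
def eucNorm {p : ℕ} (θ : Fin p → ℝ) : ℝ := Real.sqrt (∑ i, θ i ^ 2)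

/-- The set of label vectors in `{-1,1}^n`. -/
def pmOne (n : ℕ) : Set (Fin n → ℝ) := {η | ∀ i, η i = 1 ∨ η i = -1}

/-- `sgn s = 1` if `s ≥ 0` and `-1` otherwise. -/
def sgn (s : ℝ) : ℝ := if 0 ≤ s then 1 else -1

/-- Hamming-type loss `r(a,b) = min over ν ∈ {±1} of Σ_j |a_j - ν b_j|`. -/
def lossR {n : ℕ} (a b : Fin n → ℝ) : ℝ :=
  min (∑ j, |a j - b j|) (∑ j, |a j + b j|)

/-- Law of `Y = θ ηᵀ + W`, where `W` has i.i.d. `N(0,σ²)` entries. -/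
def lawY (p n : ℕ) (σ : ℝ) (θ : Fin p → ℝ) (η : Fin n → ℝ) :
    Measure (Fin p → Fin n → ℝ) :=
  Measure.pi fun i => Measure.pi fun j => gaussianReal (θ i * η j) (σ ^ 2).toNNReal

/-- Parameter set `Ω_Δ = {θ : ‖θ‖ ≥ Δ} × {-1,1}^n`. -/
def Omega (p n : ℕ) (Δ : ℝ) : Set ((Fin p → ℝ) × (Fin n → ℝ)) :=
  {x | Δ ≤ eucNorm x.1 ∧ x.2 ∈ pmOne n}

/-- Expected loss of an estimator `f` at `(θ, η)`. -/
def risk (p n : ℕ) (σ : ℝ) (f : (Fin p → Fin n → ℝ) → Fin n → ℝ)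
    (θ : Fin p → ℝ) (η : Fin n → ℝ) : ℝ :=
  ∫ y, lossR (f y) η ∂(lawY p n σ θ η)

/-- Minimax risk `Ψ_Δ`. -/
def minimaxRisk (p n : ℕ) (σ Δ : ℝ) : ℝ :=
  ⨅ f : {f : (Fin p → Fin n → ℝ) → Fin n → ℝ // Measurable f ∧ ∀ y, f y ∈ pmOne n},
    ⨆ x : Omega p n Δ, (n : ℝ)⁻¹ * risk p n σ f.1 x.1.1 x.1.2

/-- Standard Gaussian upper tail `Φᶜ(t) = P(Z > t)`. -/
def Phic (t : ℝ) : ℝ := ((gaussianReal 0 1) {x | t < x}).toReal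

/-- Signal-to-noise ratio `r_n = (Δ²/σ²)/√(Δ²/σ² + p/n)`. -/
def snr (p n : ℕ) (σ Δ : ℝ) : ℝ :=
  (Δ ^ 2 / σ ^ 2) / Real.sqrt (Δ ^ 2 / σ ^ 2 + (p : ℝ) / n)

/-- Gaussian product measure on `Fin p → ℝ` with i.i.d. centered coordinates of variance `v`. -/
def gaussVec (p : ℕ) (v : ℝ) : Measure (Fin p → ℝ) :=
  Measure.pi fun _ => gaussianReal 0 v.toNNReal

/-- `G_σ(t, θ) = P((θ + σξ₁)ᵀ(θ + (σ/(n-1)) Σ_{j=2}^n ξ_j) ≤ ‖θ‖² t)` for i.i.d.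
standard Gaussian vectors `ξ₁, …, ξ_n` in `ℝ^p`. -/
def Gfun (p n : ℕ) (σ t : ℝ) (θ : Fin p → ℝ) : ℝ :=
  (((gaussVec p 1).prod (Measure.pi fun _ : Fin (n - 1) => gaussVec p 1))
    {ξ | ∑ i, (θ i + σ * ξ.1 i) * (θ i + σ / ((n : ℝ) - 1) * ∑ j, ξ.2 j i)
        ≤ eucNorm θ ^ 2 * t}).toReal

/-- Hollowed Gram matrix `H(YᵀY)` of the observation `y`, as a function. -/
def hollowGram {p n : ℕ} (y : Fin p → Fin n → ℝ) : Fin n → Fin n → ℝ :=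
  fun a b => if a = b then 0 else ∑ i, y i a * y i b

/-- `v` is a unit-norm eigenvector of the matrix `M` for its largest eigenvalue. -/
def IsTopEigenvector {n : ℕ} (M : Fin n → Fin n → ℝ) (v : Fin n → ℝ) : Prop :=
  eucNorm v = 1 ∧ ∃ μ : ℝ, (∀ a, ∑ b, M a b * v b = μ * v a) ∧
    ∀ μ' : ℝ, (∃ w : Fin n → ℝ, w ≠ 0 ∧ ∀ a, ∑ b, M a b * w b = μ' * w a) → μ' ≤ μ

/-- A spectral estimator: the entrywise sign of a measurable selection of a unit-norm
top eigenvector of `H(YᵀY)`. -/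
def IsSpectralEstimator (p n : ℕ) (f : (Fin p → Fin n → ℝ) → Fin n → ℝ) : Prop :=
  Measurable f ∧ ∃ v : (Fin p → Fin n → ℝ) → Fin n → ℝ, Measurable v ∧
    (∀ y, IsTopEigenvector (hollowGram y) (v y)) ∧
    ∀ y a, f y a = sgn (v y a)

/-- Lloyd iterations `η̂^{k+1}(Y) = sign(H(YᵀY) η̂^k(Y))`, started from `f0`. -/
def lloydIter {p n : ℕ} (f0 : (Fin p → Fin n → ℝ) → Fin n → ℝ) :
    ℕ → (Fin p → Fin n → ℝ) → Fin n → ℝ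
  | 0 => f0
  | k + 1 => fun y a => sgn (∑ b, hollowGram y a b * lloydIter f0 k y b)

/-- Operator (spectral) norm of a real matrix with respect to Euclidean norms. -/
def opNorm {m n : ℕ} (M : Matrix (Fin m) (Fin n) ℝ) : ℝ :=
  ‖LinearMap.toContinuousLinearMap (Matrix.toEuclideanLin M)‖

/-- `H(M)`: the matrix `M` with its diagonal entries replaced by zero. -/
def hollow {n : ℕ} (M : Matrix (Fin n) (Fin n) ℝ) : Matrix (Fin n) (Fin n) ℝ :=
  Matrix.of fun a b => if a = b then 0 else M a b

/-- Gram matrix `WᵀW` of a `p × n` array `w`. -/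
def gramMat {p n : ℕ} (w : Fin p → Fin n → ℝ) : Matrix (Fin n) (Fin n) ℝ :=
  Matrix.of fun a b => ∑ i, w i a * w i b

/-- Law of a `p × n` random matrix with i.i.d. `N(0, τ²)` entries. -/
def lawW (p n : ℕ) (τ : ℝ) : Measure (Fin p → Fin n → ℝ) :=
  Measure.pi fun _ => Measure.pi fun _ => gaussianReal 0 (τ ^ 2).toNNReal

/-- Rademacher (uniform ±1) measure on `ℝ`. -/
def rademacher : Measure ℝ :=
  (2 : ℝ≥0∞)⁻¹ • Measure.dirac (1 : ℝ) + (2 : ℝ≥0∞)⁻¹ • Measure.dirac (-1 : ℝ)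

instance : IsProbabilityMeasure rademacher := by
  constructor
  simp [rademacher, Measure.add_apply, Measure.smul_apply, smul_eq_mul]
  rw [ENNReal.inv_two_add_inv_two]

/-- i.i.d. Rademacher vector measure on `Fin n → ℝ`. -/
def radVec (n : ℕ) : Measure (Fin n → ℝ) := Measure.pi fun _ => rademacher



/-! ### Part 1: Gaussian integrals on product spaces -/

lemma lintegral_pi_prod {ι : Type*} [Fintype ι] {E : ι → Type*}
    [∀ i, MeasurableSpace (E i)] (μ : ∀ i, Measure (E i)) [∀ i, IsProbabilityMeasure (μ i)]
    (f : ∀ i, E i → ℝ≥0∞) (hf : ∀ i, Measurable (f i)) :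
    ∫⁻ x, ∏ i, f i (x i) ∂(Measure.pi μ) = ∏ i, ∫⁻ x, f i x ∂(μ i) := by
  have h := iIndepFun_pi (μ := μ) (X := f) (fun i => (hf i).aemeasurable)
  have h2 := lintegral_prod_eq_prod_lintegral_of_indepFun (μ := Measure.pi μ) Finset.univ
    (fun i ω => f i (ω i)) h (fun i => (hf i).comp (measurable_pi_apply i))
  rw [h2]
  refine Finset.prod_congr rfl fun i _ => ?_
  exact (measurePreserving_eval μ i).lintegral_comp (hf i)

lemma pi_withDensity' {ι : Type*} [Fintype ι] {E : ι → Type*}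
    [∀ i, MeasurableSpace (E i)] (μ ν : ∀ i, Measure (E i)) [∀ i, IsProbabilityMeasure (μ i)]
    [∀ i, IsProbabilityMeasure (ν i)]
    (f : ∀ i, E i → ℝ≥0∞) (hf : ∀ i, Measurable (f i))
    (hν : ∀ i, ν i = (μ i).withDensity (f i)) :
    Measure.pi ν = (Measure.pi μ).withDensity (fun x => ∏ i, f i (x i)) := by
  refine Measure.pi_eq fun s hs => ?_
  rw [withDensity_apply _ (MeasurableSet.univ_pi hs),
    ← lintegral_indicator (MeasurableSet.univ_pi hs)]
  have : (Set.univ.pi s).indicator (fun x => ∏ i, f i (x i))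
      = fun x => ∏ i, (s i).indicator (f i) (x i) := by
    classical
    ext x
    by_cases hx : x ∈ Set.univ.pi s
    · rw [Set.indicator_of_mem hx]
      refine Finset.prod_congr rfl fun i _ => ?_
      rw [Set.indicator_of_mem (hx i trivial)]
    · rw [Set.indicator_of_notMem hx]
      simp only [Set.mem_pi, Set.mem_univ, true_implies, not_forall] at hx
      obtain ⟨i, hi⟩ := hx
      symm
      exact Finset.prod_eq_zero (Finset.mem_univ i) (Set.indicator_of_notMem hi _)
  rw [this, lintegral_pi_prod μ _ (fun i => (hf i).indicator (hs i))]
  refine Finset.prod_congr rfl fun i _ => ?_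
  rw [hν i, withDensity_apply _ (hs i), lintegral_indicator (hs i)]

/-- Sum of the coordinates in `S` (with signs) is Gaussian. -/
lemma map_sum_gaussian {n : ℕ} (t : ℝ) (v : NNReal) (η : Fin n → ℝ) (hη : η ∈ pmOne n)
    (S : Finset (Fin n)) :
    (Measure.pi fun j => gaussianReal (t * η j) v).map (fun y => ∑ j ∈ S, η j * y j)
      = gaussianReal (S.card * t) (S.card * v) := by
  have hind : iIndepFun (fun j (y : Fin n → ℝ) => η j * y j)
      (Measure.pi fun j => gaussianReal (t * η j) v) :=
    iIndepFun_pi (X := fun j x => η j * x) (fun i => by fun_prop)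
  have hm : ∀ j, Measurable (fun (y : Fin n → ℝ) => η j * y j) := fun j => by fun_prop
  have hlaw : ∀ j, (Measure.pi fun j => gaussianReal (t * η j) v).map
      (fun y : Fin n → ℝ => η j * y j) = gaussianReal t v := by
    intro j
    have h1 := (measurePreserving_eval (fun j => gaussianReal (t * η j) v) j).map_eq
    have : (fun y : Fin n → ℝ => η j * y j) = (fun x => η j * x) ∘ (Function.eval j) := rfl
    have hev : Measurable (Function.eval j : (Fin n → ℝ) → ℝ) := measurable_pi_apply j
    have h4 : Measurable (fun x : ℝ => η j * x) := by fun_prop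
    rw [this, ← Measure.map_map h4 hev, h1, gaussianReal_map_const_mul]
    congr 1
    · rcases hη j with h | h <;> rw [h] <;> ring
    · ext
      rcases hη j with h | h <;> simp [h]
  induction S using Finset.induction_on with
  | empty => simp [Measure.map_const]
  | insert a S ha ih =>
    have h2 := gaussianReal_add_gaussianReal_of_indepFun
      (hind.indepFun_finsetSum_of_notMem hm ha)
      (by rw [← ih]; congr 1; ext y; simp) (hlaw a)
    have h3 : (fun y : Fin n → ℝ => ∑ j ∈ insert a S, η j * y j)
       = (∑ j ∈ S, fun y : Fin n → ℝ => η j * y j) + fun y : Fin n → ℝ => η a * y a := by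
      ext y; simp [Finset.sum_insert ha, add_comm]
    rw [h3, h2, Finset.card_insert_of_notMem ha]
    congr 1
    · push_cast; ring
    · push_cast; ring

lemma map_pair_gaussian {n : ℕ} (t : ℝ) (v : NNReal) (η : Fin n → ℝ) (hη : η ∈ pmOne n)
    (S : Finset (Fin n)) :
    (Measure.pi fun j => gaussianReal (t * η j) v).map
      (fun y => (∑ j ∈ S, η j * y j, ∑ j ∈ Sᶜ, η j * y j))
      = (gaussianReal (S.card * t) (S.card * v)).prod
        (gaussianReal (Sᶜ.card * t) (Sᶜ.card * v)) := by
  have hind : iIndepFun (fun j (y : Fin n → ℝ) => η j * y j)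
      (Measure.pi fun j => gaussianReal (t * η j) v) :=
    iIndepFun_pi (X := fun j x => η j * x) (fun i => by fun_prop)
  have hm : ∀ j, Measurable (fun (y : Fin n → ℝ) => η j * y j) := fun j => by fun_prop
  have h1 := hind.indepFun_finset S Sᶜ disjoint_compl_right hm
  have h2 := h1.comp (φ := fun z => ∑ j, z j) (ψ := fun z => ∑ j, z j)
    (by fun_prop) (by fun_prop)
  have h3 : IndepFun (fun y : Fin n → ℝ => ∑ j ∈ S, η j * y j)
      (fun y : Fin n → ℝ => ∑ j ∈ Sᶜ, η j * y j)
      (Measure.pi fun j => gaussianReal (t * η j) v) := by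
    convert h2 using 1
    · ext y; simp only [Function.comp]; rw [← Finset.sum_coe_sort]
    · ext y; simp only [Function.comp]; rw [← Finset.sum_coe_sort]
  rw [h3.map_prod_eq_prod_map_map
    (Measurable.aemeasurable (by fun_prop)) (Measurable.aemeasurable (by fun_prop)), map_sum_gaussian t v η hη,
    map_sum_gaussian t v η hη]

lemma lintegral_exp_gaussian (μ : ℝ) (v : NNReal) (c : ℝ) :
    ∫⁻ x, ENNReal.ofReal (Real.exp (c * x)) ∂(gaussianReal μ v)
      = ENNReal.ofReal (Real.exp (μ * c + v * c ^ 2 / 2)) := by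
  rw [← ofReal_integral_eq_lintegral_ofReal (integrable_exp_mul_gaussianReal c)
    (ae_of_all _ fun x => (Real.exp_pos _).le)]
  have := congrFun (mgf_fun_id_gaussianReal (μ := μ) (v := v)) c
  rw [mgf] at this
  rw [this]

/-- Quadratic exponential moment of a Gaussian. -/
lemma lintegral_exp_quad_gaussian (μ : ℝ) (v : NNReal) (hv : 0 < v) (α β : ℝ)
    (h : β * v < 1) :
    ∫⁻ x, ENNReal.ofReal (Real.exp (α * x + β * x ^ 2 / 2)) ∂(gaussianReal μ v)
      = ENNReal.ofReal ((Real.sqrt (1 - β * v))⁻¹ *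
        Real.exp ((α * μ + α ^ 2 * v / 2 + β * μ ^ 2 / 2) / (1 - β * v))) := by
  have hd : 0 < 1 - β * v := by linarith
  have hv' : (0:ℝ) < v := hv
  set d := 1 - β * v with hdd
  let v' : NNReal := v / d.toNNReal
  have hdn : 0 < d.toNNReal := Real.toNNReal_pos.mpr hd
  have hv'0 : v' ≠ 0 := (div_pos hv hdn).ne'
  have hv'c : (v' : ℝ) = v / d := by simp [v', Real.coe_toNNReal _ hd.le]
  rw [gaussianReal_of_var_ne_zero _ hv.ne', lintegral_withDensity_eq_lintegral_mul _
    (measurable_gaussianPDF μ v) (by fun_prop)]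
  have key : ∀ x, (gaussianPDF μ v * fun x =>
        ENNReal.ofReal (Real.exp (α * x + β * x ^ 2 / 2))) x
      = ENNReal.ofReal ((Real.sqrt d)⁻¹ *
        Real.exp ((α * μ + α ^ 2 * v / 2 + β * μ ^ 2 / 2) / d))
        * gaussianPDF ((μ + α * v) / d) v' x := by
    intro x
    simp only [Pi.mul_apply, gaussianPDF]
    rw [← ENNReal.ofReal_mul (gaussianPDFReal_nonneg _ _ _), ← ENNReal.ofReal_mul (by positivity)]
    congr 1
    rw [gaussianPDFReal, gaussianPDFReal, hv'c]
    have e1 : Real.sqrt (2 * Real.pi * (v / d)) = Real.sqrt (2 * Real.pi * v) / Real.sqrt d := by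
      rw [← Real.sqrt_div (by positivity)]; congr 1; ring
    rw [e1]
    have hsd : Real.sqrt d ≠ 0 := (Real.sqrt_pos.mpr hd).ne'
    have hsv : Real.sqrt (2 * Real.pi * v) ≠ 0 := (Real.sqrt_pos.mpr (by positivity)).ne'
    have e2 : -(x - μ) ^ 2 / (2 * v) + (α * x + β * x ^ 2 / 2)
       = (α * μ + α ^ 2 * v / 2 + β * μ ^ 2 / 2) / d
         + -(x - (μ + α * v) / d) ^ 2 / (2 * (v / d)) := by
      have : β = (1 - d) / v := by rw [hdd]; field_simp; ring
      rw [this]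
      field_simp
      ring
    rw [mul_assoc, ← Real.exp_add, e2, Real.exp_add]
    field_simp
  rw [lintegral_congr key, lintegral_const_mul _ (measurable_gaussianPDF _ _),
    lintegral_gaussianPDF_eq_one _ hv'0, mul_one]

lemma exp_neg_two_mul_le {x : ℝ} (h0 : 0 ≤ x) (h1 : x ≤ 1 / 2) : Real.exp (-(2 * x)) ≤ 1 - x := by
  rw [Real.exp_neg, inv_le_comm₀ (Real.exp_pos _) (by linarith)]
  have := Real.add_one_le_exp (2 * x)
  refine le_trans ?_ this
  rw [inv_le_iff_one_le_mul₀ (by linarith)]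
  nlinarith

/-- Row bound for the Chernoff argument. -/
lemma row_chernoff {n : ℕ} (t : ℝ) (v : NNReal) (hv : 0 < v) (η : Fin n → ℝ) (hη : η ∈ pmOne n)
    (S : Finset (Fin n)) (hS : S.Nonempty) (l : ℝ) (hl : 0 ≤ l)
    (hl1 : l * v * n ≤ 1) :
    ∫⁻ y, ENNReal.ofReal (Real.exp (-l * ((∑ j ∈ S, η j * y j) * ∑ j ∈ Sᶜ, η j * y j)))
        ∂(Measure.pi fun j => gaussianReal (t * η j) v)
      ≤ ENNReal.ofReal (Real.exp (l ^ 2 * (S.card * Sᶜ.card) * v ^ 2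
          - l * (S.card * Sᶜ.card) * t ^ 2 / 2)) := by
  have hv' : (0:ℝ) < v := hv
  have hk : (0:ℝ) < S.card := by exact_mod_cast hS.card_pos
  have hkm : (S.card : ℝ) + Sᶜ.card = n := by
    have := S.card_add_card_compl
    rw [Fintype.card_fin] at this
    exact_mod_cast this
  set k : ℝ := (S.card : ℝ) with hkdef
  set m : ℝ := (Sᶜ.card : ℝ) with hmdef
  have hm : 0 ≤ m := by rw [hmdef]; positivity
  let F : ℝ × ℝ → ℝ≥0∞ := fun z => ENNReal.ofReal (Real.exp (-l * (z.1 * z.2)))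
  have hF : Measurable F := by fun_prop
  have e1 : ∫⁻ y, ENNReal.ofReal (Real.exp (-l * ((∑ j ∈ S, η j * y j) * ∑ j ∈ Sᶜ, η j * y j)))
        ∂(Measure.pi fun j => gaussianReal (t * η j) v)
      = ∫⁻ z, F z ∂((gaussianReal (S.card * t) (S.card * v)).prod
        (gaussianReal (Sᶜ.card * t) (Sᶜ.card * v))) := by
    rw [← map_pair_gaussian t v η hη S, lintegral_map hF (by fun_prop)]
  rw [e1, lintegral_prod _ hF.aemeasurable]
  have e2 : ∀ x, ∫⁻ y, F (x, y) ∂(gaussianReal (Sᶜ.card * t) (Sᶜ.card * v))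
      = ENNReal.ofReal (Real.exp ((-l * m * t) * x + (l ^ 2 * m * v) * x ^ 2 / 2)) := by
    intro x
    have := lintegral_exp_gaussian (Sᶜ.card * t) (Sᶜ.card * v) (-l * x)
    simp only [F]
    simp only [mul_assoc] at this ⊢
    rw [this]
    congr 2
    push_cast
    ring
  rw [lintegral_congr e2]
  have hcv : ((S.card * v : NNReal) : ℝ) = k * v := by push_cast; rfl
  set u : ℝ := l ^ 2 * m * v * (k * v) with hu
  have hkm4 : k * m ≤ n ^ 2 / 4 := by rw [← hkm]; nlinarith [sq_nonneg (k - m)]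
  have hlvn : 0 ≤ l * v * n := by positivity
  have hu0 : 0 ≤ u := by positivity
  have hu4 : u ≤ 1 / 4 := by
    have : u = (l * v) ^ 2 * (k * m) := by rw [hu]; ring
    rw [this]
    calc (l * v) ^ 2 * (k * m) ≤ (l * v) ^ 2 * (n ^ 2 / 4) := by gcongr
      _ = (l * v * n) ^ 2 / 4 := by ring
      _ ≤ 1 / 4 := by gcongr; nlinarith
  have hvk : 0 < (S.card * v : NNReal) := by
    have : 0 < (S.card : NNReal) := by exact_mod_cast hS.card_pos
    positivity
  rw [lintegral_exp_quad_gaussian _ _ hvk _ _ (by rw [hcv]; linarith), hcv]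
  apply ENNReal.ofReal_le_ofReal
  have hu1 : l ^ 2 * m * v * (k * v) = u := rfl
  have hexp : Real.exp (l ^ 2 * (k * m) * (v:ℝ) ^ 2 - l * (k * m) * t ^ 2 / 2)
      = Real.exp (l ^ 2 * (k * m) * (v:ℝ) ^ 2) * Real.exp (-(l * (k * m) * t ^ 2 / 2)) := by
    rw [sub_eq_add_neg, Real.exp_add]
  rw [hu1, hexp]
  have hsq : (Real.sqrt (1 - u))⁻¹ ≤ Real.exp u := by
    rw [inv_le_comm₀ (Real.sqrt_pos.mpr (by linarith)) (Real.exp_pos _), ← Real.exp_neg]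
    apply Real.le_sqrt_of_sq_le
    rw [← Real.exp_nat_mul]
    refine le_trans (le_of_eq ?_) (exp_neg_two_mul_le hu0 (by linarith))
    congr 1; push_cast; ring
  have hu2 : l ^ 2 * (k * m) * (v:ℝ) ^ 2 = u := by rw [hu]; ring
  rw [hu2]
  gcongr
  rw [div_le_iff₀ (by linarith)]
  have e3 : -l * m * t * (k * t) + (-l * m * t) ^ 2 * (k * v) / 2 +
      l ^ 2 * m * v * (k * t) ^ 2 / 2 = - (l * (k * m) * t ^ 2) * (1 - l * v * n / 2) := by
    rw [← hkm]; ring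
  rw [e3]
  have : 0 ≤ l * (k * m) * t ^ 2 := by positivity
  nlinarith [mul_nonneg this hu0, mul_nonneg this hlvn, mul_le_mul_of_nonneg_left hl1 this]

/-! ### Part 2: upper bound via the maximum likelihood estimator -/

instance instProbLawY (p n : ℕ) (σ : ℝ) (θ : Fin p → ℝ) (η : Fin n → ℝ) :
    IsProbabilityMeasure (lawY p n σ θ η) := by
  unfold lawY; infer_instance

/-- Cross term between the block `S` and its complement. -/
def crossT {p n : ℕ} (η : Fin n → ℝ) (S : Finset (Fin n)) (y : Fin p → Fin n → ℝ) : ℝ :=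
  ∑ i, (∑ j ∈ S, η j * y i j) * ∑ j ∈ Sᶜ, η j * y i j

lemma measurable_crossT {p n : ℕ} (η : Fin n → ℝ) (S : Finset (Fin n)) :
    Measurable (crossT (p := p) η S) := by
  unfold crossT; fun_prop

lemma snr_sq (p n : ℕ) (hp : 1 ≤ p) (hn : 1 ≤ n) (σ Δ : ℝ) :
    snr p n σ Δ ^ 2 = (Δ ^ 2 / σ ^ 2) ^ 2 / (Δ ^ 2 / σ ^ 2 + (p : ℝ) / n) := by
  unfold snr
  rw [div_pow, Real.sq_sqrt (by positivity)]

lemma cross_prob (p n : ℕ) (hp : 1 ≤ p) (hn : 1 ≤ n) (σ Δ : ℝ) (hσ : 0 < σ) (hΔ : 0 < Δ)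
    (θ : Fin p → ℝ) (hθ : Δ ≤ eucNorm θ) (η : Fin n → ℝ) (hη : η ∈ pmOne n)
    (S : Finset (Fin n)) (hS : S.Nonempty) (hS2 : 2 * S.card ≤ n) :
    (lawY p n σ θ η).real {y | crossT η S y ≤ 0}
      ≤ Real.exp (-(snr p n σ Δ ^ 2 / 32)) ^ S.card := by
  have hkm : (S.card : ℝ) + Sᶜ.card = n := by
    have := S.card_add_card_compl
    rw [Fintype.card_fin] at this
    exact_mod_cast this
  have hk : (0:ℝ) < S.card := by exact_mod_cast hS.card_pos
  have hkn : 2 * (S.card : ℝ) ≤ n := by exact_mod_cast hS2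
  have hn' : (0:ℝ) < n := by exact_mod_cast hn
  have hp' : (0:ℝ) < p := by exact_mod_cast hp
  set v : NNReal := (σ ^ 2).toNNReal with hv
  have hvr : (v : ℝ) = σ ^ 2 := Real.coe_toNNReal _ (by positivity)
  have hv0 : 0 < v := Real.toNNReal_pos.mpr (by positivity)
  set s : ℝ := Δ ^ 2 / σ ^ 2 with hs
  have hs0 : 0 < s := by positivity
  set x : ℝ := s / (4 * (s + p / n)) with hx
  have hx0 : 0 < x := by positivity
  have hx1 : x ≤ 1 := by
    rw [hx, div_le_one (by positivity)]
    have : 0 < (p:ℝ) / n := by positivity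
    linarith
  have hxp : x * (p / n) ≤ s / 4 := by
    rw [hx, div_mul_eq_mul_div, div_le_div_iff₀ (by positivity) (by norm_num)]
    nlinarith [mul_pos hs0 hs0]
  have hxs : x * s = snr p n σ Δ ^ 2 / 4 := by
    rw [snr_sq p n hp hn, ← hs, hx]; field_simp
  set l : ℝ := x / (σ ^ 2 * n) with hl
  have hl0 : 0 ≤ l := by positivity
  have hl1 : l * v * n ≤ 1 := by
    rw [hvr, hl]
    have : x / (σ ^ 2 * n) * σ ^ 2 * n = x := by field_simp
    rw [this]; exact hx1
  set k : ℝ := (S.card : ℝ) with hkd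
  set m : ℝ := (Sᶜ.card : ℝ) with hmd
  have hT : Δ ^ 2 ≤ ∑ i, θ i ^ 2 := by
    have h0 : 0 ≤ ∑ i, θ i ^ 2 := Finset.sum_nonneg fun i _ => sq_nonneg _
    have := pow_le_pow_left₀ hΔ.le hθ 2
    unfold eucNorm at this
    rwa [Real.sq_sqrt h0] at this
  have hIntg : ∫⁻ y, ENNReal.ofReal (Real.exp (-l * crossT η S y)) ∂(lawY p n σ θ η)
      ≤ ENNReal.ofReal (Real.exp (-(snr p n σ Δ ^ 2 / 32)) ^ S.card) := by
    have e1 : ∀ y : Fin p → Fin n → ℝ, ENNReal.ofReal (Real.exp (-l * crossT η S y))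
       = ∏ i, ENNReal.ofReal (Real.exp (-l * ((∑ j ∈ S, η j * y i j)
          * ∑ j ∈ Sᶜ, η j * y i j))) := by
      intro y
      rw [← ENNReal.ofReal_prod_of_nonneg (fun i _ => (Real.exp_pos _).le), ← Real.exp_sum,
        ← Finset.mul_sum]
      rfl
    rw [lintegral_congr e1]
    unfold lawY
    rw [lintegral_pi_prod (fun i => Measure.pi fun j => gaussianReal (θ i * η j) v)
      (fun i z => ENNReal.ofReal (Real.exp (-l * ((∑ j ∈ S, η j * z j)
          * ∑ j ∈ Sᶜ, η j * z j)))) (fun i => by fun_prop)]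
    refine le_trans (Finset.prod_le_prod' fun i _ =>
      row_chernoff (θ i) v hv0 η hη S hS l hl0 hl1) ?_
    rw [← ENNReal.ofReal_prod_of_nonneg (fun i _ => (Real.exp_pos _).le), ← Real.exp_sum,
      ← Real.exp_nat_mul]
    apply ENNReal.ofReal_le_ofReal
    apply Real.exp_le_exp.mpr
    have h0 : ∑ i, (l ^ 2 * (k * m) * (v:ℝ) ^ 2 - l * (k * m) * θ i ^ 2 / 2)
        = p * (l ^ 2 * (k * m) * (σ ^ 2) ^ 2) - l * (k * m) * (∑ i, θ i ^ 2) / 2 := by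
      rw [Finset.sum_sub_distrib, ← Finset.sum_div, ← Finset.mul_sum, Finset.sum_const,
        Finset.card_univ, Fintype.card_fin, nsmul_eq_mul, hvr, ← Finset.mul_sum]
      ring
    refine (le_of_eq h0).trans ?_
    have hmn : (n:ℝ) / 2 ≤ m := by linarith
    have hm0 : 0 ≤ m := by linarith
    have h1 : l * (k * m) * Δ ^ 2 ≤ l * (k * m) * ∑ i, θ i ^ 2 := by gcongr
    have h2 : (p:ℝ) * (l ^ 2 * (k * m) * (σ ^ 2) ^ 2) = (k * m / n) * (x * (x * (p / n))) := by
      rw [hl]; field_simp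
    have h3 : l * (k * m) * Δ ^ 2 = (k * m / n) * (x * s) := by
      rw [hl, hs]; field_simp
    have h4 : (k * m / n) * (x * (x * (p / n))) ≤ (k * m / n) * (x * (s / 4)) := by gcongr
    have h5 : k / 2 ≤ k * m / n := by
      rw [le_div_iff₀ hn']; nlinarith
    have h6 : (k / 2) * (x * s) ≤ (k * m / n) * (x * s) := by gcongr
    have h7 : (S.card : ℝ) * -(snr p n σ Δ ^ 2 / 32) = - (k / 2 * (x * s) / 4) := by
      rw [hxs]; ring
    rw [h7]
    nlinarith
  have hmk : lawY p n σ θ η {y | crossT η S y ≤ 0}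
      ≤ ∫⁻ y, ENNReal.ofReal (Real.exp (-l * crossT η S y)) ∂(lawY p n σ θ η) := by
    have hm := measurable_crossT (p := p) η S
    have h := mul_meas_ge_le_lintegral (μ := lawY p n σ θ η)
      (f := fun y => ENNReal.ofReal (Real.exp (-l * crossT η S y))) (by fun_prop) 1
    rw [one_mul] at h
    refine le_trans (measure_mono ?_) h
    intro y hy
    simp only [Set.mem_ofPred_eq] at hy ⊢
    rw [← ENNReal.ofReal_one]
    apply ENNReal.ofReal_le_ofReal
    rw [← Real.exp_zero]
    apply Real.exp_le_exp.mpr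
    nlinarith
  rw [measureReal_def]
  exact ENNReal.toReal_le_of_le_ofReal (by positivity) (hmk.trans hIntg)

/-- Squared norm of `Y η`. -/
def gobj {p n : ℕ} (η : Fin n → ℝ) (y : Fin p → Fin n → ℝ) : ℝ := ∑ i, (∑ j, η j * y i j) ^ 2

lemma exists_measurable_argmax {Ω ι : Type*} [MeasurableSpace Ω] [MeasurableSpace ι]
    (g : ι → Ω → ℝ) (hg : ∀ i, Measurable (g i)) (s : Finset ι) (hs : s.Nonempty) :
    ∃ m : Ω → ι, Measurable m ∧ Measurable (fun ω => g (m ω) ω) ∧ (∀ ω, m ω ∈ s) ∧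
      ∀ ω, ∀ i ∈ s, g i ω ≤ g (m ω) ω := by
  classical
  induction hs using Finset.Nonempty.cons_induction with
  | singleton a =>
    exact ⟨fun _ => a, measurable_const, hg a, fun _ => by simp, fun ω i hi => by
      simp at hi; rw [hi]⟩
  | cons a s ha hs ih =>
    obtain ⟨m, hm, hgm, hms, hmax⟩ := ih
    have hset : MeasurableSet {ω | g (m ω) ω ≤ g a ω} := measurableSet_le hgm (hg a)
    refine ⟨fun ω => if g (m ω) ω ≤ g a ω then a else m ω,
      Measurable.ite hset measurable_const hm, ?_, ?_, ?_⟩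
    · have : (fun ω => g (if g (m ω) ω ≤ g a ω then a else m ω) ω)
        = fun ω => if g (m ω) ω ≤ g a ω then g a ω else g (m ω) ω := by
        ext ω; split_ifs <;> rfl
      rw [this]
      exact Measurable.ite hset (hg a) hgm
    · intro ω
      by_cases h : g (m ω) ω ≤ g a ω
      · simp [h]
      · simp [h, hms ω]
    · intro ω i hi
      rw [Finset.mem_cons] at hi
      by_cases h : g (m ω) ω ≤ g a ω
      · simp only [h, if_true]
        rcases hi with rfl | hi
        · exact le_rfl
        · exact (hmax ω i hi).trans h
      · simp only [h, if_false]
        rcases hi with rfl | hi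
        · exact (not_le.mp h).le
        · exact hmax ω i hi

lemma pmOne_finite (n : ℕ) : (pmOne n).Finite := by
  have : pmOne n ⊆ Set.univ.pi fun _ : Fin n => ({1, -1} : Set ℝ) := by
    intro η hη i _
    simpa using hη i
  exact (Set.Finite.pi' fun _ => Set.toFinite _).subset
    (by intro η hη i; simpa using hη i : pmOne n ⊆ {f | ∀ i, f i ∈ ({1, -1} : Set ℝ)})

lemma exists_mle (p n : ℕ) : ∃ f : (Fin p → Fin n → ℝ) → Fin n → ℝ,
    (Measurable f ∧ ∀ y, f y ∈ pmOne n) ∧ ∀ y, ∀ η ∈ pmOne n, gobj η y ≤ gobj (f y) y := by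
  obtain ⟨m, hm, -, hms, hmax⟩ := exists_measurable_argmax
    (fun (η : Fin n → ℝ) (y : Fin p → Fin n → ℝ) => gobj η y)
    (fun η => by unfold gobj; fun_prop) (pmOne_finite n).toFinset
    ⟨fun _ => 1, by simp [pmOne]⟩
  refine ⟨m, ⟨hm, fun y => by simpa using hms y⟩, fun y η hη => hmax y η (by simpa using hη)⟩

lemma gobj_split {p n : ℕ} (η : Fin n → ℝ) (S : Finset (Fin n)) (y : Fin p → Fin n → ℝ) :
    gobj η y - gobj (fun j => if j ∈ S then -η j else η j) y = 4 * crossT η S y := by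
  unfold gobj crossT
  rw [← Finset.sum_sub_distrib, Finset.mul_sum]
  refine Finset.sum_congr rfl fun i _ => ?_
  have h1 : ∑ j, η j * y i j = ∑ j ∈ S, η j * y i j + ∑ j ∈ Sᶜ, η j * y i j :=
    (Finset.sum_add_sum_compl S _).symm
  have h2 : ∑ j, (if j ∈ S then -η j else η j) * y i j
      = - ∑ j ∈ S, η j * y i j + ∑ j ∈ Sᶜ, η j * y i j := by
    rw [← Finset.sum_add_sum_compl S, ← Finset.sum_neg_distrib]
    congr 1
    · refine Finset.sum_congr rfl fun j hj => ?_
      rw [if_pos hj]; ring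
    · refine Finset.sum_congr rfl fun j hj => ?_
      rw [if_neg (Finset.mem_compl.mp hj)]
  rw [h1, h2]; ring

lemma sum_abs_sub {n : ℕ} (a b : Fin n → ℝ) (ha : a ∈ pmOne n) (hb : b ∈ pmOne n) :
    ∑ j, |a j - b j| = 2 * (Finset.univ.filter fun j => a j ≠ b j).card := by
  rw [Finset.card_filter]
  push_cast
  rw [Finset.mul_sum]
  refine Finset.sum_congr rfl fun j _ => ?_
  rcases ha j with h | h <;> rcases hb j with h' | h' <;> rw [h, h'] <;> norm_num

lemma neg_mem_pmOne {n : ℕ} {b : Fin n → ℝ} (hb : b ∈ pmOne n) : (fun j => -b j) ∈ pmOne n := by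
  intro j
  rcases hb j with h | h
  · right; simp [h]
  · left; simp [h]

lemma sum_abs_add {n : ℕ} (a b : Fin n → ℝ) (ha : a ∈ pmOne n) (hb : b ∈ pmOne n) :
    ∑ j, |a j + b j| = 2 * (Finset.univ.filter fun j => a j ≠ b j)ᶜ.card := by
  rw [Finset.compl_filter, Finset.card_filter]
  push_cast
  rw [Finset.mul_sum]
  refine Finset.sum_congr rfl fun j _ => ?_
  rcases ha j with h | h <;> rcases hb j with h' | h' <;> rw [h, h'] <;> norm_num

lemma mle_loss {p n : ℕ} (a η : Fin n → ℝ) (ha : a ∈ pmOne n) (hη : η ∈ pmOne n)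
    (y : Fin p → Fin n → ℝ) (hmax : gobj η y ≤ gobj a y) :
    ∃ S : Finset (Fin n), 2 * S.card ≤ n ∧ lossR a η ≤ 2 * S.card ∧ crossT η S y ≤ 0 := by
  set T := Finset.univ.filter fun j => a j ≠ η j with hT
  have hcard : T.card + Tᶜ.card = n := by
    rw [T.card_add_card_compl, Fintype.card_fin]
  have haT : (fun j => if j ∈ T then -η j else η j) = a := by
    ext j
    by_cases h : a j = η j
    · simp [hT, h]
    · simp only [hT, Finset.mem_filter, Finset.mem_univ, true_and, ne_eq, h, not_false_eq_true,
        if_true]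
      rcases ha j with h1 | h1 <;> rcases hη j with h2 | h2
      · exact absurd (h1.trans h2.symm) h
      · rw [h1, h2]; norm_num
      · rw [h1, h2]
      · exact absurd (h1.trans h2.symm) h
  have hc : crossT η T y ≤ 0 := by
    have := gobj_split η T y
    rw [haT] at this
    linarith
  by_cases h : 2 * T.card ≤ n
  · refine ⟨T, h, ?_, hc⟩
    unfold lossR
    rw [sum_abs_sub a η ha hη]
    exact min_le_left _ _
  · refine ⟨Tᶜ, by omega, ?_, ?_⟩
    · unfold lossR
      rw [sum_abs_add a η ha hη]
      exact min_le_right _ _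
    · refine le_trans (le_of_eq ?_) hc
      unfold crossT
      rw [compl_compl]
      exact Finset.sum_congr rfl fun i _ => mul_comm _ _

lemma lossR_nonneg {n : ℕ} (a b : Fin n → ℝ) : 0 ≤ lossR a b :=
  le_min (Finset.sum_nonneg fun _ _ => abs_nonneg _) (Finset.sum_nonneg fun _ _ => abs_nonneg _)

/-- Generic union bound for the risk of the MLE. -/
lemma risk_union (p n : ℕ) (hp : 1 ≤ p) (hn : 1 ≤ n) (σ Δ : ℝ) (hσ : 0 < σ) (hΔ : 0 < Δ)
    (f : (Fin p → Fin n → ℝ) → Fin n → ℝ) (hf : ∀ y, f y ∈ pmOne n)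
    (hmax : ∀ y, ∀ η ∈ pmOne n, gobj η y ≤ gobj (f y) y)
    (θ : Fin p → ℝ) (hθ : Δ ≤ eucNorm θ) (η : Fin n → ℝ) (hη : η ∈ pmOne n)
    (c0 : ℝ) (c : ℕ → ℝ) (hc : ∀ k, 0 ≤ c k) (hc00 : c 0 = 0)
    (hcc : ∀ k : ℕ, 2 * k ≤ n → 2 * (k : ℝ) ≤ c0 + c k) :
    risk p n σ f θ η ≤ c0 + ∑ S : Finset (Fin n),
      c S.card * Real.exp (-(snr p n σ Δ ^ 2 / 32)) ^ S.card := by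
  set q := Real.exp (-(snr p n σ Δ ^ 2 / 32)) with hq
  set A : Finset (Finset (Fin n)) := Finset.univ.filter fun S => 2 * S.card ≤ n with hA
  have hms : ∀ S : Finset (Fin n), MeasurableSet {y : Fin p → Fin n → ℝ | crossT η S y ≤ 0} :=
    fun S => measurableSet_le (measurable_crossT η S) measurable_const
  have hIntg : ∀ S : Finset (Fin n), Integrable
      (fun y => c S.card * ({y : Fin p → Fin n → ℝ | crossT η S y ≤ 0}.indicator
        (fun _ => (1:ℝ)) y)) (lawY p n σ θ η) := fun S =>
    ((integrable_const (1:ℝ)).indicator (hms S)).const_mul _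
  have hb : risk p n σ f θ η ≤ ∫ y, (c0 + ∑ S ∈ A, c S.card *
      ({y : Fin p → Fin n → ℝ | crossT η S y ≤ 0}.indicator (fun _ => (1:ℝ)) y))
      ∂(lawY p n σ θ η) := by
    unfold risk
    refine integral_mono_of_nonneg (ae_of_all _ fun y => lossR_nonneg _ _)
      ((integrable_const _).add (integrable_finsetSum _ fun S _ => hIntg S))
      (ae_of_all _ fun y => ?_)
    obtain ⟨S, h1, h2, h3⟩ := mle_loss (f y) η (hf y) hη y (hmax y η hη)
    refine h2.trans ((hcc _ h1).trans ?_)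
    simp only
    gcongr
    have hSA : S ∈ A := by simp [hA, h1]
    refine le_trans (le_of_eq ?_) (Finset.single_le_sum (f := fun S => c S.card *
      ({y : Fin p → Fin n → ℝ | crossT η S y ≤ 0}.indicator (fun _ => (1:ℝ)) y))
      (fun T _ => mul_nonneg (hc _) (Set.indicator_nonneg (fun _ _ => zero_le_one) _)) hSA)
    rw [Set.indicator_of_mem (by exact h3), mul_one]
  refine hb.trans ?_
  rw [integral_add (integrable_const _) (integrable_finsetSum _ fun S _ => hIntg S),
    integral_const, integral_finsetSum _ (fun S _ => hIntg S)]
  simp only [probReal_univ, one_smul]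
  gcongr
  refine le_trans (Finset.sum_le_sum (g := fun S => c S.card * q ^ S.card) fun S hS => ?_)
    (Finset.sum_le_sum_of_subset_of_nonneg (Finset.subset_univ _)
      fun S _ _ => mul_nonneg (hc _) (by positivity))
  rw [integral_const_mul, integral_indicator (hms S), setIntegral_const, smul_eq_mul, mul_one]
  rcases S.eq_empty_or_nonempty with h | h
  · simp [h, hc00]
  · refine mul_le_mul_of_nonneg_left ?_ (hc _)
    exact cross_prob p n hp hn σ Δ hσ hΔ θ hθ η hη S h (by simpa [hA] using hS)

lemma sum_pow_card (n : ℕ) (x : ℝ) : ∑ S : Finset (Fin n), x ^ S.card = (1 + x) ^ n := by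
  have := Fintype.sum_pow_mul_eq_add_pow (Fin n) x 1
  simpa [add_comm] using this

lemma mle_risk (p n : ℕ) (hp : 1 ≤ p) (hn : 1 ≤ n) (σ Δ : ℝ) (hσ : 0 < σ) (hΔ : 0 < Δ)
    (f : (Fin p → Fin n → ℝ) → Fin n → ℝ) (hf : ∀ y, f y ∈ pmOne n)
    (hmax : ∀ y, ∀ η ∈ pmOne n, gobj η y ≤ gobj (f y) y)
    (θ : Fin p → ℝ) (hθ : Δ ≤ eucNorm θ) (η : Fin n → ℝ) (hη : η ∈ pmOne n) :
    risk p n σ f θ η ≤ n * (32 * Real.exp (-(1 / 64) * snr p n σ Δ ^ 2)) := by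
  have hn' : (0:ℝ) < n := by exact_mod_cast hn
  have hU := risk_union p n hp hn σ Δ hσ hΔ f hf hmax θ hθ η hη
  set r2 := snr p n σ Δ ^ 2 with hr2
  have hr0 : 0 ≤ r2 := sq_nonneg _
  set lam := r2 / 64 with hlam
  have hlam0 : 0 ≤ lam := by positivity
  set q := Real.exp (-(r2 / 32)) with hq
  set w := Real.exp (-(1 / 64) * r2) with hw
  have hw' : w = Real.exp (-lam) := by rw [hw, hlam]; congr 1; ring
  have hw0 : 0 < w := Real.exp_pos _
  have hw1 : w ≤ 1 := by rw [hw', Real.exp_le_one_iff]; linarith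
  have hqw : q = w ^ 2 := by
    rw [hq, hw', ← Real.exp_nat_mul]; congr 1; rw [hlam]; push_cast; ring
  have hq0 : 0 < q := Real.exp_pos _
  have hqlew : q ≤ w := by rw [hqw]; nlinarith
  have he : Real.exp 1 ≤ 2.7182818286 := Real.exp_one_lt_d9.le
  by_cases h1 : n * q ≤ 1
  · have h := hU 0 (fun k => 2 * (2 ^ k - 1))
      (fun k => by have := one_le_pow₀ (M₀ := ℝ) (one_le_two) (n := k); linarith) (by simp)
      (fun k _ => by
        have : (k:ℝ) + 1 ≤ 2 ^ k := by
          have h2 := Nat.lt_two_pow_self (n := k)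
          exact_mod_cast h2
        linarith)
    have h2 : ∑ S : Finset (Fin n), (2 * ((2:ℝ) ^ S.card - 1)) * q ^ S.card
        = 2 * ((1 + 2 * q) ^ n - (1 + q) ^ n) := by
      rw [← sum_pow_card, ← sum_pow_card, ← Finset.sum_sub_distrib, Finset.mul_sum]
      refine Finset.sum_congr rfl fun S _ => ?_
      rw [mul_pow]; ring
    rw [h2, zero_add] at h
    refine h.trans ?_
    have h3 : (1 : ℝ) ≤ (1 + q) ^ n := one_le_pow₀ (by linarith)
    set z := n * (2 * q) with hz
    have hz0 : 0 ≤ z := by positivity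
    have h4 : (1 + 2 * q) ^ n ≤ Real.exp z := by
      rw [hz, Real.exp_nat_mul]
      gcongr
      rw [add_comm]; exact Real.add_one_le_exp _
    have h5 : Real.exp z - 1 ≤ z * Real.exp z := by
      have h6 := Real.add_one_le_exp (-z)
      have h7 : Real.exp (-z) * Real.exp z = 1 := by rw [← Real.exp_add]; simp
      nlinarith [Real.exp_pos z]
    have h6 : Real.exp z ≤ 8 := by
      have : Real.exp z ≤ Real.exp 2 := Real.exp_le_exp.mpr (by rw [hz]; linarith)
      refine this.trans ?_
      have : Real.exp 2 = Real.exp 1 * Real.exp 1 := by rw [← Real.exp_add]; norm_num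
      rw [this]
      nlinarith [Real.exp_pos 1]
    have h7 : z * Real.exp z ≤ z * 8 := by gcongr
    have h8 : (n:ℝ) * q ≤ n * w := by gcongr
    have : z = 2 * (n * q) := by rw [hz]; ring
    nlinarith
  · push Not at h1
    have hnw : 1 ≤ n * w := h1.le.trans (by gcongr)
    by_cases h2 : lam < 1
    · have h := hU n (fun _ => 0) (fun _ => le_rfl) rfl
        (fun k hk => by simpa using (by exact_mod_cast hk : (2:ℝ) * k ≤ n))
      simp only [zero_mul, Finset.sum_const_zero, add_zero] at h
      refine h.trans ?_
      have h3 : 1 ≤ 32 * w := by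
        have h4 : Real.exp (-1) ≤ w := by rw [hw']; exact Real.exp_le_exp.mpr (by linarith)
        have h5 : Real.exp (-1) * Real.exp 1 = 1 := by rw [← Real.exp_add]; simp
        nlinarith [Real.exp_pos (-1)]
      nlinarith
    · push Not at h2
      set k0 : ℝ := 2 * (n * w) with hk0
      have hk00 : 0 ≤ k0 := by positivity
      have h := hU (2 * k0) (fun k => if k0 < k then n else 0)
        (fun k => by split_ifs <;> positivity)
        (by rw [if_neg]; push_cast; linarith)
        (fun k hk => by
          have hk' : (2:ℝ) * k ≤ n := by exact_mod_cast hk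
          split_ifs with h3
          · linarith
          · push Not at h3; linarith)
      refine h.trans ?_
      have h3 : ∑ S : Finset (Fin n), (if k0 < (S.card : ℝ) then (n:ℝ) else 0) * q ^ S.card
          ≤ ∑ S : Finset (Fin n), n * Real.exp (-(lam * k0)) * w ^ S.card := by
        refine Finset.sum_le_sum fun S _ => ?_
        split_ifs with h4
        · rw [mul_assoc]
          refine mul_le_mul_of_nonneg_left ?_ hn'.le
          have h5 : q ^ S.card = w ^ S.card * w ^ S.card := by rw [hqw]; ring
          rw [h5]
          refine mul_le_mul_of_nonneg_right ?_ (by positivity)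
          rw [hw', ← Real.exp_nat_mul]
          apply Real.exp_le_exp.mpr
          nlinarith
        · rw [zero_mul]; positivity
      rw [← Finset.mul_sum, sum_pow_card] at h3
      have h4 : (1 + w) ^ n ≤ Real.exp (n * w) := by
        rw [Real.exp_nat_mul]
        gcongr
        rw [add_comm]; exact Real.add_one_le_exp _
      have h5 : Real.exp (-(lam * k0)) * (1 + w) ^ n ≤ w := by
        calc Real.exp (-(lam * k0)) * (1 + w) ^ n
            ≤ Real.exp (-(lam * k0)) * Real.exp (n * w) := by gcongr
          _ = Real.exp (-(lam * k0) + n * w) := (Real.exp_add _ _).symm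
          _ ≤ Real.exp (-lam) := by
            apply Real.exp_le_exp.mpr
            rw [hk0]
            nlinarith
          _ = w := hw'.symm
      have h6 : n * Real.exp (-(lam * k0)) * (1 + w) ^ n ≤ n * w := by
        rw [mul_assoc]; gcongr
      nlinarith

lemma omega_nonempty (p n : ℕ) (hp : 1 ≤ p) (Δ : ℝ) : Nonempty (Omega p n Δ) := by
  refine ⟨⟨(fun _ => Δ, fun _ => 1), ?_, fun _ => Or.inl rfl⟩⟩
  simp only [eucNorm]
  apply Real.le_sqrt_of_sq_le
  rw [Finset.sum_const, Finset.card_univ, Fintype.card_fin, nsmul_eq_mul]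
  have : (1:ℝ) ≤ p := by exact_mod_cast hp
  nlinarith [sq_nonneg Δ]

lemma risk_nonneg (p n : ℕ) (σ : ℝ) (f : (Fin p → Fin n → ℝ) → Fin n → ℝ)
    (θ : Fin p → ℝ) (η : Fin n → ℝ) : 0 ≤ risk p n σ f θ η :=
  integral_nonneg fun _ => lossR_nonneg _ _

lemma upper_bound (p n : ℕ) (hp : 1 ≤ p) (hn : 1 ≤ n) (σ Δ : ℝ) (hσ : 0 < σ) (hΔ : 0 < Δ) :
    _root_.minimaxRisk p n σ Δ ≤ 32 * Real.exp (-(1 / 64) * snr p n σ Δ ^ 2) := by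
  have hn' : (0:ℝ) < n := by exact_mod_cast hn
  obtain ⟨f, hf, hmax⟩ := exists_mle p n
  have := omega_nonempty p n hp Δ
  unfold _root_.minimaxRisk
  refine (ciInf_le ⟨0, ?_⟩ ⟨f, hf⟩).trans (ciSup_le fun x => ?_)
  · rintro _ ⟨g, rfl⟩
    exact Real.iSup_nonneg fun x => mul_nonneg (by positivity) (risk_nonneg _ _ _ _ _ _)
  · have := mle_risk p n hp hn σ Δ hσ hΔ f hf.2 hmax x.1.1 x.2.1 x.1.2 x.2.2
    rw [inv_mul_le_iff₀ hn']
    exact this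

/-! ### Part 3: lower bound -/

lemma gauss_density (m : ℝ) (v : NNReal) (hv : 0 < v) :
    gaussianReal m v = (gaussianReal 0 v).withDensity
      (fun x => ENNReal.ofReal (Real.exp (m * x / v - m ^ 2 / (2 * v)))) := by
  have hv' : (0:ℝ) < v := hv
  rw [gaussianReal_of_var_ne_zero _ hv.ne', gaussianReal_of_var_ne_zero _ hv.ne',
    ← withDensity_mul _ (measurable_gaussianPDF 0 v) (by fun_prop)]
  congr 1
  ext x
  simp only [Pi.mul_apply, gaussianPDF]
  rw [← ENNReal.ofReal_mul (gaussianPDFReal_nonneg _ _ _)]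
  congr 1
  rw [gaussianPDFReal, gaussianPDFReal, mul_assoc (√(2 * Real.pi * v))⁻¹, ← Real.exp_add]
  congr 2
  field_simp
  ring

/-- Law of one row of pure noise. -/
def rowN (n : ℕ) (v : NNReal) : Measure (Fin n → ℝ) := Measure.pi fun _ => gaussianReal 0 v

instance (n : ℕ) (v : NNReal) : IsProbabilityMeasure (rowN n v) := by
  unfold rowN; infer_instance

/-- Law of the pure noise. -/
def refN (p n : ℕ) (v : NNReal) : Measure (Fin p → Fin n → ℝ) := Measure.pi fun _ => rowN n v

instance (p n : ℕ) (v : NNReal) : IsProbabilityMeasure (refN p n v) := by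
  unfold refN; infer_instance

lemma lawY_density (p n : ℕ) (σ : ℝ) (hσ : 0 < σ) (θ : Fin p → ℝ) (η : Fin n → ℝ) :
    lawY p n σ θ η = (refN p n (σ ^ 2).toNNReal).withDensity (fun y => ENNReal.ofReal
      (∏ i, Real.exp (∑ j, (θ i * η j * y i j / σ ^ 2 - (θ i * η j) ^ 2 / (2 * σ ^ 2))))) := by
  have hv0 : 0 < (σ ^ 2).toNNReal := Real.toNNReal_pos.mpr (by positivity)
  have hvr : ((σ ^ 2).toNNReal : ℝ) = σ ^ 2 := Real.coe_toNNReal _ (by positivity)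
  unfold lawY refN
  have hrow : ∀ i, (Measure.pi fun j => gaussianReal (θ i * η j) (σ ^ 2).toNNReal)
      = (rowN n (σ ^ 2).toNNReal).withDensity (fun z => ENNReal.ofReal
        (Real.exp (∑ j, (θ i * η j * z j / σ ^ 2 - (θ i * η j) ^ 2 / (2 * σ ^ 2))))) := by
    intro i
    unfold rowN
    rw [pi_withDensity' (fun _ : Fin n => gaussianReal 0 (σ ^ 2).toNNReal) _ _
      (fun j => by fun_prop) (fun j => gauss_density (θ i * η j) _ hv0)]
    congr 1
    ext z
    rw [← ENNReal.ofReal_prod_of_nonneg (fun i _ => (Real.exp_pos _).le), ← Real.exp_sum, hvr]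
  rw [pi_withDensity' (fun _ : Fin p => rowN n (σ ^ 2).toNNReal) _ _
      (fun j => by fun_prop) hrow]
  congr 1
  ext z
  rw [← ENNReal.ofReal_prod_of_nonneg (fun i _ => (Real.exp_pos _).le)]

lemma risk_density (p n : ℕ) (σ : ℝ) (hσ : 0 < σ) (f : (Fin p → Fin n → ℝ) → Fin n → ℝ)
    (θ : Fin p → ℝ) (η : Fin n → ℝ) :
    risk p n σ f θ η = ∫ y, lossR (f y) η *
      (∏ i, Real.exp (∑ j, (θ i * η j * y i j / σ ^ 2 - (θ i * η j) ^ 2 / (2 * σ ^ 2))))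
      ∂(refN p n (σ ^ 2).toNNReal) := by
  unfold risk
  rw [lawY_density p n σ hσ, integral_withDensity_eq_integral_toReal_smul (by fun_prop)
    (ae_of_all _ fun y => ENNReal.ofReal_lt_top)]
  refine integral_congr_ae (ae_of_all _ fun y => ?_)
  simp only
  rw [ENNReal.toReal_ofReal (Finset.prod_nonneg fun i _ => (Real.exp_pos _).le), smul_eq_mul,
    mul_comm]

lemma integrable_exp_row (n : ℕ) (v : NNReal) (c : Fin n → ℝ) :
    Integrable (fun z => Real.exp (∑ j, c j * z j)) (rowN n v) ∧
      ∫ z, Real.exp (∑ j, c j * z j) ∂(rowN n v) = Real.exp (v * (∑ j, c j ^ 2) / 2) := by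
  have e : (fun z : Fin n → ℝ => Real.exp (∑ j, c j * z j))
      = fun z => ∏ j, Real.exp (c j * z j) := by
    ext z; rw [Real.exp_sum]
  rw [e]
  unfold rowN
  refine ⟨Integrable.fintype_prod (f := fun j x => Real.exp (c j * x))
    fun j => integrable_exp_mul_gaussianReal (c j), ?_⟩
  rw [integral_fintype_prod_eq_prod (fun j x => Real.exp (c j * x)), Finset.mul_sum,
    Finset.sum_div, Real.exp_sum]
  refine Finset.prod_congr rfl fun j _ => ?_
  have := congrFun (mgf_fun_id_gaussianReal (μ := 0) (v := v)) (c j)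
  rw [mgf] at this
  rw [this]
  simp

lemma cosh_row (n : ℕ) (v : NNReal) (c : Fin n → ℝ) (Q : ℝ) (hQ : v * (∑ j, c j ^ 2) = Q) :
    Integrable (fun z => Real.cosh (∑ j, c j * z j)) (rowN n v) ∧
      ∫ z, Real.cosh (∑ j, c j * z j) ∂(rowN n v) = Real.exp (Q / 2) := by
  obtain ⟨h1, h2⟩ := integrable_exp_row n v c
  obtain ⟨h3, h4⟩ := integrable_exp_row n v (fun j => - c j)
  have e : ∀ z : Fin n → ℝ, Real.cosh (∑ j, c j * z j)
      = (Real.exp (∑ j, c j * z j) + Real.exp (∑ j, (-c j) * z j)) / 2 := by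
    intro z
    rw [Real.cosh_eq]
    simp [Finset.sum_neg_distrib]
  simp_rw [e]
  refine ⟨(h1.add h3).div_const 2, ?_⟩
  rw [integral_div, integral_add h1 h3, h2, h4]
  simp only [neg_sq]
  rw [hQ]; ring

lemma sqrt_cosh_lower1 (U V : ℝ) :
    Real.cosh U ≤ Real.sqrt (Real.cosh (U + V) * Real.cosh (U - V)) := by
  apply Real.le_sqrt_of_sq_le
  rw [Real.cosh_add, Real.cosh_sub]
  nlinarith [Real.cosh_sq U, Real.cosh_sq V, sq_nonneg (Real.sinh V),
    sq_nonneg (Real.sinh U * Real.sinh V)]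

lemma sqrt_cosh_lower2 (U V : ℝ) :
    Real.cosh U * Real.cosh V - Real.sinh U ^ 2 * Real.sinh V ^ 2
      ≤ Real.sqrt (Real.cosh (U + V) * Real.cosh (U - V)) := by
  set D := Real.cosh U * Real.cosh V with hD
  set E := Real.sinh U ^ 2 * Real.sinh V ^ 2 with hE
  have hE0 : 0 ≤ E := by positivity
  have hD1 : 1 ≤ D := one_le_mul_of_one_le_of_one_le (Real.one_le_cosh _) (Real.one_le_cosh _)
  have hX : Real.cosh (U + V) * Real.cosh (U - V) = D ^ 2 - E := by
    rw [Real.cosh_add, Real.cosh_sub, hD, hE]; ring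
  by_cases h : D - E ≤ 0
  · exact h.trans (Real.sqrt_nonneg _)
  · push Not at h
    apply Real.le_sqrt_of_sq_le
    rw [hX]
    nlinarith


/-- Signs of a Boolean vector. -/
def sg {m : ℕ} (e : Fin m → Bool) (j : Fin m) : ℝ := if e j then 1 else -1

lemma sg_sq {m : ℕ} (e : Fin m → Bool) (j : Fin m) : sg e j ^ 2 = 1 := by
  unfold sg; split_ifs <;> norm_num

lemma sg_mem {m : ℕ} (e : Fin m → Bool) : sg e ∈ pmOne m := by
  intro j; unfold sg; split_ifs <;> simp

/-- Flip one coordinate. -/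
def flipB {m : ℕ} (i : Fin m) (e : Fin m → Bool) : Fin m → Bool := Function.update e i (!e i)

lemma flipB_flipB {m : ℕ} (i : Fin m) (e : Fin m → Bool) : flipB i (flipB i e) = e := by
  unfold flipB; ext j; by_cases h : j = i
  · subst h; simp
  · simp [h]

lemma sg_flip_same {m : ℕ} (i : Fin m) (e : Fin m → Bool) : sg (flipB i e) i = - sg e i := by
  unfold sg flipB; cases h : e i <;> simp

lemma sg_flip_ne {m : ℕ} (i j : Fin m) (h : j ≠ i) (e : Fin m → Bool) :
    sg (flipB i e) j = sg e j := by
  unfold sg flipB; simp [h]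

/-- Density of one row. -/
def rowK {n : ℕ} (a τ : ℝ) (e : Fin n → Bool) (z : Fin n → ℝ) : ℝ :=
  Real.exp (-(n * τ / 2)) * Real.cosh (∑ j, (a * sg e j) * z j)

lemma rowK_pos {n : ℕ} (a τ : ℝ) (e : Fin n → Bool) (z : Fin n → ℝ) : 0 < rowK a τ e z :=
  mul_pos (Real.exp_pos _) (Real.cosh_pos _)

@[fun_prop]
lemma measurable_rowK {n : ℕ} (a τ : ℝ) (e : Fin n → Bool) : Measurable (rowK a τ e) := by
  unfold rowK
  exact (Real.continuous_cosh.measurable.comp (by fun_prop)).const_mul _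

lemma rowK_int {n : ℕ} (v : NNReal) (a τ : ℝ) (hτ : v * a ^ 2 = τ) (e : Fin n → Bool) :
    Integrable (rowK a τ e) (rowN n v) ∧ ∫ z, rowK a τ e z ∂(rowN n v) = 1 := by
  obtain ⟨h1, h2⟩ := cosh_row n v (fun j => a * sg e j) (n * τ) (by
    simp only [mul_pow, sg_sq]; simp; rw [← hτ]; ring)
  refine ⟨h1.const_mul _, ?_⟩
  unfold rowK
  rw [integral_const_mul, h2, ← Real.exp_add]; simp

/-- Geometric mean of two row densities. -/
def gRow {n : ℕ} (a τ : ℝ) (e : Fin n → Bool) (i : Fin n) (z : Fin n → ℝ) : ℝ :=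
  Real.sqrt (rowK a τ e z * rowK a τ (flipB i e) z)

@[fun_prop]
lemma measurable_gRow {n : ℕ} (a τ : ℝ) (e : Fin n → Bool) (i : Fin n) :
    Measurable (gRow a τ e i) := by
  unfold gRow; fun_prop

lemma gRow_integrable {n : ℕ} (v : NNReal) (a τ : ℝ) (hτ : v * a ^ 2 = τ) (e : Fin n → Bool)
    (i : Fin n) : Integrable (gRow a τ e i) (rowN n v) := by
  refine ((rowK_int v a τ hτ e).1.add (rowK_int v a τ hτ (flipB i e)).1).mono'
    (by fun_prop) (ae_of_all _ fun z => ?_)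
  have h1 := rowK_pos a τ e z
  have h2 := rowK_pos a τ (flipB i e) z
  rw [gRow, Real.norm_of_nonneg (Real.sqrt_nonneg _), Pi.add_apply]
  apply Real.sqrt_le_iff.mpr
  constructor
  · positivity
  · nlinarith

lemma gRow_eq {n : ℕ} (a τ : ℝ) (e : Fin n → Bool) (i : Fin n) (z : Fin n → ℝ) :
    gRow a τ e i z = Real.exp (-(n * τ / 2)) * Real.sqrt
      (Real.cosh ((∑ j, (if j = i then 0 else a * sg e j) * z j)
          + ∑ j, (if j = i then a * sg e i else 0) * z j) *
        Real.cosh ((∑ j, (if j = i then 0 else a * sg e j) * z j)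
          - ∑ j, (if j = i then a * sg e i else 0) * z j)) := by
  unfold gRow rowK
  have e1 : (∑ j, (if j = i then 0 else a * sg e j) * z j)
          + ∑ j, (if j = i then a * sg e i else 0) * z j = ∑ j, (a * sg e j) * z j := by
    rw [← Finset.sum_add_distrib]
    refine Finset.sum_congr rfl fun j _ => ?_
    by_cases h : j = i
    · subst h; simp
    · simp [h]
  have e2 : (∑ j, (if j = i then 0 else a * sg e j) * z j)
          - ∑ j, (if j = i then a * sg e i else 0) * z j = ∑ j, (a * sg (flipB i e) j) * z j := by
    rw [← Finset.sum_sub_distrib]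
    refine Finset.sum_congr rfl fun j _ => ?_
    by_cases h : j = i
    · subst h; simp [sg_flip_same]
    · simp [h, sg_flip_ne]
  rw [e1, e2]
  rw [show ∀ x y w : ℝ, x * y * (x * w) = x ^ 2 * (y * w) by intros; ring,
    Real.sqrt_mul (sq_nonneg _), Real.sqrt_sq (Real.exp_pos _).le]

lemma sumU {n : ℕ} (a : ℝ) (e : Fin n → Bool) (i : Fin n) :
    ∑ j, (if j = i then 0 else a * sg e j) ^ 2 = (n - 1) * a ^ 2 := by
  have : ∀ j, (if j = i then 0 else a * sg e j) ^ 2 = a ^ 2 - if j = i then a ^ 2 else 0 := by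
    intro j; split_ifs <;> simp [mul_pow, sg_sq]
  simp_rw [this, Finset.sum_sub_distrib]
  simp; ring

lemma sumV {n : ℕ} (a : ℝ) (e : Fin n → Bool) (i : Fin n) :
    ∑ j, (if j = i then a * sg e i else 0) ^ 2 = a ^ 2 := by
  have : ∀ j, (if j = i then a * sg e i else 0) ^ 2 = if j = i then a ^ 2 else 0 := by
    intro j; split_ifs <;> simp [mul_pow, sg_sq]
  simp_rw [this]
  simp

lemma gRow_lower1 {n : ℕ} (v : NNReal) (a τ : ℝ) (hτ : v * a ^ 2 = τ) (e : Fin n → Bool)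
    (i : Fin n) : Real.exp (-(τ / 2)) ≤ ∫ z, gRow a τ e i z ∂(rowN n v) := by
  obtain ⟨h1, h2⟩ := cosh_row n v (fun j => if j = i then 0 else a * sg e j) ((n - 1) * τ) (by
    rw [sumU, ← hτ]; ring)
  have h3 : ∫ z, Real.exp (-(n * τ / 2)) * Real.cosh
      (∑ j, (if j = i then 0 else a * sg e j) * z j) ∂(rowN n v) = Real.exp (-(τ / 2)) := by
    rw [integral_const_mul, h2, ← Real.exp_add]; congr 1; ring
  rw [← h3]
  refine integral_mono (h1.const_mul _) (gRow_integrable v a τ hτ e i) fun z => ?_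
  simp only
  rw [gRow_eq]
  exact mul_le_mul_of_nonneg_left (sqrt_cosh_lower1 _ _) (Real.exp_pos _).le

lemma exp_sub_one_le (x : ℝ) : Real.exp x - 1 ≤ x * Real.exp x := by
  have h := Real.add_one_le_exp (-x)
  have h2 : Real.exp x * Real.exp (-x) = 1 := by rw [← Real.exp_add]; simp
  nlinarith [Real.exp_pos x]

set_option maxHeartbeats 2000000 in
lemma gRow_lower2 {n : ℕ} (hn : 128 ≤ n) (v : NNReal) (a τ : ℝ) (hτ : v * a ^ 2 = τ)
    (hnτ : n * τ ≤ 1) (e : Fin n → Bool)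
    (i : Fin n) : Real.exp (-(128 * τ ^ 2 * n)) ≤ ∫ z, gRow a τ e i z ∂(rowN n v) := by
  have hn' : (128:ℝ) ≤ n := by exact_mod_cast hn
  have hτ0 : 0 ≤ τ := by rw [← hτ]; positivity
  set cU : Fin n → ℝ := fun j => if j = i then 0 else a * sg e j with hcU
  set cV : Fin n → ℝ := fun j => if j = i then a * sg e i else 0 with hcV
  have hUV : ∀ j, cU j * cV j = 0 := by
    intro j; simp only [hcU, hcV]; split_ifs <;> simp
  have sU : ∑ j, cU j ^ 2 = (n - 1) * a ^ 2 := sumU a e i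
  have sV : ∑ j, cV j ^ 2 = a ^ 2 := sumV a e i
  have s1 : ∀ α β : ℝ, ∑ j, (α * cU j + β * cV j) ^ 2
      = α ^ 2 * ((n - 1) * a ^ 2) + β ^ 2 * a ^ 2 := by
    intro α β
    rw [← sU, ← sV, Finset.mul_sum, Finset.mul_sum, ← Finset.sum_add_distrib]
    refine Finset.sum_congr rfl fun j _ => ?_
    linear_combination 2 * α * β * hUV j
  have hK : ∀ α β : ℝ, Integrable (fun z => Real.cosh
        (α * (∑ j, cU j * z j) + β * (∑ j, cV j * z j))) (rowN n v) ∧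
      ∫ z, Real.cosh (α * (∑ j, cU j * z j) + β * (∑ j, cV j * z j)) ∂(rowN n v)
        = Real.exp ((α ^ 2 * (n - 1) + β ^ 2) * τ / 2) := by
    intro α β
    have := cosh_row n v (fun j => α * cU j + β * cV j) ((α ^ 2 * (n - 1) + β ^ 2) * τ) (by
      rw [s1, ← hτ]; ring)
    have e1 : ∀ z : Fin n → ℝ, ∑ j, (α * cU j + β * cV j) * z j
        = α * (∑ j, cU j * z j) + β * (∑ j, cV j * z j) := by
      intro z
      rw [Finset.mul_sum, Finset.mul_sum, ← Finset.sum_add_distrib]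
      exact Finset.sum_congr rfl fun j _ => by ring
    simpa only [e1] using this
  obtain ⟨i1, k1⟩ := hK 1 1
  obtain ⟨i2, k2⟩ := hK 1 (-1)
  obtain ⟨i3, k3⟩ := hK 2 2
  obtain ⟨i4, k4⟩ := hK 2 (-2)
  obtain ⟨i5, k5⟩ := hK 2 0
  obtain ⟨i6, k6⟩ := hK 0 2
  have hpt : ∀ U V : ℝ, Real.cosh U * Real.cosh V - Real.sinh U ^ 2 * Real.sinh V ^ 2
      = (1 / 2) * Real.cosh (1 * U + 1 * V) + (1 / 2) * Real.cosh (1 * U + (-1) * V)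
        - (1 / 8) * Real.cosh (2 * U + 2 * V) - (1 / 8) * Real.cosh (2 * U + (-2) * V)
        + (1 / 4) * Real.cosh (2 * U + 0 * V) + (1 / 4) * Real.cosh (0 * U + 2 * V) - 1 / 4 := by
    intro U V
    rw [show 1 * U + (-1) * V = U - V by ring, show 2 * U + (-2) * V = 2 * U - 2 * V by ring,
      show 1 * U + 1 * V = U + V by ring, show 2 * U + 0 * V = 2 * U by ring,
      show 0 * U + 2 * V = 2 * V by ring, Real.cosh_add, Real.cosh_sub, Real.cosh_add,
      Real.cosh_sub, Real.cosh_two_mul, Real.cosh_two_mul, Real.cosh_sq U, Real.cosh_sq V]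
    ring
  set E := Real.exp (-(n * τ / 2)) with hE
  have hIntg : Integrable (fun z : Fin n → ℝ => E * (Real.cosh (∑ j, cU j * z j) *
      Real.cosh (∑ j, cV j * z j)
      - Real.sinh (∑ j, cU j * z j) ^ 2 * Real.sinh (∑ j, cV j * z j) ^ 2)) (rowN n v) ∧
      ∫ z, E * (Real.cosh (∑ j, cU j * z j) * Real.cosh (∑ j, cV j * z j)
      - Real.sinh (∑ j, cU j * z j) ^ 2 * Real.sinh (∑ j, cV j * z j) ^ 2) ∂(rowN n v)
      = E * (Real.exp (n * τ / 2) -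
        (Real.exp (2 * (n - 1) * τ) - 1) * (Real.exp (2 * τ) - 1) / 4) := by
    simp_rw [hpt]
    have j1 := i1.const_mul (1 / 2)
    have j2 := i2.const_mul (1 / 2)
    have j3 := i3.const_mul (1 / 8)
    have j4 := i4.const_mul (1 / 8)
    have j5 := i5.const_mul (1 / 4)
    have j6 := i6.const_mul (1 / 4)
    have j12 := j1.add j2
    have j123 := j12.sub j3
    have j1234 := j123.sub j4
    have j15 := j1234.add j5
    have j16 := j15.add j6
    have j7 : Integrable (fun _ : Fin n → ℝ => (1 / 4 : ℝ)) (rowN n v) := integrable_const _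
    refine ⟨(j16.sub j7).const_mul E, ?_⟩
    rw [integral_const_mul]
    congr 1
    refine (integral_sub j16 j7).trans ?_
    rw [integral_add' j15 j6, integral_add' j1234 j5, integral_sub' j123 j4, integral_sub' j12 j3,
      integral_add' j1 j2]
    simp only [integral_const_mul, k1, k2, k3, k4, k5, k6]
    have x1 : Real.exp (2 * (n - 1) * τ) * Real.exp (2 * τ) = Real.exp (2 * n * τ) := by
      rw [← Real.exp_add]; congr 1; ring
    have q1 : Real.exp ((1 ^ 2 * ((n:ℝ) - 1) + 1 ^ 2) * τ / 2) = Real.exp (n * τ / 2) := by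
      congr 1; ring
    have q2 : Real.exp ((1 ^ 2 * ((n:ℝ) - 1) + (-1) ^ 2) * τ / 2) = Real.exp (n * τ / 2) := by
      congr 1; ring
    have q3 : Real.exp ((2 ^ 2 * ((n:ℝ) - 1) + 2 ^ 2) * τ / 2) = Real.exp (2 * n * τ) := by
      congr 1; ring
    have q4 : Real.exp ((2 ^ 2 * ((n:ℝ) - 1) + (-2) ^ 2) * τ / 2) = Real.exp (2 * n * τ) := by
      congr 1; ring
    have q5 : Real.exp ((2 ^ 2 * ((n:ℝ) - 1) + 0 ^ 2) * τ / 2) = Real.exp (2 * (n - 1) * τ) := by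
      congr 1; ring
    have q6 : Real.exp ((0 ^ 2 * ((n:ℝ) - 1) + 2 ^ 2) * τ / 2) = Real.exp (2 * τ) := by
      congr 1; ring
    rw [q1, q2, q3, q4, q5, q6]
    simp
    linear_combination (1 / 4) * x1
  have hmain : E * (Real.exp (n * τ / 2) -
        (Real.exp (2 * (n - 1) * τ) - 1) * (Real.exp (2 * τ) - 1) / 4)
        ≤ ∫ z, gRow a τ e i z ∂(rowN n v) := by
    rw [← hIntg.2]
    refine integral_mono hIntg.1 (gRow_integrable v a τ hτ e i) fun z => ?_
    simp only
    rw [gRow_eq]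
    exact mul_le_mul_of_nonneg_left (sqrt_cosh_lower2 _ _) (Real.exp_pos _).le
  refine le_trans ?_ hmain
  have hE1 : E * Real.exp (n * τ / 2) = 1 := by rw [hE, ← Real.exp_add]; simp
  have hEle : E ≤ 1 := by
    rw [hE]; apply Real.exp_le_one_iff.mpr
    have : 0 ≤ n * τ / 2 := by positivity
    linarith
  have hE0 : 0 < E := Real.exp_pos _
  have he : Real.exp 1 < 2.7182818286 := Real.exp_one_lt_d9
  have he2 : Real.exp 2 ≤ 8 := by
    rw [show (2:ℝ) = 1 + 1 by norm_num, Real.exp_add]; nlinarith [Real.exp_pos 1]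
  have y1 : Real.exp (2 * (n - 1) * τ) - 1 ≤ 2 * n * τ * 8 := by
    refine (exp_sub_one_le _).trans ?_
    have : Real.exp (2 * (n - 1) * τ) ≤ 8 := by
      refine le_trans (Real.exp_le_exp.mpr ?_) he2
      nlinarith
    have h0 : 0 ≤ 2 * ((n:ℝ) - 1) * τ := mul_nonneg (by linarith) hτ0
    exact mul_le_mul (by nlinarith) this (Real.exp_pos _).le (by positivity)
  have y2 : Real.exp (2 * τ) - 1 ≤ 2 * τ * 8 := by
    refine (exp_sub_one_le _).trans ?_
    have : Real.exp (2 * τ) ≤ 8 := by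
      refine le_trans (Real.exp_le_exp.mpr ?_) he2
      nlinarith
    exact mul_le_mul_of_nonneg_left this (by positivity)
  have y1' : 0 ≤ Real.exp (2 * (n - 1) * τ) - 1 := by
    have h0 : 0 ≤ 2 * ((n:ℝ) - 1) * τ := mul_nonneg (by linarith) hτ0
    linarith [Real.one_le_exp h0]
  have y2' : 0 ≤ Real.exp (2 * τ) - 1 := by
    linarith [Real.one_le_exp (show 0 ≤ 2 * τ by positivity)]
  have y3 : (Real.exp (2 * (n - 1) * τ) - 1) * (Real.exp (2 * τ) - 1) ≤
      (2 * n * τ * 8) * (2 * τ * 8) := mul_le_mul y1 y2 y2' (by positivity)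
  set X := (Real.exp (2 * (n - 1) * τ) - 1) * (Real.exp (2 * τ) - 1)
  have hX0 : 0 ≤ X := mul_nonneg y1' y2'
  have hx : 64 * τ ^ 2 * n ≤ 1 / 2 := by
    have h1 : (n:ℝ) * τ * (n * τ) ≤ 1 := by
      have : 0 ≤ (n:ℝ) * τ := by positivity
      nlinarith
    have h2 : 128 * (τ ^ 2 * n) ≤ n * (τ ^ 2 * n) := by gcongr
    nlinarith
  have := exp_neg_two_mul_le (x := 64 * τ ^ 2 * n) (by positivity) hx
  calc Real.exp (-(128 * τ ^ 2 * n)) = Real.exp (-(2 * (64 * τ ^ 2 * n))) := by congr 1; ring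
    _ ≤ 1 - 64 * τ ^ 2 * n := this
    _ ≤ 1 - X / 4 := by linarith only [y3, show (2 * n * τ * 8) * (2 * τ * 8) = 256 * τ ^ 2 * n by ring]
    _ ≤ E * (Real.exp (n * τ / 2) - X / 4) := by
      rw [mul_sub, hE1]
      have : E * (X / 4) ≤ 1 * (X / 4) := mul_le_mul_of_nonneg_right hEle (by positivity)
      linarith only [this]


lemma geo_min {L L' g ρ m : ℝ} (hL : 0 ≤ L) (hL' : 0 ≤ L') (hg : g ^ 2 = L * L')
    (hm0 : m = 0 ∨ m = 1) : ρ * g - ρ ^ 2 / 4 * (L + L') ≤ m * L + (1 - m) * L' := by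
  have key : ∀ x y : ℝ, 0 ≤ x → 0 ≤ y → g ^ 2 = x * y → ρ * g - ρ ^ 2 / 4 * (x + y) ≤ x := by
    intro x y hx hy h
    have h1 : ρ * g - ρ ^ 2 / 4 * y ≤ x := by
      rcases hy.eq_or_lt with h0 | h0
      · rw [← h0] at h ⊢
        have : g = 0 := by simpa using h
        rw [this]; simpa using hx
      · by_contra hc
        push Not at hc
        have : y * x < y * (ρ * g - ρ ^ 2 / 4 * y) := mul_lt_mul_of_pos_left hc h0
        nlinarith [sq_nonneg (g - ρ * y / 2)]
    have : 0 ≤ ρ ^ 2 / 4 * x := by positivity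
    linarith
  rcases hm0 with h | h
  · subst h
    have := key L' L hL' hL (by rw [hg]; ring)
    linarith
  · subst h
    have := key L L' hL hL' hg
    linarith

lemma loss_lower {n : ℕ} (hn : 0 < n) (a b : Fin n → ℝ) (ha : a ∈ pmOne n) (hb : b ∈ pmOne n) :
    (n:ℝ)⁻¹ * ∑ i, ∑ j, (1 - a i * a j * (b i * b j)) / 2 ≤ lossR a b := by
  have hn' : (0:ℝ) < n := by exact_mod_cast hn
  set C := ∑ j, a j * b j with hC
  have hab : ∀ j, (a j * b j = 1 ∨ a j * b j = -1) := by
    intro j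
    rcases ha j with h | h <;> rcases hb j with h' | h' <;> simp [h, h']
  have h1 : ∑ j, |a j - b j| = n - C := by
    have : ∀ j, |a j - b j| = 1 - a j * b j := by
      intro j
      rcases ha j with h | h <;> rcases hb j with h' | h' <;> simp [h, h'] <;> norm_num
    simp [this, hC]
  have h2 : ∑ j, |a j + b j| = n + C := by
    have : ∀ j, |a j + b j| = 1 + a j * b j := by
      intro j
      rcases ha j with h | h <;> rcases hb j with h' | h' <;> simp [h, h'] <;> norm_num
    simp [this, hC, Finset.sum_add_distrib]
  have hC1 : C ≤ n := by
    have : 0 ≤ ∑ j, |a j - b j| := Finset.sum_nonneg fun _ _ => abs_nonneg _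
    linarith
  have hC2 : -n ≤ C := by
    have : 0 ≤ ∑ j, |a j + b j| := Finset.sum_nonneg fun _ _ => abs_nonneg _
    linarith
  have h3 : ∑ i, ∑ j, (1 - a i * a j * (b i * b j)) / 2 = (n ^ 2 - C ^ 2) / 2 := by
    have : ∀ i j, (1 - a i * a j * (b i * b j)) / 2 = 1 / 2 - (a i * b i) * (a j * b j) / 2 := by
      intro i j; ring
    simp_rw [this, Finset.sum_sub_distrib, ← Finset.sum_div, ← Finset.mul_sum, ← hC,
      ← Finset.sum_mul, ← hC]
    simp; ring
  rw [h3, lossR, h1, h2, inv_mul_le_iff₀ hn']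
  apply le_of_sub_nonneg
  rcases min_choice ((n:ℝ) - C) (n + C) with h | h <;> rw [h]
  · nlinarith
  · nlinarith

lemma lossR_le {n : ℕ} (a b : Fin n → ℝ) (ha : a ∈ pmOne n) (hb : b ∈ pmOne n) :
    lossR a b ≤ 2 * n := by
  refine (min_le_left _ _).trans ?_
  calc ∑ j, |a j - b j| ≤ ∑ j : Fin n, (2:ℝ) := by
        refine Finset.sum_le_sum fun j _ => ?_
        rcases ha j with h | h <;> rcases hb j with h' | h' <;> simp [h, h'] <;> norm_num
    _ = 2 * n := by simp; ring

/-- Mixture density. -/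
def LK {p n : ℕ} (a τ : ℝ) (e : Fin n → Bool) (y : Fin p → Fin n → ℝ) : ℝ := ∏ i, rowK a τ e (y i)

/-- Geometric mean density. -/
def gK {p n : ℕ} (a τ : ℝ) (e : Fin n → Bool) (i : Fin n) (y : Fin p → Fin n → ℝ) : ℝ :=
  ∏ k, gRow a τ e i (y k)

lemma LK_pos {p n : ℕ} (a τ : ℝ) (e : Fin n → Bool) (y : Fin p → Fin n → ℝ) : 0 < LK a τ e y :=
  Finset.prod_pos fun _ _ => rowK_pos _ _ _ _

lemma gK_sq {p n : ℕ} (a τ : ℝ) (e : Fin n → Bool) (i : Fin n) (y : Fin p → Fin n → ℝ) :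
    gK a τ e i y ^ 2 = LK a τ e y * LK a τ (flipB i e) y := by
  unfold gK LK
  rw [← Finset.prod_pow, ← Finset.prod_mul_distrib]
  refine Finset.prod_congr rfl fun k _ => ?_
  exact Real.sq_sqrt (mul_pos (rowK_pos _ _ _ _) (rowK_pos _ _ _ _)).le

lemma LK_int {p n : ℕ} (v : NNReal) (a τ : ℝ) (hτ : v * a ^ 2 = τ) (e : Fin n → Bool) :
    Integrable (LK (p := p) a τ e) (refN p n v) ∧ ∫ y, LK a τ e y ∂(refN p n v) = 1 := by
  unfold refN LK
  refine ⟨Integrable.fintype_prod (f := fun _ z => rowK a τ e z)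
    fun j => (rowK_int v a τ hτ e).1, ?_⟩
  rw [integral_fintype_prod_eq_prod (fun _ z => rowK a τ e z)]
  simp [(rowK_int v a τ hτ e).2]

lemma gK_int {p n : ℕ} (v : NNReal) (a τ : ℝ) (hτ : v * a ^ 2 = τ) (e : Fin n → Bool) (i : Fin n)
    (ρ : ℝ) (hρ0 : 0 ≤ ρ) (hρ : ρ ≤ ∫ z, gRow a τ e i z ∂(rowN n v)) :
    Integrable (gK (p := p) a τ e i) (refN p n v) ∧ ρ ^ p ≤ ∫ y, gK a τ e i y ∂(refN p n v) := by
  unfold refN gK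
  refine ⟨Integrable.fintype_prod (f := fun _ z => gRow a τ e i z)
    fun j => gRow_integrable v a τ hτ e i, ?_⟩
  rw [integral_fintype_prod_eq_prod (fun _ z => gRow a τ e i z)]
  simp only [Finset.prod_const, Finset.card_univ, Fintype.card_fin]
  gcongr

lemma LK_mix {p n : ℕ} (σ t : ℝ) (hσ : 0 < σ) (e : Fin n → Bool) (y : Fin p → Fin n → ℝ) :
    ∑ ε : Fin p → Bool, (∏ i, Real.exp (∑ j, (t * sg ε i * sg e j * y i j / σ ^ 2
      - (t * sg ε i * sg e j) ^ 2 / (2 * σ ^ 2)))) = 2 ^ p * LK (t / σ ^ 2) (t ^ 2 / σ ^ 2) e y := by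
  have h := Finset.prod_univ_sum (fun _ : Fin p => (Finset.univ : Finset Bool))
    (fun i b => Real.exp (∑ j, (t * (if b then 1 else -1) * sg e j * y i j / σ ^ 2
      - (t * (if b then 1 else -1) * sg e j) ^ 2 / (2 * σ ^ 2))))
  rw [Fintype.piFinset_univ] at h
  have h' : ∑ ε : Fin p → Bool, (∏ i, Real.exp (∑ j, (t * sg ε i * sg e j * y i j / σ ^ 2
      - (t * sg ε i * sg e j) ^ 2 / (2 * σ ^ 2)))) = _ := h.symm
  rw [h']
  unfold LK
  have : (2:ℝ) ^ p = ∏ i : Fin p, (2:ℝ) := by simp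
  rw [this, ← Finset.prod_mul_distrib]
  refine Finset.prod_congr rfl fun i _ => ?_
  rw [Fintype.sum_bool]
  unfold rowK
  rw [Real.cosh_eq]
  have e1 : ∀ s : ℝ, s ^ 2 = 1 → ∑ j, (t * s * sg e j * y i j / σ ^ 2
      - (t * s * sg e j) ^ 2 / (2 * σ ^ 2))
      = -(n * (t ^ 2 / σ ^ 2) / 2) + s * ∑ j, (t / σ ^ 2 * sg e j) * y i j := by
    intro s hs
    rw [Finset.sum_sub_distrib, Finset.mul_sum]
    have : ∀ j, (t * s * sg e j) ^ 2 / (2 * σ ^ 2) = t ^ 2 / σ ^ 2 / 2 := by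
      intro j; rw [mul_pow, mul_pow, hs, sg_sq]; field_simp
    simp_rw [this]
    rw [Finset.sum_const, Finset.card_univ, Fintype.card_fin, nsmul_eq_mul]
    have : ∀ j, t * s * sg e j * y i j / σ ^ 2 = s * (t / σ ^ 2 * sg e j * y i j) := by
      intro j; ring
    simp_rw [this]; ring
  simp only [if_true, Bool.false_eq_true, if_false]
  rw [e1 1 (by norm_num), e1 (-1) (by norm_num), Real.exp_add, Real.exp_add]
  simp only [one_mul, neg_mul]
  ring

lemma measurable_lossR {α : Type*} [MeasurableSpace α] {n : ℕ} (f : α → Fin n → ℝ)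
    (hf : Measurable f) (b : Fin n → ℝ) : Measurable (fun y => lossR (f y) b) := by
  unfold lossR
  have : ∀ j, Measurable fun y => f y j := fun j => (measurable_pi_apply j).comp hf
  fun_prop

lemma pair_lower {p n : ℕ} (v : NNReal) (a τ : ℝ) (hτ : v * a ^ 2 = τ)
    (f : (Fin p → Fin n → ℝ) → Fin n → ℝ) (hf : Measurable f) (hfm : ∀ y, f y ∈ pmOne n)
    (ρ : ℝ) (hρ0 : 0 ≤ ρ) (hρ : ∀ e i, ρ ≤ ∫ z, gRow a τ e i z ∂(rowN n v))
    (i j : Fin n) (hij : j ≠ i) :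
    (2:ℝ) ^ n * ((ρ ^ p) ^ 2 / 4) ≤ ∑ e : Fin n → Bool, ∫ y,
      (1 - f y i * f y j * (sg e i * sg e j)) / 2 * LK a τ e y ∂(refN p n v) := by
  have hmeas : ∀ j, Measurable fun y => f y j := fun j => (measurable_pi_apply j).comp hf
  set M : (Fin n → Bool) → (Fin p → Fin n → ℝ) → ℝ :=
    fun e y => (1 - f y i * f y j * (sg e i * sg e j)) / 2 with hM
  have hM01 : ∀ e y, M e y = 0 ∨ M e y = 1 := by
    intro e y
    rcases hfm y i with h1 | h1 <;> rcases hfm y j with h2 | h2 <;>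
    rcases sg_mem e i with h3 | h3 <;> rcases sg_mem e j with h4 | h4 <;>
    simp only [hM, h1, h2, h3, h4] <;> norm_num
  have hMflip : ∀ e y, M (flipB i e) y = 1 - M e y := by
    intro e y
    simp only [hM, sg_flip_same, sg_flip_ne i j hij]; ring
  have hMint : ∀ e e', Integrable (fun y => M e y * LK a τ e' y) (refN p n v) := by
    intro e e'
    refine (LK_int (p := p) v a τ hτ e').1.bdd_mul (c := 1) ?_ (ae_of_all _ fun y => ?_)
    · simp only [hM]; exact Measurable.aestronglyMeasurable (by fun_prop)
    · rcases hM01 e y with h | h <;> simp [h]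
  set r := ρ ^ p with hr
  have hr0 : 0 ≤ r := by positivity
  have hone : ∀ e, r ^ 2 / 2 ≤ ∫ y, M e y * LK a τ e y ∂(refN p n v)
      + ∫ y, M (flipB i e) y * LK a τ (flipB i e) y ∂(refN p n v) := by
    intro e
    obtain ⟨g1, g2⟩ := gK_int (p := p) v a τ hτ e i ρ hρ0 (hρ e i)
    obtain ⟨l1, l2⟩ := LK_int (p := p) v a τ hτ e
    obtain ⟨l3, l4⟩ := LK_int (p := p) v a τ hτ (flipB i e)
    rw [← integral_add (hMint e e) (hMint _ _)]
    have h1 : ∫ y, (r * gK a τ e i y - r ^ 2 / 4 * (LK a τ e y + LK a τ (flipB i e) y))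
        ∂(refN p n v) = r * (∫ y, gK a τ e i y ∂(refN p n v)) - r ^ 2 / 4 * (1 + 1) := by
      have l5 : Integrable (fun y => LK a τ e y + LK a τ (flipB i e) y) (refN p n v) := l1.add l3
      rw [integral_sub (g1.const_mul r) (l5.const_mul _), integral_const_mul,
        integral_const_mul, integral_add l1 l3, l2, l4]
    have h2 : r ^ 2 / 2 ≤ r * (∫ y, gK a τ e i y ∂(refN p n v)) - r ^ 2 / 4 * (1 + 1) := by
      nlinarith [mul_le_mul_of_nonneg_left g2 hr0]
    refine h2.trans (h1.symm.le.trans ?_)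
    refine integral_mono ((g1.const_mul r).sub ((l1.add l3).const_mul _))
      ((hMint _ _).add (hMint _ _)) fun y => ?_
    simp only
    rw [hMflip]
    exact geo_min (LK_pos a τ e y).le (LK_pos a τ _ y).le (gK_sq a τ e i y) (hM01 e y)
  have hsum : ∑ e, ∫ y, M (flipB i e) y * LK a τ (flipB i e) y ∂(refN p n v)
      = ∑ e, ∫ y, M e y * LK a τ e y ∂(refN p n v) :=
    Equiv.sum_comp (Function.Involutive.toPerm (flipB i) (flipB_flipB i))
      (fun e => ∫ y, M e y * LK a τ e y ∂(refN p n v))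
  have h3 := Finset.sum_le_sum (s := (Finset.univ : Finset (Fin n → Bool))) fun e _ => hone e
  rw [Finset.sum_add_distrib, hsum] at h3
  simp at h3
  linarith

lemma integrable_dens (p n : ℕ) (σ : ℝ) (hσ : 0 < σ) (θ : Fin p → ℝ) (η : Fin n → ℝ) :
    Integrable (fun y : Fin p → Fin n → ℝ =>
      ∏ i, Real.exp (∑ j, (θ i * η j * y i j / σ ^ 2 - (θ i * η j) ^ 2 / (2 * σ ^ 2))))
      (refN p n (σ ^ 2).toNNReal) := by
  suffices key : ∀ i : Fin p, Integrable (fun z : Fin n → ℝ => Real.exp (∑ j, (θ i * η j * z j / σ ^ 2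
    - (θ i * η j) ^ 2 / (2 * σ ^ 2)))) (rowN n (σ ^ 2).toNNReal) from
    Integrable.fintype_prod key
  intro i
  have := (integrable_exp_row n (σ ^ 2).toNNReal (fun j => θ i * η j / σ ^ 2)).1.mul_const
    (Real.exp (- ∑ j, (θ i * η j) ^ 2 / (2 * σ ^ 2)))
  refine this.congr (ae_of_all _ fun z => ?_)
  simp only
  rw [← Real.exp_add, Finset.sum_sub_distrib, sub_eq_add_neg]
  congr 2
  exact Finset.sum_congr rfl fun j _ => by ring

lemma bddAbove_risk (p n : ℕ) (hn : 1 ≤ n) (σ Δ : ℝ)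
    (f : (Fin p → Fin n → ℝ) → Fin n → ℝ) (hfm : ∀ y, f y ∈ pmOne n) :
    BddAbove (Set.range fun x : Omega p n Δ => (n : ℝ)⁻¹ * risk p n σ f x.1.1 x.1.2) := by
  refine ⟨2, ?_⟩
  rintro _ ⟨x, rfl⟩
  have hn' : (0:ℝ) < n := by exact_mod_cast hn
  simp only
  rw [inv_mul_le_iff₀ hn', risk]
  have h := integral_mono_of_nonneg (μ := lawY p n σ x.1.1 x.1.2)
    (f := fun y => lossR (f y) x.1.2) (g := fun _ => 2 * (n:ℝ))
    (ae_of_all _ fun y => lossR_nonneg _ _) (integrable_const _)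
    (ae_of_all _ fun y => lossR_le _ _ (hfm y) x.2.2)
  simp at h
  linarith

lemma lower_core (p n : ℕ) (hp : 1 ≤ p) (hn : 2 ≤ n) (σ Δ : ℝ) (hσ : 0 < σ) (hΔ : 0 < Δ)
    (ρ : ℝ) (hρ0 : 0 ≤ ρ)
    (hρ : ∀ (e : Fin n → Bool) i, ρ ≤ ∫ z, gRow (Δ / √p / σ ^ 2) ((Δ / √p) ^ 2 / σ ^ 2) e i z
      ∂(rowN n (σ ^ 2).toNNReal)) :
    (ρ ^ p) ^ 2 / 8 ≤ _root_.minimaxRisk p n σ Δ := by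
  have hn' : (2:ℝ) ≤ n := by exact_mod_cast hn
  have hn0 : (0:ℝ) < n := by linarith
  have hp' : (0:ℝ) < p := by exact_mod_cast hp
  have hvr : ((σ ^ 2).toNNReal : ℝ) = σ ^ 2 := Real.coe_toNNReal _ (by positivity)
  set t := Δ / √p with ht
  set v := (σ ^ 2).toNNReal with hv
  have hτ : v * (t / σ ^ 2) ^ 2 = t ^ 2 / σ ^ 2 := by rw [hvr]; field_simp
  set τ := t ^ 2 / σ ^ 2 with hτd
  set a := t / σ ^ 2 with had
  obtain ⟨f0, hf0, -⟩ := exists_mle p n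
  have : Nonempty {f : (Fin p → Fin n → ℝ) → Fin n → ℝ // Measurable f ∧ ∀ y, f y ∈ pmOne n} :=
    ⟨⟨f0, hf0⟩⟩
  unfold _root_.minimaxRisk
  refine le_ciInf fun ⟨f, hf, hfm⟩ => ?_
  simp only
  set R := ⨆ x : Omega p n Δ, (n : ℝ)⁻¹ * risk p n σ f x.1.1 x.1.2 with hR
  have hmem : ∀ (ε : Fin p → Bool) (e : Fin n → Bool),
      ((fun i => t * sg ε i, sg e) : (Fin p → ℝ) × (Fin n → ℝ)) ∈ Omega p n Δ := by
    intro ε e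
    refine ⟨?_, sg_mem e⟩
    simp only [eucNorm, mul_pow, sg_sq]
    apply Real.le_sqrt_of_sq_le
    simp only [mul_one, Finset.sum_const, Finset.card_univ, Fintype.card_fin, nsmul_eq_mul]
    rw [ht, div_pow, Real.sq_sqrt hp'.le]
    field_simp
    exact le_rfl
  have h1 : ∀ (ε : Fin p → Bool) (e : Fin n → Bool),
      risk p n σ f (fun i => t * sg ε i) (sg e) ≤ n * R := by
    intro ε e
    have := le_ciSup (bddAbove_risk p n (by omega) σ Δ f hfm) ⟨_, hmem ε e⟩
    simp only at this
    rw [inv_mul_le_iff₀ hn0] at this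
    exact this
  have hlossmeas : ∀ b, Measurable fun y => lossR (f y) b := measurable_lossR f hf
  have h2 : ∀ e : Fin n → Bool, ∫ y, lossR (f y) (sg e) * LK a τ e y ∂(refN p n v) ≤ n * R := by
    intro e
    have h := Finset.sum_le_sum (s := (Finset.univ : Finset (Fin p → Bool))) fun ε _ => h1 ε e
    simp_rw [risk_density p n σ hσ] at h
    rw [← integral_finsetSum] at h
    · simp_rw [← Finset.mul_sum, LK_mix σ t hσ] at h
      rw [Finset.sum_const, Finset.card_univ, Fintype.card_fun, Fintype.card_bool,
        Fintype.card_fin, nsmul_eq_mul] at h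
      have e1 : ∀ y : Fin p → Fin n → ℝ, lossR (f y) (sg e) * (2 ^ p * LK a τ e y)
          = 2 ^ p * (lossR (f y) (sg e) * LK a τ e y) := by intro y; ring
      simp_rw [← hτd, ← had, e1] at h
      rw [integral_const_mul] at h
      push_cast at h
      have h2p : (0:ℝ) < 2 ^ p := by positivity
      refine le_of_mul_le_mul_left ?_ h2p
      linarith
    · intro ε _
      refine (integrable_dens p n σ hσ _ _).bdd_mul (c := 2 * n)
        (hlossmeas _).aestronglyMeasurable (ae_of_all _ fun y => ?_)
      rw [Real.norm_of_nonneg (lossR_nonneg _ _)]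
      exact lossR_le _ _ (hfm y) (sg_mem e)
  have hmeas : ∀ j, Measurable fun y => f y j := fun j => (measurable_pi_apply j).comp hf
  have hMint : ∀ (e : Fin n → Bool) (i j : Fin n), Integrable (fun y =>
      (1 - f y i * f y j * (sg e i * sg e j)) / 2 * LK a τ e y) (refN p n v) := by
    intro e i j
    refine (LK_int (p := p) v a τ hτ e).1.bdd_mul (c := 1)
      (Measurable.aestronglyMeasurable (by fun_prop)) (ae_of_all _ fun y => ?_)
    rcases hfm y i with h1 | h1 <;> rcases hfm y j with h2 | h2 <;>
    rcases sg_mem e i with h3 | h3 <;> rcases sg_mem e j with h4 | h4 <;>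
    simp only [h1, h2, h3, h4] <;> norm_num
  have h3 : ∀ e : Fin n → Bool, (n:ℝ)⁻¹ * ∑ i, ∑ j, ∫ y,
      (1 - f y i * f y j * (sg e i * sg e j)) / 2 * LK a τ e y ∂(refN p n v) ≤ n * R := by
    intro e
    refine le_trans ?_ (h2 e)
    simp_rw [← integral_finsetSum _ (fun j _ => hMint e _ j)]
    rw [← integral_finsetSum _ (fun i _ => integrable_finsetSum _ fun j _ => hMint e i j),
      ← integral_const_mul]
    refine integral_mono ((integrable_finsetSum _ fun i _ =>
      integrable_finsetSum _ fun j _ => hMint e i j).const_mul _) ?_ fun y => ?_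
    · refine (LK_int (p := p) v a τ hτ e).1.bdd_mul (c := 2 * n)
        (hlossmeas _).aestronglyMeasurable (ae_of_all _ fun y => ?_)
      rw [Real.norm_of_nonneg (lossR_nonneg _ _)]
      exact lossR_le _ _ (hfm y) (sg_mem e)
    · simp_rw [← Finset.sum_mul]
      rw [← mul_assoc]
      exact mul_le_mul_of_nonneg_right (loss_lower (by omega) _ _ (hfm y) (sg_mem e))
        (LK_pos a τ e y).le
  have h4 := Finset.sum_le_sum (s := (Finset.univ : Finset (Fin n → Bool))) fun e _ => h3 e
  rw [← Finset.mul_sum, Finset.sum_comm] at h4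
  have h5 : ∀ i : Fin n, ((n:ℝ) - 1) * (2 ^ n * ((ρ ^ p) ^ 2 / 4)) ≤ ∑ e : Fin n → Bool, ∑ j, ∫ y,
      (1 - f y i * f y j * (sg e i * sg e j)) / 2 * LK a τ e y ∂(refN p n v) := by
    intro i
    rw [Finset.sum_comm]
    have : ∀ j : Fin n, (2 ^ n * ((ρ ^ p) ^ 2 / 4)) - (if j = i then 2 ^ n * ((ρ ^ p) ^ 2 / 4) else 0)
        ≤ ∑ e : Fin n → Bool, ∫ y,
      (1 - f y i * f y j * (sg e i * sg e j)) / 2 * LK a τ e y ∂(refN p n v) := by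
      intro j
      split_ifs with h
      · rw [sub_self]
        refine Finset.sum_nonneg fun e _ => integral_nonneg fun y => ?_
        refine mul_nonneg ?_ (LK_pos _ _ _ _).le
        rw [h]
        rcases hfm y i with h1 | h1 <;> rcases sg_mem e i with h3 | h3 <;>
        simp only [h1, h3] <;> norm_num
      · rw [sub_zero]
        exact pair_lower v a τ hτ f hf hfm ρ hρ0 hρ i j h
    have h := Finset.sum_le_sum (s := (Finset.univ : Finset (Fin n))) fun j _ => this j
    refine le_trans (le_of_eq ?_) h
    rw [Finset.sum_sub_distrib, Finset.sum_ite_eq' Finset.univ i]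
    simp
    ring
  have h6 := Finset.sum_le_sum (s := (Finset.univ : Finset (Fin n))) fun i _ => h5 i
  rw [Finset.sum_const, Finset.card_univ, Fintype.card_fin, nsmul_eq_mul] at h6
  rw [Finset.sum_const, Finset.card_univ, Fintype.card_fun, Fintype.card_bool,
        Fintype.card_fin, nsmul_eq_mul] at h4
  have h7 := mul_le_mul_of_nonneg_left h6 (inv_nonneg.mpr hn0.le)
  rw [← mul_assoc, inv_mul_cancel₀ hn0.ne', one_mul] at h7
  have h8 := h7.trans h4
  push_cast at h8
  have h2n : (0:ℝ) < 2 ^ n := by positivity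
  have h9 : ((n:ℝ) - 1) * ((ρ ^ p) ^ 2 / 4) ≤ n * R := by
    refine le_of_mul_le_mul_left ?_ h2n
    linarith
  have h10 : (n:ℝ) * ((ρ ^ p) ^ 2 / 8) ≤ ((n:ℝ) - 1) * ((ρ ^ p) ^ 2 / 4) := by
    nlinarith [sq_nonneg (ρ ^ p)]
  exact le_of_mul_le_mul_left (h10.trans h9) hn0

lemma lower_bound (p n : ℕ) (hp : 1 ≤ p) (hn : 128 ≤ n) (σ Δ : ℝ) (hσ : 0 < σ) (hΔ : 0 < Δ) :
    1 / 8 * Real.exp (-512 * snr p n σ Δ ^ 2) ≤ _root_.minimaxRisk p n σ Δ := by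
  have hn0 : (0:ℝ) < n := by exact_mod_cast (by omega : 0 < n)
  have hp' : (0:ℝ) < p := by exact_mod_cast hp
  have hvr : ((σ ^ 2).toNNReal : ℝ) = σ ^ 2 := Real.coe_toNNReal _ (by positivity)
  have hτ : ((σ ^ 2).toNNReal : ℝ) * (Δ / √p / σ ^ 2) ^ 2 = (Δ / √p) ^ 2 / σ ^ 2 := by
    rw [hvr]; field_simp
  set τ := (Δ / √p) ^ 2 / σ ^ 2 with hτd
  rw [snr_sq p n hp (by omega) σ Δ]
  set s := Δ ^ 2 / σ ^ 2 with hs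
  have hs0 : 0 < s := by positivity
  have hsτ : τ = s / p := by
    rw [hτd, hs, div_pow, Real.sq_sqrt hp'.le]; field_simp
  by_cases hc : (p:ℝ) / n ≤ s
  · refine le_trans ?_ (lower_core p n hp (by omega) σ Δ hσ hΔ (Real.exp (-(τ / 2)))
      (Real.exp_pos _).le (fun e i => gRow_lower1 _ _ _ hτ e i))
    rw [← Real.exp_nat_mul, ← Real.exp_nat_mul, hsτ]
    have h1 : s / 2 ≤ s ^ 2 / (s + p / n) := by
      rw [le_div_iff₀ (by positivity)]; nlinarith
    have h2 : Real.exp (-512 * (s ^ 2 / (s + p / n)))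
        ≤ Real.exp ((2:ℕ) * ((p:ℕ) * (-(s / p / 2)))) := by
      apply Real.exp_le_exp.mpr
      have : ((2:ℕ):ℝ) * ((p:ℕ) * (-(s / p / 2))) = -s := by push_cast; field_simp
      rw [this]; linarith
    linarith
  · push Not at hc
    refine le_trans ?_ (lower_core p n hp (by omega) σ Δ hσ hΔ (Real.exp (-(128 * τ ^ 2 * n)))
      (Real.exp_pos _).le (fun e i => gRow_lower2 hn _ _ _ hτ (by
        rw [hsτ, ← mul_div_assoc, div_le_one hp']
        rw [lt_div_iff₀ hn0] at hc
        linarith) e i))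
    rw [← Real.exp_nat_mul, ← Real.exp_nat_mul, hsτ]
    have h1 : s ^ 2 * n / (2 * p) ≤ s ^ 2 / (s + p / n) := by
      have : s ^ 2 * n / (2 * p) = s ^ 2 / (p / n + p / n) := by field_simp; ring
      rw [this]; gcongr
    have h2 : Real.exp (-512 * (s ^ 2 / (s + p / n)))
        ≤ Real.exp ((2:ℕ) * ((p:ℕ) * (-(128 * (s / p) ^ 2 * n)))) := by
      apply Real.exp_le_exp.mpr
      have : ((2:ℕ):ℝ) * ((p:ℕ) * (-(128 * (s / p) ^ 2 * n))) = -512 * (s ^ 2 * n / (2 * p)) := by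
        push_cast; field_simp; ring
      rw [this]; linarith
    linarith


/-- Proposition 4: `C₁ e^{-c₁ r_n²} ≤ Ψ_{Δ_n} ≤ C₂ e^{-c₂ r_n²}` for large `n`. -/
theorem statement9 :
    ∃ c₁ c₂ C₁ C₂ : ℝ, 0 < c₁ ∧ 0 < c₂ ∧ 0 < C₁ ∧ 0 < C₂ ∧
      ∀ (p : ℕ → ℕ) (σ Δ : ℕ → ℝ),
        (∀ n, 1 ≤ p n) → (∀ n, 0 < σ n) → (∀ n, 0 < Δ n) →
        ∃ N : ℕ, ∀ n ≥ N,
          C₁ * Real.exp (-c₁ * snr (p n) n (σ n) (Δ n) ^ 2)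
              ≤ minimaxRisk (p n) n (σ n) (Δ n) ∧
            minimaxRisk (p n) n (σ n) (Δ n)
              ≤ C₂ * Real.exp (-c₂ * snr (p n) n (σ n) (Δ n) ^ 2) := by
  refine ⟨512, 1 / 64, 1 / 8, 32, by norm_num, by norm_num, by norm_num, by norm_num, ?_⟩
  intro p σ Δ hp hσ hΔ
  refine ⟨128, fun n hn => ⟨?_, ?_⟩⟩
  · exact lower_bound (p n) n (hp n) hn (σ n) (Δ n) (hσ n) (hΔ n)
  · exact upper_bound (p n) n (hp n) (by omega) (σ n) (Δ n) (hσ n) (hΔ n)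

end
end

section
/- Almost full recovery is possible for the sequence of classes (Ω_{Δ_n}) if and only if Φ^c(r_n) → 0 as n → ∞. -/
open MeasureTheory ProbabilityTheory Filter Finset Asymptotics
open scoped ENNReal

noncomputable section

/-- Product of measures with density. -/
lemma aux_pi_withDensity {ι : Type*} [Fintype ι] {E : ι → Type*} [∀ i, MeasurableSpace (E i)]
    (μ : ∀ i, Measure (E i)) [∀ i, IsProbabilityMeasure (μ i)] (f : ∀ i, E i → ℝ≥0∞)
    (hf : ∀ i, Measurable (f i)) [∀ i, SigmaFinite ((μ i).withDensity (f i))] :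
    Measure.pi (fun i => (μ i).withDensity (f i))
      = (Measure.pi μ).withDensity (fun x => ∏ i, f i (x i)) := by
  refine Measure.pi_eq fun s hs => ?_
  have hind : iIndepFun (fun i (x : ∀ i, E i) => (s i).indicator (f i) (x i)) (Measure.pi μ) :=
    iIndepFun_pi (fun i => ((hf i).indicator (hs i)).aemeasurable)
  rw [withDensity_apply _ (MeasurableSet.univ_pi hs), ← lintegral_indicator (MeasurableSet.univ_pi hs)]
  have : ∀ x : ∀ i, E i, (Set.univ.pi s).indicator (fun x => ∏ i, f i (x i)) x
      = ∏ i, (s i).indicator (f i) (x i) := by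
    intro x
    by_cases hx : x ∈ Set.univ.pi s
    · rw [Set.indicator_of_mem hx]
      refine Finset.prod_congr rfl fun i _ => ?_
      rw [Set.indicator_of_mem (hx i trivial)]
    · rw [Set.indicator_of_notMem hx]
      simp only [Set.mem_pi, Set.mem_univ, true_implies, not_forall] at hx
      obtain ⟨i, hi⟩ := hx
      exact (Finset.prod_eq_zero (Finset.mem_univ i) (Set.indicator_of_notMem hi _)).symm
  simp_rw [this]
  have h2 := lintegral_prod_eq_prod_lintegral_of_indepFun Finset.univ
    (fun i (x : ∀ i, E i) => (s i).indicator (f i) (x i)) hind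
    (fun i => ((hf i).indicator (hs i)).comp (measurable_pi_apply i))
  rw [h2]
  refine Finset.prod_congr rfl fun i _ => ?_
  rw [withDensity_apply _ (hs i), ← lintegral_indicator (hs i)]
  exact (measurePreserving_eval μ i).lintegral_comp ((hf i).indicator (hs i))

lemma aux_gauss_density (m : ℝ) (v : NNReal) (hv : v ≠ 0) :
    gaussianReal m v = (gaussianReal 0 v).withDensity
      (fun x => ENNReal.ofReal (Real.exp (m * x / v - m ^ 2 / (2 * v)))) := by
  rw [gaussianReal_of_var_ne_zero _ hv, gaussianReal_of_var_ne_zero _ hv, ← withDensity_mul]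
  · congr 1
    ext x
    simp only [gaussianPDF, Pi.mul_apply, gaussianPDFReal]
    rw [← ENNReal.ofReal_mul (by positivity), mul_assoc (_)⁻¹ (Real.exp _), ← Real.exp_add]
    congr 3
    have : (v : ℝ) ≠ 0 := by exact_mod_cast hv
    field_simp
    ring
  · exact measurable_gaussianPDF _ _
  · fun_prop

lemma aux_lawY_density (p n : ℕ) (σ : ℝ) (hσ : 0 < σ) (θ : Fin p → ℝ) (η : Fin n → ℝ) :
    lawY p n σ θ η = (lawW p n σ).withDensity (fun y => ENNReal.ofReal
      (∏ i, ∏ j, Real.exp (θ i * η j * y i j / σ ^ 2 - (θ i * η j) ^ 2 / (2 * σ ^ 2)))) := by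
  have hv : (σ ^ 2).toNNReal ≠ 0 := by
    simp only [ne_eq, Real.toNNReal_eq_zero, not_le]; positivity
  have hv' : (((σ ^ 2).toNNReal : NNReal) : ℝ) = σ ^ 2 := Real.coe_toNNReal _ (by positivity)
  have h1 : ∀ i : Fin p, (Measure.pi fun j => gaussianReal (θ i * η j) (σ ^ 2).toNNReal)
      = (Measure.pi fun _ : Fin n => gaussianReal 0 (σ ^ 2).toNNReal).withDensity
        (fun y => ∏ j, ENNReal.ofReal
          (Real.exp (θ i * η j * y j / σ ^ 2 - (θ i * η j) ^ 2 / (2 * σ ^ 2)))) := by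
    intro i
    have h0 : ∀ j, gaussianReal (θ i * η j) (σ ^ 2).toNNReal
        = (gaussianReal 0 (σ ^ 2).toNNReal).withDensity (fun x => ENNReal.ofReal
          (Real.exp (θ i * η j * x / σ ^ 2 - (θ i * η j) ^ 2 / (2 * σ ^ 2)))) := by
      intro j
      rw [aux_gauss_density (θ i * η j) _ hv, hv']
    have : ∀ j, SigmaFinite ((gaussianReal 0 (σ ^ 2).toNNReal).withDensity (fun x => ENNReal.ofReal
          (Real.exp (θ i * η j * x / σ ^ 2 - (θ i * η j) ^ 2 / (2 * σ ^ 2))))) := by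
      intro j; rw [← h0 j]; infer_instance
    rw [← aux_pi_withDensity (fun _ : Fin n => gaussianReal 0 (σ ^ 2).toNNReal)
      (fun j x => ENNReal.ofReal
          (Real.exp (θ i * η j * x / σ ^ 2 - (θ i * η j) ^ 2 / (2 * σ ^ 2))))
      (fun j => by fun_prop)]
    congr 1
    ext1 j
    exact h0 j
  have : ∀ i, SigmaFinite ((Measure.pi fun _ : Fin n => gaussianReal 0 (σ ^ 2).toNNReal).withDensity
        (fun y => ∏ j, ENNReal.ofReal
          (Real.exp (θ i * η j * y j / σ ^ 2 - (θ i * η j) ^ 2 / (2 * σ ^ 2))))) := by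
    intro i; rw [← h1 i]; infer_instance
  have h2 := aux_pi_withDensity
    (fun _ : Fin p => Measure.pi fun _ : Fin n => gaussianReal 0 (σ ^ 2).toNNReal)
    (fun i y => ∏ j, ENNReal.ofReal
          (Real.exp (θ i * η j * y j / σ ^ 2 - (θ i * η j) ^ 2 / (2 * σ ^ 2))))
    (fun i => by fun_prop)
  unfold lawY lawW
  simp_rw [h1]
  rw [h2]
  congr 1
  ext y
  rw [ENNReal.ofReal_prod_of_nonneg (fun i _ => by positivity)]
  refine Finset.prod_congr rfl fun i _ => ?_
  rw [ENNReal.ofReal_prod_of_nonneg (fun i _ => by positivity)]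

instance aux_lawW_prob (p n : ℕ) (σ : ℝ) : IsProbabilityMeasure (lawW p n σ) := by
  unfold lawW; infer_instance

instance aux_lawY_prob (p n : ℕ) (σ : ℝ) (θ : Fin p → ℝ) (η : Fin n → ℝ) :
    IsProbabilityMeasure (lawY p n σ θ η) := by
  unfold lawY; infer_instance

lemma aux_integral_lawY (p n : ℕ) (σ : ℝ) (hσ : 0 < σ) (θ : Fin p → ℝ) (η : Fin n → ℝ)
    (F : (Fin p → Fin n → ℝ) → ℝ) :
    ∫ y, F y ∂(lawY p n σ θ η) = ∫ y, (∏ i, ∏ j, Real.exp (θ i * η j * y i j / σ ^ 2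
      - (θ i * η j) ^ 2 / (2 * σ ^ 2))) * F y ∂(lawW p n σ) := by
  rw [aux_lawY_density p n σ hσ, integral_withDensity_eq_integral_toReal_smul (by fun_prop)
    (by simp)]
  refine integral_congr_ae (Eventually.of_forall fun y => ?_)
  simp only [smul_eq_mul]
  rw [ENNReal.toReal_ofReal (Finset.prod_nonneg fun i _ => Finset.prod_nonneg fun j _ =>
    (Real.exp_pos _).le)]

/-- Row measure. -/
def rowM (n : ℕ) (σ : ℝ) : Measure (Fin n → ℝ) :=
  Measure.pi fun _ => gaussianReal 0 (σ ^ 2).toNNReal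

instance aux_rowM_prob (n : ℕ) (σ : ℝ) : IsProbabilityMeasure (rowM n σ) := by
  unfold rowM; infer_instance

lemma aux_lawW_eq (p n : ℕ) (σ : ℝ) : lawW p n σ = Measure.pi fun _ : Fin p => rowM n σ := rfl

lemma aux_row_exp (n : ℕ) (σ : ℝ) (b : Fin n → ℝ) :
    Integrable (fun y : Fin n → ℝ => Real.exp (∑ j, b j * y j)) (rowM n σ) ∧
    ∫ y, Real.exp (∑ j, b j * y j) ∂(rowM n σ) = Real.exp (σ ^ 2 * (∑ j, b j ^ 2) / 2) := by
  have hv' : (((σ ^ 2).toNNReal : NNReal) : ℝ) = σ ^ 2 := Real.coe_toNNReal _ (by positivity)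
  simp_rw [Real.exp_sum]
  constructor
  · exact Integrable.fintype_prod (f := fun j x => Real.exp (b j * x))
      (fun j => integrable_exp_mul_gaussianReal (b j))
  · unfold rowM
    rw [integral_fintype_prod_eq_prod (fun j x => Real.exp (b j * x)), Finset.mul_sum,
      Finset.sum_div, Real.exp_sum]
    refine Finset.prod_congr rfl fun j _ => ?_
    have := congrFun (mgf_id_gaussianReal (μ := 0) (v := (σ ^ 2).toNNReal)) (b j)
    simp only [mgf, id] at this
    rw [this, hv']
    congr 1; ring

lemma aux_mat_prod_int (p n : ℕ) (σ : ℝ) (g : Fin p → (Fin n → ℝ) → ℝ)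
    (hg : ∀ i, Integrable (g i) (rowM n σ)) :
    Integrable (fun y : Fin p → Fin n → ℝ => ∏ i, g i (y i)) (lawW p n σ) := by
  rw [aux_lawW_eq]
  exact Integrable.fintype_prod (E := Fin n → ℝ) (μ := fun _ : Fin p => rowM n σ) (f := g) hg

lemma aux_mat_prod (p n : ℕ) (σ : ℝ) (g : Fin p → (Fin n → ℝ) → ℝ) :
    ∫ y : Fin p → Fin n → ℝ, ∏ i, g i (y i) ∂(lawW p n σ) = ∏ i, ∫ x, g i x ∂(rowM n σ) := by
  rw [aux_lawW_eq]
  exact integral_fintype_prod_eq_prod (E := fun _ => Fin n → ℝ) (μ := fun _ : Fin p => rowM n σ) g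

lemma aux_mat_exp (p n : ℕ) (σ : ℝ) (b : Fin p → Fin n → ℝ) :
    Integrable (fun y : Fin p → Fin n → ℝ => Real.exp (∑ i, ∑ j, b i j * y i j)) (lawW p n σ) ∧
    ∫ y, Real.exp (∑ i, ∑ j, b i j * y i j) ∂(lawW p n σ)
      = Real.exp (σ ^ 2 * (∑ i, ∑ j, b i j ^ 2) / 2) := by
  have hE : (fun y : Fin p → Fin n → ℝ => Real.exp (∑ i, ∑ j, b i j * y i j))
      = fun y => ∏ i, Real.exp (∑ j, b i j * y i j) := by
    ext y; rw [Real.exp_sum]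
  rw [hE]
  constructor
  · exact aux_mat_prod_int p n σ (fun i x => Real.exp (∑ j, b i j * x j))
      (fun i => (aux_row_exp n σ (b i)).1)
  · rw [aux_mat_prod p n σ (fun i x => Real.exp (∑ j, b i j * x j)), Finset.mul_sum,
      Finset.sum_div, Real.exp_sum]
    refine Finset.prod_congr rfl fun j _ => ?_
    rw [(aux_row_exp n σ (b j)).2]

/-- law of a signed sum of a row -/
lemma aux_row_law (n : ℕ) (σ : ℝ) (u : Fin n → ℝ) (hu : u ∈ pmOne n) :
    (rowM n σ).map (fun y => ∑ j, y j * u j) = gaussianReal 0 (n * σ ^ 2).toNNReal := by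
  have hv' : (((σ ^ 2).toNNReal : NNReal) : ℝ) = σ ^ 2 := Real.coe_toNNReal _ (by positivity)
  have hv2 : (((n * σ ^ 2).toNNReal : NNReal) : ℝ) = n * σ ^ 2 := Real.coe_toNNReal _ (by positivity)
  have hm : Measurable (fun y : Fin n → ℝ => ∑ j, y j * u j) := by fun_prop
  have : IsProbabilityMeasure ((rowM n σ).map (fun y => ∑ j, y j * u j)) :=
    Measure.isProbabilityMeasure_map hm.aemeasurable
  refine Measure.ext_of_charFun ?_
  ext t
  rw [charFun_apply_real, integral_map hm.aemeasurable (by fun_prop), charFun_gaussianReal]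
  have : ∀ y : Fin n → ℝ, Complex.exp (t * ((∑ j, y j * u j : ℝ) : ℂ) * Complex.I)
      = ∏ j, Complex.exp (((t * u j : ℝ) : ℂ) * (y j : ℂ) * Complex.I) := by
    intro y
    rw [← Complex.exp_sum]
    congr 1
    push_cast
    rw [Finset.mul_sum, Finset.sum_mul]
    refine Finset.sum_congr rfl fun j _ => ?_
    ring
  simp_rw [this]
  unfold rowM
  rw [integral_fintype_prod_eq_prod (fun j (x : ℝ) => Complex.exp (((t * u j : ℝ) : ℂ) * (x : ℂ) * Complex.I))]
  simp_rw [← charFun_apply_real, charFun_gaussianReal, ← Complex.exp_sum]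
  congr 1
  have h2 : ∀ j, (u j : ℂ) ^ 2 = 1 := by
    intro j
    rcases hu j with h | h <;> simp [h]
  have e1 : (((σ ^ 2).toNNReal : ℝ) : ℂ) = (σ : ℂ) ^ 2 := by rw [hv']; push_cast; rfl
  have e2 : (((n * σ ^ 2).toNNReal : ℝ) : ℂ) = n * (σ : ℂ) ^ 2 := by rw [hv2]; push_cast; rfl
  rw [e1, e2]
  have : ∀ j, (((t * u j : ℝ) : ℂ) * ((0 : ℝ) : ℂ) * Complex.I - (σ : ℂ) ^ 2 * ((t * u j : ℝ) : ℂ) ^ 2 / 2)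
      = - ((σ : ℂ) ^ 2 * (t : ℂ) ^ 2 / 2) := by
    intro j
    push_cast
    rw [mul_pow, h2 j]; ring
  simp_rw [this]
  simp
  ring

lemma aux_row_cosh (n : ℕ) (σ : ℝ) (b : Fin n → ℝ) :
    Integrable (fun y : Fin n → ℝ => Real.cosh (∑ j, b j * y j)) (rowM n σ) ∧
    ∫ y, Real.cosh (∑ j, b j * y j) ∂(rowM n σ) = Real.exp (σ ^ 2 * (∑ j, b j ^ 2) / 2) := by
  have h1 := aux_row_exp n σ b
  have h2 := aux_row_exp n σ (fun j => - b j)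
  have e : ∀ y : Fin n → ℝ, ∑ j, - b j * y j = - ∑ j, b j * y j := by
    intro y; simp [Finset.sum_neg_distrib]
  simp only [e, neg_sq] at h2
  simp only [Real.cosh_eq]
  constructor
  · exact (h1.1.add h2.1).div_const 2
  · rw [integral_div, integral_add h1.1 h2.1, h1.2, h2.2]; ring

/-- row mixture density -/
def rowMix (n : ℕ) (κ α : ℝ) (η : Fin n → ℝ) (y : Fin n → ℝ) : ℝ :=
  Real.exp (-(n * α)) * Real.cosh (∑ j, κ * η j * y j)

lemma aux_rowMix_pos (n : ℕ) (κ α : ℝ) (η y : Fin n → ℝ) : 0 < rowMix n κ α η y :=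
  mul_pos (Real.exp_pos _) (Real.cosh_pos _)

lemma aux_rowMix_meas (n : ℕ) (κ α : ℝ) (η : Fin n → ℝ) : Measurable (rowMix n κ α η) := by
  unfold rowMix
  have : Measurable Real.cosh := Real.continuous_cosh.measurable
  fun_prop

lemma aux_sq_one {n : ℕ} {η : Fin n → ℝ} (h : η ∈ pmOne n) (j : Fin n) : η j ^ 2 = 1 := by
  rcases h j with h | h <;> simp [h]

lemma aux_rowMix_int (n : ℕ) (σ κ α : ℝ) (hα : α = σ ^ 2 * κ ^ 2 / 2) (η : Fin n → ℝ)
    (hη : η ∈ pmOne n) :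
    Integrable (rowMix n κ α η) (rowM n σ) ∧ ∫ y, rowMix n κ α η y ∂(rowM n σ) = 1 := by
  have h := aux_row_cosh n σ (fun j => κ * η j)
  unfold rowMix
  refine ⟨h.1.const_mul _, ?_⟩
  rw [integral_const_mul, h.2, ← Real.exp_add, ← Real.exp_zero]
  congr 1
  simp_rw [mul_pow, aux_sq_one hη]
  simp [hα]
  ring

lemma aux_sqrt_bound (A B : ℝ) (hA : 1 ≤ A) (hB : 1 ≤ B) :
    A * B - (2 * A - 2) * (2 * B - 2) ≤ Real.sqrt (A ^ 2 + B ^ 2 - 1) := by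
  by_cases hX : A * B - (2 * A - 2) * (2 * B - 2) ≤ 0
  · exact hX.trans (Real.sqrt_nonneg _)
  · push Not at hX
    apply Real.le_sqrt_of_sq_le
    obtain ⟨s, rfl⟩ : ∃ s, A = 1 + s := ⟨A - 1, by ring⟩
    obtain ⟨t, rfl⟩ : ∃ t, B = 1 + t := ⟨B - 1, by ring⟩
    have hs : 0 ≤ s := by linarith
    have ht : 0 ≤ t := by linarith
    have hst := mul_nonneg hs ht
    have h3 : 0 ≤ 1 + s + t - 3 * (s * t) := by nlinarith
    have h4 := mul_nonneg hst h3
    nlinarith [mul_nonneg hst hs, mul_nonneg hst ht]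

lemma aux_cosh_cosh (u v : ℝ) :
    Real.cosh (u + v) * Real.cosh (v - u) = Real.cosh u ^ 2 + Real.cosh v ^ 2 - 1 := by
  rw [Real.cosh_add, Real.cosh_sub]
  have h1 := Real.cosh_sq u
  have h2 := Real.cosh_sq v
  have : (Real.cosh u * Real.cosh v + Real.sinh u * Real.sinh v) *
    (Real.cosh v * Real.cosh u - Real.sinh v * Real.sinh u)
     = Real.cosh u ^ 2 * Real.cosh v ^ 2 - Real.sinh u ^ 2 * Real.sinh v ^ 2 := by ring
  rw [this, h1, h2]; ring

lemma aux_lin4 {X : Type*} [MeasurableSpace X] {μ : Measure X} [IsProbabilityMeasure μ]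
    {f g h k : X → ℝ} (hf : Integrable f μ) (hg : Integrable g μ) (hh : Integrable h μ)
    (hk : Integrable k μ) :
    ∫ x, (f x + g x) / 2 * (-3) + 4 * h x + 4 * k x - 4 ∂μ
      = (∫ x, f x ∂μ + ∫ x, g x ∂μ) / 2 * (-3) + 4 * ∫ x, h x ∂μ + 4 * ∫ x, k x ∂μ - 4 := by
  have h1 : Integrable (fun x => (f x + g x) / 2 * (-3)) μ :=
    ((hf.add hg).div_const 2).mul_const (-3)
  have h2 : Integrable (fun x => 4 * h x) μ := hh.const_mul 4
  have h3 : Integrable (fun x => 4 * k x) μ := hk.const_mul 4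
  have h4 : Integrable (fun x => (f x + g x) / 2 * (-3) + 4 * h x) μ := h1.add h2
  have h5 : Integrable (fun x => (f x + g x) / 2 * (-3) + 4 * h x + 4 * k x) μ := h4.add h3
  rw [integral_sub h5 (integrable_const 4), integral_add h4 h3, integral_add h1 h2,
    integral_mul_const, integral_div, integral_add hf hg, integral_const_mul, integral_const_mul]
  simp

/-- Row affinity bounds. -/
lemma aux_row_aff (n : ℕ) (σ κ α : ℝ) (hα : α = σ ^ 2 * κ ^ 2 / 2)
    (η : Fin n → ℝ) (hη : η ∈ pmOne n) (j : Fin n) :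
    Integrable (fun y => Real.sqrt (rowMix n κ α η y * rowMix n κ α (Function.update η j (-η j)) y))
      (rowM n σ) ∧
    Real.exp (-α) ≤ ∫ y, Real.sqrt (rowMix n κ α η y * rowMix n κ α (Function.update η j (-η j)) y)
      ∂(rowM n σ) ∧
    1 - 4 * (1 - Real.exp (-α)) * (1 - Real.exp (-((n - 1) * α))) ≤
      ∫ y, Real.sqrt (rowMix n κ α η y * rowMix n κ α (Function.update η j (-η j)) y)
      ∂(rowM n σ) := by
  set η' := Function.update η j (-η j) with hη'
  have hη'm : η' ∈ pmOne n := by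
    intro i
    by_cases h : i = j
    · subst h; rcases hη i with h | h <;> simp [hη', h]
    · simp only [hη', Function.update_of_ne h]; exact hη i
  set bu : Fin n → ℝ := fun k => if k = j then κ * η j else 0 with hbu
  set bv : Fin n → ℝ := fun k => if k = j then 0 else κ * η k with hbv
  have eplus : ∀ y : Fin n → ℝ, ∑ k, κ * η k * y k = ∑ k, bu k * y k + ∑ k, bv k * y k := by
    intro y
    rw [← Finset.sum_add_distrib]
    refine Finset.sum_congr rfl fun k _ => ?_
    by_cases h : k = j
    · subst h; simp [hbu, hbv]
    · simp [hbu, hbv, h]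
  have eminus : ∀ y : Fin n → ℝ, ∑ k, κ * η' k * y k = ∑ k, bv k * y k - ∑ k, bu k * y k := by
    intro y
    rw [← Finset.sum_sub_distrib]
    refine Finset.sum_congr rfl fun k _ => ?_
    by_cases h : k = j
    · subst h; simp [hbu, hbv, hη']
    · simp [hbu, hbv, hη', h]
  have hprod : ∀ y, Real.sqrt (rowMix n κ α η y * rowMix n κ α η' y)
      = Real.exp (-(n * α)) * Real.sqrt (Real.cosh (∑ k, bu k * y k) ^ 2
        + Real.cosh (∑ k, bv k * y k) ^ 2 - 1) := by
    intro y
    unfold rowMix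
    rw [eplus, eminus, ← aux_cosh_cosh, mul_mul_mul_comm, Real.sqrt_mul (by positivity),
      Real.sqrt_mul_self (Real.exp_pos _).le]
  have hint : Integrable (fun y => Real.sqrt (rowMix n κ α η y * rowMix n κ α η' y)) (rowM n σ) := by
    refine Integrable.mono' ((aux_rowMix_int n σ κ α hα η hη).1.add
      (aux_rowMix_int n σ κ α hα η' hη'm).1) ?_ (Eventually.of_forall fun y => ?_)
    · exact (((aux_rowMix_meas n κ α η).mul (aux_rowMix_meas n κ α η')).sqrt).aestronglyMeasurable
    · have h1 := aux_rowMix_pos n κ α η y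
      have h2 := aux_rowMix_pos n κ α η' y
      rw [Real.norm_of_nonneg (Real.sqrt_nonneg _)]
      simp only [Pi.add_apply]
      rw [Real.sqrt_le_left (by positivity)]
      nlinarith [mul_pos h1 h2, sq_nonneg (rowMix n κ α η y), sq_nonneg (rowMix n κ α η' y)]
  have hU := aux_row_cosh n σ bu
  have hV := aux_row_cosh n σ bv
  have hcard : (n : ℝ) = 1 + (n - 1) := by ring
  have sU : σ ^ 2 * (∑ k, bu k ^ 2) / 2 = α := by
    have : ∑ k, bu k ^ 2 = κ ^ 2 := by
      rw [Finset.sum_eq_single j]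
      · simp [hbu, mul_pow, aux_sq_one hη]
      · intro k _ h; simp [hbu, h]
      · simp
    rw [this, hα]
  have sV : σ ^ 2 * (∑ k, bv k ^ 2) / 2 = (n - 1) * α := by
    have : ∑ k, bv k ^ 2 = (n - 1) * κ ^ 2 := by
      have h1 : ∀ k, bv k ^ 2 = κ ^ 2 - if k = j then κ ^ 2 else 0 := by
        intro k
        by_cases h : k = j
        · simp [hbv, h]
        · simp [hbv, h, mul_pow, aux_sq_one hη]
      simp_rw [h1]
      rw [Finset.sum_sub_distrib]
      simp
      ring
    rw [this, hα]; ring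
  rw [sU] at hU
  rw [sV] at hV
  have hP := aux_row_cosh n σ (fun k => κ * η k)
  have hM := aux_row_cosh n σ (fun k => κ * η' k)
  have sP : σ ^ 2 * (∑ k, (κ * η k) ^ 2) / 2 = n * α := by
    simp_rw [mul_pow, aux_sq_one hη]; simp [hα]; ring
  have sM : σ ^ 2 * (∑ k, (κ * η' k) ^ 2) / 2 = n * α := by
    simp_rw [mul_pow, aux_sq_one hη'm]; simp [hα]; ring
  rw [sP] at hP
  rw [sM] at hM
  have hUV : ∀ y : Fin n → ℝ, Real.cosh (∑ k, bu k * y k) * Real.cosh (∑ k, bv k * y k)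
      = (Real.cosh (∑ k, κ * η k * y k) + Real.cosh (∑ k, κ * η' k * y k)) / 2 := by
    intro y
    rw [eplus, eminus, Real.cosh_add, Real.cosh_sub]; ring
  refine ⟨hint, ?_, ?_⟩
  · have h1 : ∫ y, Real.exp (-(n * α)) * Real.cosh (∑ k, bv k * y k) ∂(rowM n σ)
        = Real.exp (-α) := by
      rw [integral_const_mul, hV.2, ← Real.exp_add]
      congr 1; ring
    rw [← h1]
    refine integral_mono (hV.1.const_mul _) hint fun y => ?_
    simp only [hprod]
    refine mul_le_mul_of_nonneg_left ?_ (Real.exp_pos _).le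
    apply Real.le_sqrt_of_sq_le
    nlinarith [Real.one_le_cosh (∑ k, bu k * y k)]
  · have hI : Integrable (fun y => Real.exp (-(n * α)) *
        ((Real.cosh (∑ k, κ * η k * y k) + Real.cosh (∑ k, κ * η' k * y k)) / 2 * (-3)
          + 4 * Real.cosh (∑ k, bu k * y k) + 4 * Real.cosh (∑ k, bv k * y k) - 4)) (rowM n σ) := by
      refine Integrable.const_mul ?_ _
      exact (((((hP.1.add hM.1).div_const 2).mul_const (-3)).add (hU.1.const_mul 4)).add
        (hV.1.const_mul 4)).sub (integrable_const 4)
    have h1 : ∫ y, Real.exp (-(n * α)) *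
        ((Real.cosh (∑ k, κ * η k * y k) + Real.cosh (∑ k, κ * η' k * y k)) / 2 * (-3)
          + 4 * Real.cosh (∑ k, bu k * y k) + 4 * Real.cosh (∑ k, bv k * y k) - 4) ∂(rowM n σ)
        = 1 - 4 * (1 - Real.exp (-α)) * (1 - Real.exp (-((n - 1) * α))) := by
      rw [integral_const_mul, aux_lin4 hP.1 hM.1 hU.1 hV.1, hP.2, hM.2, hU.2, hV.2]
      have e1 : Real.exp (-(n * α)) * Real.exp (n * α) = 1 := by rw [← Real.exp_add]; simp
      have e2 : Real.exp (-(n * α)) = Real.exp (-α) * Real.exp (-((n - 1) * α)) := by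
        rw [← Real.exp_add]; congr 1; ring
      have e3 : Real.exp (-α) * Real.exp α = 1 := by rw [← Real.exp_add]; simp
      have e4 : Real.exp (-((n - 1) * α)) * Real.exp ((n - 1) * α) = 1 := by
        rw [← Real.exp_add]; simp
      have e5 : Real.exp (n * α) = Real.exp α * Real.exp ((n - 1) * α) := by
        rw [← Real.exp_add]; congr 1; ring
      rw [e5, e2]
      set x := Real.exp (-α)
      set X := Real.exp α
      set z := Real.exp (-((n - 1) * α))
      set Z := Real.exp ((n - 1) * α)
      have : x * z * ((X * Z + X * Z) / 2 * -3 + 4 * X + 4 * Z - 4)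
        = (x * X) * (z * Z) * (-3) + 4 * (x * X) * z + 4 * x * (z * Z) - 4 * (x * z) := by ring
      rw [this, e3, e4]; ring
    rw [← h1]
    refine integral_mono hI hint fun y => ?_
    simp only [hprod]
    refine mul_le_mul_of_nonneg_left ?_ (Real.exp_pos _).le
    have := aux_sqrt_bound _ _ (Real.one_le_cosh (∑ k, bu k * y k)) (Real.one_le_cosh (∑ k, bv k * y k))
    rw [← hUV]
    linarith

lemma aux_exp_lower (x : ℝ) (h0 : 0 ≤ x) (h : x ≤ 1 / 2) : Real.exp (-(2 * x)) ≤ 1 - x := by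
  have h1 := Real.add_one_le_exp (2 * x)
  rw [Real.exp_neg, inv_le_comm₀ (Real.exp_pos _) (by linarith)]
  refine le_trans ?_ h1
  rw [inv_le_iff_one_le_mul₀ (by linarith)]
  nlinarith

lemma aux_numeric (p n : ℕ) (hp : 1 ≤ p) (hn : 2 ≤ n) (σ Δ α ρ : ℝ) (hσ : 0 < σ) (hΔ : 0 < Δ)
    (hα : α = Δ ^ 2 / σ ^ 2 / (2 * p)) (h1 : Real.exp (-α) ≤ ρ)
    (h2 : 1 - 4 * (1 - Real.exp (-α)) * (1 - Real.exp (-((n - 1) * α))) ≤ ρ) :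
    Real.exp (-(4 * snr p n σ Δ ^ 2)) ≤ ρ ^ p := by
  have hp' : (1 : ℝ) ≤ p := by exact_mod_cast hp
  have hn' : (2 : ℝ) ≤ n := by exact_mod_cast hn
  have hd : 0 < Δ ^ 2 / σ ^ 2 := by positivity
  set d := Δ ^ 2 / σ ^ 2 with hd_def
  have hαpos : 0 < α := by rw [hα]; positivity
  have hr : snr p n σ Δ ^ 2 = d ^ 2 / (d + p / n) := by
    unfold snr
    rw [← hd_def, div_pow, Real.sq_sqrt (by positivity)]
  have h3 : Real.exp (-(8 * n * α ^ 2)) ≤ ρ := by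
    by_cases ha : α ≤ 1 / 8
    · have e1 : 0 ≤ 1 - Real.exp (-α) := by
        have := Real.exp_le_one_iff.2 (by linarith : -α ≤ 0); linarith
      have e1' : 1 - Real.exp (-α) ≤ α := by linarith [Real.add_one_le_exp (-α)]
      have hmα : 0 ≤ (n - 1) * α := by apply mul_nonneg <;> linarith
      have e2 : 0 ≤ 1 - Real.exp (-((n - 1) * α)) := by
        have := Real.exp_le_one_iff.2 (by linarith : -((n - 1) * α) ≤ 0); linarith
      have e2' : 1 - Real.exp (-((n - 1) * α)) ≤ (n - 1) * α := by
        linarith [Real.add_one_le_exp (-((n - 1) * α))]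
      have e3 : 1 - Real.exp (-((n - 1) * α)) ≤ 1 := by linarith [Real.exp_pos (-((n - 1) * α))]
      set x := 4 * (1 - Real.exp (-α)) * (1 - Real.exp (-((n - 1) * α)))
      have hx0 : 0 ≤ x := by positivity
      have hx1 : x ≤ 1 / 2 := by
        have : x ≤ 4 * (1 - Real.exp (-α)) * 1 := mul_le_mul_of_nonneg_left e3 (by positivity)
        linarith
      have hx2 : x ≤ 4 * α * ((n - 1) * α) :=
        mul_le_mul (by linarith) e2' e2 (by positivity)
      refine le_trans ?_ h2
      refine le_trans ?_ (aux_exp_lower x hx0 hx1)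
      apply Real.exp_le_exp.2
      nlinarith
    · push Not at ha
      refine le_trans ?_ h1
      apply Real.exp_le_exp.2
      have : α ≤ 8 * α ^ 2 := by nlinarith
      nlinarith
  by_cases hc : (p : ℝ) / n ≤ d
  · calc Real.exp (-(4 * snr p n σ Δ ^ 2)) ≤ Real.exp (-α) ^ p := by
          rw [← Real.exp_nat_mul]
          apply Real.exp_le_exp.2
          have e : (p : ℝ) * -α = -(d / 2) := by rw [hα]; field_simp
          rw [e, hr]
          have : d / 2 ≤ d ^ 2 / (d + p / n) := by
            rw [div_le_div_iff₀ (by norm_num) (by positivity)]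
            nlinarith
          have h0 : 0 ≤ d ^ 2 / (d + p / n) := by positivity
          linarith
      _ ≤ ρ ^ p := pow_le_pow_left₀ (Real.exp_pos _).le h1 p
  · push Not at hc
    calc Real.exp (-(4 * snr p n σ Δ ^ 2)) ≤ Real.exp (-(8 * n * α ^ 2)) ^ p := by
          rw [← Real.exp_nat_mul]
          apply Real.exp_le_exp.2
          have e : (p : ℝ) * -(8 * n * α ^ 2) = -(4 * (d ^ 2 / (2 * (p / n)))) := by
            rw [hα]; field_simp; ring
          rw [e, hr]
          have : d ^ 2 / (2 * (p / n)) ≤ d ^ 2 / (d + p / n) := by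
            apply div_le_div_of_nonneg_left (by positivity) (by positivity)
            linarith
          linarith
      _ ≤ ρ ^ p := pow_le_pow_left₀ (Real.exp_pos _).le h3 p

lemma aux_abs_le {n : ℕ} {a b : Fin n → ℝ} (ha : a ∈ pmOne n) (hb : b ∈ pmOne n) :
    |∑ j, a j * b j| ≤ n := by
  refine (Finset.abs_sum_le_sum_abs _ _).trans ?_
  have : ∀ j, |a j * b j| = 1 := by
    intro j
    rcases ha j with h | h <;> rcases hb j with h' | h' <;> simp [h, h']
  simp [this]

lemma aux_loss {n : ℕ} {a b : Fin n → ℝ} (ha : a ∈ pmOne n) (hb : b ∈ pmOne n) :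
    lossR a b = n - |∑ j, a j * b j| := by
  have h1 : ∀ j, |a j - b j| = 1 - a j * b j := by
    intro j
    rcases ha j with h | h <;> rcases hb j with h' | h' <;> rw [h, h'] <;> norm_num
  have h2 : ∀ j, |a j + b j| = 1 + a j * b j := by
    intro j
    rcases ha j with h | h <;> rcases hb j with h' | h' <;> rw [h, h'] <;> norm_num
  unfold lossR
  simp_rw [h1, h2, Finset.sum_sub_distrib, Finset.sum_add_distrib]
  simp only [sum_const, card_univ, Fintype.card_fin, nsmul_eq_mul, mul_one]
  rcases le_total 0 (∑ j, a j * b j) with h | h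
  · rw [abs_of_nonneg h, min_eq_left (by linarith)]
  · rw [abs_of_nonpos h, min_eq_right (by linarith)]; ring

lemma aux_loss_meas {n : ℕ} {X : Type*} [MeasurableSpace X] {G : X → Fin n → ℝ} (hG : Measurable G)
    (b : Fin n → ℝ) : Measurable (fun y => lossR (G y) b) := by
  unfold lossR
  have : ∀ j, Measurable (fun y => G y j) := fun j => (measurable_pi_apply j).comp hG
  refine Measurable.min ?_ ?_
  · refine Finset.measurable_sum _ fun j _ => ?_
    exact ((this j).sub_const _).abs
  · refine Finset.measurable_sum _ fun j _ => ?_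
    exact ((this j).add_const _).abs

lemma aux_bdd_int {X : Type*} [MeasurableSpace X] {μ : Measure X} [IsProbabilityMeasure μ]
    {f : X → ℝ} (hf : Measurable f) (C : ℝ) (h : ∀ x, |f x| ≤ C) : Integrable f μ :=
  Integrable.of_bound hf.aestronglyMeasurable C (Eventually.of_forall h)

lemma aux_loss_int {n : ℕ} {X : Type*} [MeasurableSpace X] {μ : Measure X} [IsProbabilityMeasure μ]
    {G : X → Fin n → ℝ} (hG : Measurable G) (hGm : ∀ y, G y ∈ pmOne n) {b : Fin n → ℝ}
    (hb : b ∈ pmOne n) : Integrable (fun y => lossR (G y) b) μ := by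
  refine aux_bdd_int (aux_loss_meas hG b) n fun y => ?_
  rw [aux_loss (hGm y) hb, abs_of_nonneg (by linarith [aux_abs_le (hGm y) hb])]
  linarith [abs_nonneg (∑ j, G y j * b j)]

lemma aux_loss_lower {n : ℕ} (hn : 2 ≤ n) {a b : Fin n → ℝ} (ha : a ∈ pmOne n) (hb : b ∈ pmOne n) :
    ((n : ℝ) ^ 2)⁻¹ * ∑ j, ∑ k, (1 - a j * b j * (a k * b k)) / 2 ≤ (n : ℝ)⁻¹ * lossR a b := by
  have h0 : (0 : ℝ) < n := by positivity
  have h1 : ∑ j, ∑ k, (1 - a j * b j * (a k * b k)) / 2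
      = ((n : ℝ) ^ 2 - (∑ j, a j * b j) ^ 2) / 2 := by
    rw [sq (∑ j, a j * b j), Finset.sum_mul_sum]
    simp_rw [sub_div, Finset.sum_sub_distrib, ← Finset.sum_div]
    simp
    ring
  rw [h1, aux_loss ha hb]
  have h2 := aux_abs_le ha hb
  rw [← sq_abs (∑ j, a j * b j)]
  set c := |∑ j, a j * b j|
  rw [inv_mul_le_iff₀ (by positivity)]
  have : (n : ℝ) ^ 2 * ((n : ℝ)⁻¹ * (n - c)) = n * (n - c) := by field_simp
  rw [this]
  nlinarith [sq_nonneg (n - c)]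

/-- Mixture density -/
def matMix (p n : ℕ) (κ α : ℝ) (η : Fin n → ℝ) (y : Fin p → Fin n → ℝ) : ℝ :=
  ∏ i, rowMix n κ α η (y i)

lemma aux_matMix_pos (p n : ℕ) (κ α : ℝ) (η : Fin n → ℝ) (y : Fin p → Fin n → ℝ) :
    0 < matMix p n κ α η y := Finset.prod_pos fun _ _ => aux_rowMix_pos _ _ _ _ _

lemma aux_matMix_int (p n : ℕ) (σ κ α : ℝ) (hα : α = σ ^ 2 * κ ^ 2 / 2) (η : Fin n → ℝ)
    (hη : η ∈ pmOne n) :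
    Integrable (matMix p n κ α η) (lawW p n σ) ∧ ∫ y, matMix p n κ α η y ∂(lawW p n σ) = 1 := by
  have h := aux_rowMix_int n σ κ α hα η hη
  constructor
  · exact aux_mat_prod_int p n σ (fun _ => rowMix n κ α η) (fun _ => h.1)
  · unfold matMix
    rw [aux_mat_prod p n σ (fun _ => rowMix n κ α η)]
    simp [h.2]

lemma aux_int_mul_bdd {X : Type*} [MeasurableSpace X] {μ : Measure X} {f e : X → ℝ}
    (hf : Integrable f μ) (he : Measurable e) (C : ℝ) (h : ∀ x, |e x| ≤ C) :
    Integrable (fun x => f x * e x) μ :=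
  hf.mul_bdd (c := C) he.aestronglyMeasurable (Eventually.of_forall h)

/-- Two point lower bound -/
lemma aux_two_point (p n : ℕ) (hp : 1 ≤ p) (hn : 2 ≤ n) (σ Δ κ α : ℝ) (hσ : 0 < σ) (hΔ : 0 < Δ)
    (hα : α = σ ^ 2 * κ ^ 2 / 2) (hα' : α = Δ ^ 2 / σ ^ 2 / (2 * p)) (η : Fin n → ℝ)
    (hη : η ∈ pmOne n) (j : Fin n) (hη' : Function.update η j (-η j) ∈ pmOne n)
    (e : (Fin p → Fin n → ℝ) → ℝ) (he : Measurable e) (he0 : ∀ y, 0 ≤ e y) (he1 : ∀ y, e y ≤ 1) :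
    Real.exp (-(4 * snr p n σ Δ ^ 2)) ^ 2 / 2 ≤
      ∫ y, matMix p n κ α η y * e y ∂(lawW p n σ)
      + ∫ y, matMix p n κ α (Function.update η j (-η j)) y * (1 - e y) ∂(lawW p n σ) := by
  set η' := Function.update η j (-η j) with hη'def
  have hr := aux_row_aff n σ κ α hα η hη j
  rw [← hη'def] at hr
  set ρ := ∫ y, Real.sqrt (rowMix n κ α η y * rowMix n κ α η' y) ∂(rowM n σ) with hρ
  have hA := aux_numeric p n hp hn σ Δ α ρ hσ hΔ hα' hr.2.1 hr.2.2
  have hI1 := aux_matMix_int p n σ κ α hα η hη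
  have hI2 := aux_matMix_int p n σ κ α hα η' hη'
  have hsq : ∀ y : Fin p → Fin n → ℝ, Real.sqrt (matMix p n κ α η y * matMix p n κ α η' y)
      = ∏ i, Real.sqrt (rowMix n κ α η (y i) * rowMix n κ α η' (y i)) := by
    intro y
    unfold matMix
    rw [← Finset.prod_mul_distrib, Real.sqrt_prod]
    intro i _
    exact (mul_pos (aux_rowMix_pos _ _ _ _ _) (aux_rowMix_pos _ _ _ _ _)).le
  have hsi : Integrable (fun y => Real.sqrt (matMix p n κ α η y * matMix p n κ α η' y))
      (lawW p n σ) := by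
    simp_rw [hsq]
    exact aux_mat_prod_int p n σ (fun _ x => Real.sqrt (rowMix n κ α η x * rowMix n κ α η' x))
      (fun _ => hr.1)
  have hsI : ∫ y, Real.sqrt (matMix p n κ α η y * matMix p n κ α η' y) ∂(lawW p n σ) = ρ ^ p := by
    simp_rw [hsq]
    rw [aux_mat_prod p n σ (fun _ x => Real.sqrt (rowMix n κ α η x * rowMix n κ α η' x))]
    simp [hρ]
  have hJ1 : Integrable (fun y => matMix p n κ α η y * e y) (lawW p n σ) :=
    aux_int_mul_bdd hI1.1 he 1 fun y => by rw [abs_of_nonneg (he0 y)]; exact he1 y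
  have hJ2 : Integrable (fun y => matMix p n κ α η' y * (1 - e y)) (lawW p n σ) :=
    aux_int_mul_bdd hI2.1 (he.const_sub 1) 1 fun y => by
      rw [abs_of_nonneg (by linarith [he1 y])]; linarith [he0 y]
  set A := Real.exp (-(4 * snr p n σ Δ ^ 2)) with hAdef
  have hApos : 0 < A := Real.exp_pos _
  rw [← integral_add hJ1 hJ2]
  have hadd : Integrable (fun y => matMix p n κ α η y + matMix p n κ α η' y) (lawW p n σ) :=
    hI1.1.add hI2.1
  have hK : Integrable (fun y => A * Real.sqrt (matMix p n κ α η y * matMix p n κ α η' y)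
      - A ^ 2 / 4 * (matMix p n κ α η y + matMix p n κ α η' y)) (lawW p n σ) :=
    (hsi.const_mul _).sub (hadd.const_mul _)
  calc A ^ 2 / 2 ≤ A * ρ ^ p - A ^ 2 / 4 * (1 + 1) := by nlinarith
    _ = ∫ y, (A * Real.sqrt (matMix p n κ α η y * matMix p n κ α η' y)
      - A ^ 2 / 4 * (matMix p n κ α η y + matMix p n κ α η' y)) ∂(lawW p n σ) := by
        rw [integral_sub (hsi.const_mul _) (hadd.const_mul _), integral_const_mul,
          integral_const_mul, hsI, integral_add hI1.1 hI2.1, hI1.2, hI2.2]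
    _ ≤ _ := by
        refine integral_mono hK (hJ1.add hJ2) fun y => ?_
        simp only [Pi.add_apply]
        set P := matMix p n κ α η y
        set Q := matMix p n κ α η' y
        have hP : 0 < P := aux_matMix_pos _ _ _ _ _ _
        have hQ : 0 < Q := aux_matMix_pos _ _ _ _ _ _
        rw [Real.sqrt_mul hP.le]
        have hP2 : Real.sqrt P ^ 2 = P := Real.sq_sqrt hP.le
        have hQ2 : Real.sqrt Q ^ 2 = Q := Real.sq_sqrt hQ.le
        have k1 : A * (Real.sqrt P * Real.sqrt Q) ≤ P + A ^ 2 / 4 * Q := by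
          nlinarith [sq_nonneg (Real.sqrt P - A / 2 * Real.sqrt Q)]
        have k2 : A * (Real.sqrt P * Real.sqrt Q) ≤ Q + A ^ 2 / 4 * P := by
          nlinarith [sq_nonneg (Real.sqrt Q - A / 2 * Real.sqrt P)]
        have k3 := mul_le_mul_of_nonneg_left k1 (he0 y)
        have k4 := mul_le_mul_of_nonneg_left k2 (by linarith [he1 y] : 0 ≤ 1 - e y)
        have k5 : 0 ≤ A ^ 2 / 4 * (e y * P + (1 - e y) * Q) := by
          have := he0 y
          have := he1 y
          have h6 : 0 ≤ (1 - e y) * Q := mul_nonneg (by linarith) hQ.le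
          positivity
        nlinarith

/-- sign vector -/
def sgV {m : ℕ} (b : Fin m → Bool) (j : Fin m) : ℝ := if b j then 1 else -1

lemma aux_sgV_mem {m : ℕ} (b : Fin m → Bool) : sgV b ∈ pmOne m := by
  intro j; unfold sgV; by_cases h : b j <;> simp [h]

/-- likelihood -/
def lik (p n : ℕ) (σ : ℝ) (θ : Fin p → ℝ) (η : Fin n → ℝ) (y : Fin p → Fin n → ℝ) : ℝ :=
  ∏ i, ∏ j, Real.exp (θ i * η j * y i j / σ ^ 2 - (θ i * η j) ^ 2 / (2 * σ ^ 2))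

lemma aux_lik_int (p n : ℕ) (σ : ℝ) (θ : Fin p → ℝ) (η : Fin n → ℝ) :
    Integrable (lik p n σ θ η) (lawW p n σ) := by
  have h := (aux_mat_exp p n σ (fun i j => θ i * η j / σ ^ 2)).1.const_mul
    (Real.exp (- ∑ i, ∑ j, (θ i * η j) ^ 2 / (2 * σ ^ 2)))
  refine h.congr (Eventually.of_forall fun y => ?_)
  unfold lik
  simp only
  simp_rw [← Real.exp_sum]
  rw [← Real.exp_add]
  congr 1
  simp_rw [Finset.sum_sub_distrib]
  rw [neg_add_eq_sub]
  congr 1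
  refine Finset.sum_congr rfl fun i _ => Finset.sum_congr rfl fun j _ => ?_
  ring

lemma aux_mixture (p n : ℕ) (σ a κ α : ℝ) (hσ : 0 < σ) (hκ : κ = a / σ ^ 2)
    (hα : α = σ ^ 2 * κ ^ 2 / 2) (η : Fin n → ℝ) (hη : η ∈ pmOne n) (y : Fin p → Fin n → ℝ) :
    ∑ s : Fin p → Bool, lik p n σ (fun i => a * sgV s i) η y = 2 ^ p * matMix p n κ α η y := by
  have h1 : ∀ (b : Bool) (i : Fin p),
      ∏ j, Real.exp ((a * if b then 1 else -1) * η j * y i j / σ ^ 2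
        - ((a * if b then 1 else -1) * η j) ^ 2 / (2 * σ ^ 2))
      = Real.exp (-(n * α)) * Real.exp ((if b then 1 else -1) * ∑ j, κ * η j * y i j) := by
    intro b i
    rw [← Real.exp_sum, ← Real.exp_add]
    congr 1
    rw [Finset.sum_sub_distrib]
    have hq : ∀ j, ((a * if b then 1 else -1) * η j) ^ 2 / (2 * σ ^ 2) = α := by
      intro j
      rw [mul_pow, aux_sq_one hη]
      have : ((if b then (1 : ℝ) else -1)) ^ 2 = 1 := by cases b <;> simp
      rw [mul_pow, this, hα, hκ]
      field_simp
    simp_rw [hq]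
    rw [sub_eq_neg_add]
    congr 1
    · simp
    · rw [Finset.mul_sum]
      refine Finset.sum_congr rfl fun j _ => ?_
      rw [hκ]; ring
  have h2 : 2 ^ p * matMix p n κ α η y = ∏ i : Fin p, ∑ b : Bool,
      ∏ j, Real.exp ((a * if b then 1 else -1) * η j * y i j / σ ^ 2
        - ((a * if b then 1 else -1) * η j) ^ 2 / (2 * σ ^ 2)) := by
    simp_rw [h1]
    unfold matMix rowMix
    have : (2 : ℝ) ^ p = ∏ _i : Fin p, 2 := by simp
    rw [this, ← Finset.prod_mul_distrib]
    refine Finset.prod_congr rfl fun i _ => ?_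
    rw [Real.cosh_eq]
    simp
    ring
  rw [h2, Finset.prod_univ_sum, Fintype.piFinset_univ]
  rfl

lemma aux_theta_norm (p : ℕ) (hp : 1 ≤ p) (Δ : ℝ) (hΔ : 0 < Δ) (s : Fin p → Bool) :
    eucNorm (fun i => Δ / Real.sqrt p * sgV s i) = Δ := by
  have hp' : (0 : ℝ) < p := by exact_mod_cast hp
  unfold eucNorm
  simp_rw [mul_pow, aux_sq_one (aux_sgV_mem s), div_pow, Real.sq_sqrt hp'.le]
  simp only [mul_one, sum_const, card_univ, Fintype.card_fin, nsmul_eq_mul]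
  rw [mul_div_cancel₀ _ hp'.ne', Real.sqrt_sq hΔ.le]

/-- Main lower bound. -/
lemma aux_lower (p n : ℕ) (hp : 1 ≤ p) (hn : 2 ≤ n) (σ Δ S : ℝ) (hσ : 0 < σ) (hΔ : 0 < Δ)
    (G : (Fin p → Fin n → ℝ) → Fin n → ℝ) (hG : Measurable G) (hGm : ∀ y, G y ∈ pmOne n)
    (hS : ∀ x : Omega p n Δ, (n : ℝ)⁻¹ * risk p n σ G x.1.1 x.1.2 ≤ S) :
    Real.exp (-(4 * snr p n σ Δ ^ 2)) ^ 2 / 8 ≤ S := by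
  have hp' : (0 : ℝ) < p := by exact_mod_cast hp
  have hn' : (2 : ℝ) ≤ n := by exact_mod_cast hn
  set a := Δ / Real.sqrt p with ha
  set κ := a / σ ^ 2 with hκ
  set α := σ ^ 2 * κ ^ 2 / 2 with hα
  have hα' : α = Δ ^ 2 / σ ^ 2 / (2 * p) := by
    rw [hα, hκ, ha, div_pow, div_pow, Real.sq_sqrt hp'.le]; field_simp
  set A := Real.exp (-(4 * snr p n σ Δ ^ 2)) with hA
  set e : Fin n → Fin n → (Fin n → Bool) → (Fin p → Fin n → ℝ) → ℝ := fun j k b y =>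
    (1 - G y j * sgV b j * (G y k * sgV b k)) / 2 with he
  have hGj : ∀ j, Measurable (fun y => G y j) := fun j => (measurable_pi_apply j).comp hG
  have heM : ∀ j k b, Measurable (e j k b) := by
    intro j k b
    simp only [he]
    have := hGj j
    have := hGj k
    fun_prop
  have he01 : ∀ j k b y, 0 ≤ e j k b y ∧ e j k b y ≤ 1 := by
    intro j k b y
    simp only [he]
    rcases hGm y j with h1 | h1 <;> rcases hGm y k with h2 | h2 <;>
      rcases aux_sgV_mem b j with h3 | h3 <;> rcases aux_sgV_mem b k with h4 | h4 <;>
      rw [h1, h2, h3, h4] <;> norm_num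
  have heB : ∀ j k b y, |e j k b y| ≤ 1 := by
    intro j k b y
    rw [abs_of_nonneg (he01 j k b y).1]; exact (he01 j k b y).2
  have hmixI : ∀ b : Fin n → Bool, Integrable (matMix p n κ α (sgV b)) (lawW p n σ) :=
    fun b => (aux_matMix_int p n σ κ α hα (sgV b) (aux_sgV_mem b)).1
  set φ : Fin n → Fin n → (Fin n → Bool) → ℝ := fun j k b =>
    ∫ y, matMix p n κ α (sgV b) y * e j k b y ∂(lawW p n σ) with hφ
  have step1 : ∀ b : Fin n → Bool, ((n : ℝ) ^ 2)⁻¹ * ∑ j, ∑ k, φ j k b ≤ S := by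
    intro b
    have h1 : ∀ s : Fin p → Bool,
        ∫ y, lik p n σ (fun i => a * sgV s i) (sgV b) y * (((n : ℝ) ^ 2)⁻¹ * ∑ j, ∑ k, e j k b y)
          ∂(lawW p n σ) ≤ S := by
      intro s
      have h2 := hS ⟨(fun i => a * sgV s i, sgV b), by
        refine ⟨?_, aux_sgV_mem b⟩
        exact (aux_theta_norm p hp Δ hΔ s).ge⟩
      refine le_trans ?_ h2
      have h3 := aux_integral_lawY p n σ hσ (fun i => a * sgV s i) (sgV b)
        (fun y => ((n : ℝ) ^ 2)⁻¹ * ∑ j, ∑ k, e j k b y)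
      unfold lik
      rw [← h3]
      unfold risk
      rw [← integral_const_mul]
      refine integral_mono ?_ ((aux_loss_int hG hGm (aux_sgV_mem b)).const_mul _) fun y => ?_
      · refine Integrable.const_mul ?_ _
        refine integrable_finsetSum _ fun j _ => integrable_finsetSum _ fun k _ => ?_
        exact aux_bdd_int (heM j k b) 1 (heB j k b)
      · exact aux_loss_lower hn (hGm y) (aux_sgV_mem b)
    have hli : ∀ s : Fin p → Bool, Integrable (fun y => lik p n σ (fun i => a * sgV s i) (sgV b) y
        * (((n : ℝ) ^ 2)⁻¹ * ∑ j, ∑ k, e j k b y)) (lawW p n σ) := by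
      intro s
      refine aux_int_mul_bdd (aux_lik_int p n σ _ _) ?_ (((n : ℝ) ^ 2)⁻¹ * ∑ j : Fin n, ∑ k : Fin n, 1) ?_
      · refine Measurable.const_mul ?_ _
        exact Finset.measurable_sum _ fun j _ => Finset.measurable_sum _ fun k _ => heM j k b
      · intro y
        rw [abs_mul, abs_of_nonneg (by positivity : (0 : ℝ) ≤ ((n : ℝ) ^ 2)⁻¹)]
        refine mul_le_mul_of_nonneg_left ?_ (by positivity)
        refine (Finset.abs_sum_le_sum_abs _ _).trans (Finset.sum_le_sum fun j _ => ?_)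
        exact (Finset.abs_sum_le_sum_abs _ _).trans (Finset.sum_le_sum fun k _ => heB j k b y)
    have h4 : ∑ s : Fin p → Bool,
        ∫ y, lik p n σ (fun i => a * sgV s i) (sgV b) y * (((n : ℝ) ^ 2)⁻¹ * ∑ j, ∑ k, e j k b y)
          ∂(lawW p n σ) ≤ 2 ^ p * S := by
      refine (Finset.sum_le_sum fun s _ => h1 s).trans ?_
      simp
    rw [← integral_finsetSum _ fun s _ => hli s] at h4
    simp_rw [← Finset.sum_mul, aux_mixture p n σ a κ α hσ hκ hα (sgV b) (aux_sgV_mem b)] at h4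
    have h5 : ∀ y, 2 ^ p * matMix p n κ α (sgV b) y * (((n : ℝ) ^ 2)⁻¹ * ∑ j, ∑ k, e j k b y)
        = 2 ^ p * (((n : ℝ) ^ 2)⁻¹ * ∑ j, ∑ k, matMix p n κ α (sgV b) y * e j k b y) := by
      intro y
      simp_rw [← Finset.mul_sum]
      ring
    simp_rw [h5] at h4
    rw [integral_const_mul, integral_const_mul, integral_finsetSum] at h4
    · have h6 : ∀ j, ∫ y, ∑ k, matMix p n κ α (sgV b) y * e j k b y ∂(lawW p n σ) = ∑ k, φ j k b := by
        intro j
        rw [integral_finsetSum]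
        intro k _
        exact aux_int_mul_bdd (hmixI b) (heM j k b) 1 (heB j k b)
      simp_rw [h6] at h4
      exact le_of_mul_le_mul_left h4 (by positivity)
    · intro j _
      refine integrable_finsetSum _ fun k _ => ?_
      exact aux_int_mul_bdd (hmixI b) (heM j k b) 1 (heB j k b)
  have step2 : ∀ j k, j ≠ k → 2 ^ n * (A ^ 2 / 4) ≤ ∑ b : Fin n → Bool, φ j k b := by
    intro j k hjk
    set fl : (Fin n → Bool) → (Fin n → Bool) := fun b => Function.update b j (!b j) with hfl
    have hinv : Function.Involutive fl := by
      intro b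
      simp [hfl]
    have hs : ∑ b : Fin n → Bool, φ j k (fl b) = ∑ b : Fin n → Bool, φ j k b :=
      Equiv.sum_comp hinv.toPerm (φ j k)
    have hsg : ∀ b, sgV (fl b) = Function.update (sgV b) j (-sgV b j) := by
      intro b
      ext i
      by_cases h : i = j
      · subst h
        simp only [sgV, hfl, Function.update_self]
        cases b i <;> simp
      · simp only [sgV, hfl, Function.update_of_ne h]
    have key : ∀ b, A ^ 2 / 2 ≤ φ j k b + φ j k (fl b) := by
      intro b
      have h1 := aux_two_point p n hp hn σ Δ κ α hσ hΔ hα hα' (sgV b) (aux_sgV_mem b) j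
        (by rw [← hsg]; exact aux_sgV_mem _) (e j k b) (heM j k b) (fun y => (he01 j k b y).1)
        (fun y => (he01 j k b y).2)
      rw [← hsg] at h1
      refine h1.trans (le_of_eq ?_)
      simp only [hφ]
      congr 2
      ext y
      congr 1
      simp only [he]
      rw [hsg]
      simp only [Function.update_self, Function.update_of_ne (Ne.symm hjk)]
      ring
    have h7 : ∑ b : Fin n → Bool, (φ j k b + φ j k (fl b)) = 2 * ∑ b, φ j k b := by
      rw [Finset.sum_add_distrib, hs]; ring
    have h8 : ∑ b : Fin n → Bool, A ^ 2 / 2 ≤ ∑ b : Fin n → Bool, (φ j k b + φ j k (fl b)) :=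
      Finset.sum_le_sum fun b _ => key b
    rw [h7] at h8
    simp at h8
    linarith
  have hφ0 : ∀ j k b, 0 ≤ φ j k b := by
    intro j k b
    exact integral_nonneg fun y => mul_nonneg (aux_matMix_pos _ _ _ _ _ _).le (he01 j k b y).1
  have step3 : ∀ j k, 2 ^ n * ((A ^ 2 / 4) * (1 - if j = k then 1 else 0)) ≤ ∑ b : Fin n → Bool, φ j k b := by
    intro j k
    by_cases h : j = k
    · simp only [h, if_true, sub_self, mul_zero]
      exact Finset.sum_nonneg fun b _ => hφ0 _ _ _
    · simp only [h, if_false, sub_zero, mul_one]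
      exact step2 j k h
  have step4 : ∑ b : Fin n → Bool, ((n : ℝ) ^ 2)⁻¹ * ∑ j, ∑ k, φ j k b ≤ 2 ^ n * S := by
    refine (Finset.sum_le_sum fun b _ => step1 b).trans ?_
    simp
  rw [← Finset.mul_sum, Finset.sum_comm] at step4
  have step5 : 2 ^ n * (A ^ 2 / 4) * (n * (n - 1)) ≤ ∑ j, ∑ b : Fin n → Bool, ∑ k, φ j k b := by
    calc 2 ^ n * (A ^ 2 / 4) * (n * (n - 1))
        = ∑ j : Fin n, ∑ k : Fin n, 2 ^ n * ((A ^ 2 / 4) * (1 - if j = k then 1 else 0)) := by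
          simp_rw [← Finset.mul_sum, Finset.sum_sub_distrib]
          simp
          ring
      _ ≤ ∑ j, ∑ k, ∑ b : Fin n → Bool, φ j k b :=
          Finset.sum_le_sum fun j _ => Finset.sum_le_sum fun k _ => step3 j k
      _ = _ := by
          refine Finset.sum_congr rfl fun j _ => ?_
          rw [Finset.sum_comm]
  have h2n : (0 : ℝ) < 2 ^ n := by positivity
  rw [inv_mul_le_iff₀ (by positivity)] at step4
  have h9 := step5.trans step4
  have h10 : A ^ 2 / 4 * (n * (n - 1)) ≤ n ^ 2 * S := by
    refine le_of_mul_le_mul_left ?_ h2n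
    linarith
  have h11 : (n : ℝ) ^ 2 * (A ^ 2 / 8) ≤ n ^ 2 * S := by
    refine le_trans ?_ h10
    have : 0 ≤ A ^ 2 := sq_nonneg A
    nlinarith [mul_nonneg this (by nlinarith : (0 : ℝ) ≤ n * (n - 2))]
  exact le_of_mul_le_mul_left h11 (by positivity)

/-- squared norm of `Y h` -/
def quadQ {p n : ℕ} (y : Fin p → Fin n → ℝ) (h : Fin n → ℝ) : ℝ := ∑ i, (∑ j, y i j * h j) ^ 2

lemma aux_quadQ_meas {p n : ℕ} {X : Type*} [MeasurableSpace X] {g : X → Fin p → Fin n → ℝ}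
    {h : X → Fin n → ℝ} (hg : Measurable g) (hh : Measurable h) :
    Measurable (fun y => quadQ (g y) (h y)) := by
  unfold quadQ
  have h1 : ∀ i j, Measurable (fun y => g y i j) := fun i j =>
    (measurable_pi_apply j).comp ((measurable_pi_apply i).comp hg)
  have h2 : ∀ j, Measurable (fun y => h y j) := fun j => (measurable_pi_apply j).comp hh
  fun_prop

lemma aux_argmax_fin (p n : ℕ) (s : Finset (Fin n → ℝ)) (hs : s.Nonempty) :
    ∃ f : (Fin p → Fin n → ℝ) → Fin n → ℝ, Measurable f ∧
      ∀ y, f y ∈ s ∧ ∀ h ∈ s, quadQ y h ≤ quadQ y (f y) := by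
  classical
  induction hs using Finset.Nonempty.cons_induction with
  | singleton a => exact ⟨fun _ => a, measurable_const, fun y => by simp⟩
  | cons a s ha hs ih =>
    obtain ⟨f, hf, hf2⟩ := ih
    refine ⟨fun y => if quadQ y (f y) ≤ quadQ y a then a else f y, ?_, ?_⟩
    · refine Measurable.ite ?_ measurable_const hf
      exact measurableSet_le (aux_quadQ_meas measurable_id hf)
        (aux_quadQ_meas measurable_id measurable_const)
    · intro y
      obtain ⟨h1, h2⟩ := hf2 y
      by_cases hc : quadQ y (f y) ≤ quadQ y a
      · simp only [hc, if_true, Finset.mem_cons, true_or, true_and]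
        rintro h (rfl | hh)
        · exact le_rfl
        · exact (h2 h hh).trans hc
      · simp only [hc, if_false, Finset.mem_cons, h1, or_true, true_and]
        rintro h (rfl | hh)
        · exact (not_le.1 hc).le
        · exact h2 h hh

lemma aux_sgV_surj {n : ℕ} {h : Fin n → ℝ} (hh : h ∈ pmOne n) : ∃ b : Fin n → Bool, sgV b = h := by
  classical
  refine ⟨fun j => decide (h j = 1), ?_⟩
  ext j
  unfold sgV
  rcases hh j with h1 | h1
  · simp [h1]
  · simp only [h1]; norm_num

lemma aux_argmax (p n : ℕ) :
    ∃ f : (Fin p → Fin n → ℝ) → Fin n → ℝ, Measurable f ∧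
      ∀ y, f y ∈ pmOne n ∧ ∀ h ∈ pmOne n, quadQ y h ≤ quadQ y (f y) := by
  classical
  obtain ⟨f, hf, h2⟩ := aux_argmax_fin p n (Finset.univ.image (sgV (m := n)))
    (Finset.univ_nonempty.image _)
  refine ⟨f, hf, fun y => ⟨?_, fun h hh => ?_⟩⟩
  · obtain ⟨b, _, hb⟩ := Finset.mem_image.1 (h2 y).1
    rw [← hb]; exact aux_sgV_mem b
  · obtain ⟨b, hb⟩ := aux_sgV_surj hh
    exact (h2 y).2 h (Finset.mem_image.2 ⟨b, Finset.mem_univ _, hb⟩)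

lemma aux_shift_meas (p n : ℕ) (θ : Fin p → ℝ) (η : Fin n → ℝ) :
    Measurable (fun (w : Fin p → Fin n → ℝ) i j => θ i * η j + w i j) := by
  fun_prop

lemma aux_lawY_map (p n : ℕ) (σ : ℝ) (θ : Fin p → ℝ) (η : Fin n → ℝ) :
    lawY p n σ θ η = (lawW p n σ).map (fun w i j => θ i * η j + w i j) := by
  symm
  unfold lawY lawW
  refine MeasurePreserving.map_eq ?_
  refine measurePreserving_pi (β := fun _ : Fin p => Fin n → ℝ) _ _
    (f := fun i (w : Fin n → ℝ) j => θ i * η j + w j) fun i => ?_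
  refine measurePreserving_pi (β := fun _ : Fin n => ℝ) _ _
    (f := fun j (w : ℝ) => θ i * η j + w) fun j => ?_
  refine ⟨by fun_prop, ?_⟩
  rw [gaussianReal_map_const_add]; simp

/-- argmax inequality -/
lemma aux_argmax_ineq (p n : ℕ) (θ : Fin p → ℝ) (η h : Fin n → ℝ) (hη : η ∈ pmOne n)
    (hh : h ∈ pmOne n) (w : Fin p → Fin n → ℝ)
    (hQ : quadQ (fun i j => θ i * η j + w i j) η ≤ quadQ (fun i j => θ i * η j + w i j) h) :
    (∑ i, θ i ^ 2) * ((n : ℝ) ^ 2 - (∑ j, h j * η j) ^ 2)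
      ≤ 4 * n * ∑ j, |∑ i, θ i * w i j| + (quadQ w h - quadQ w η) := by
  have expand : ∀ g : Fin n → ℝ, quadQ (fun i j => θ i * η j + w i j) g
      = (∑ i, θ i ^ 2) * (∑ j, g j * η j) ^ 2
        + 2 * (∑ j, g j * η j) * (∑ j, (∑ i, θ i * w i j) * g j) + quadQ w g := by
    intro g
    unfold quadQ
    have e1 : ∀ i, ∑ j, (θ i * η j + w i j) * g j
        = θ i * (∑ j, g j * η j) + ∑ j, w i j * g j := by
      intro i
      rw [Finset.mul_sum, ← Finset.sum_add_distrib]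
      exact Finset.sum_congr rfl fun j _ => by ring
    have e2 : ∑ j, (∑ i, θ i * w i j) * g j = ∑ i, θ i * ∑ j, w i j * g j := by
      simp_rw [Finset.sum_mul, Finset.mul_sum]
      rw [Finset.sum_comm]
      exact Finset.sum_congr rfl fun i _ => Finset.sum_congr rfl fun j _ => by ring
    rw [e2, Finset.mul_sum, Finset.sum_mul, ← Finset.sum_add_distrib, ← Finset.sum_add_distrib]
    refine Finset.sum_congr rfl fun i _ => ?_
    rw [e1]; ring
  rw [expand, expand] at hQ
  have hn : ∑ j, η j * η j = n := by
    have : ∀ j, η j * η j = 1 := fun j => by rcases hη j with h | h <;> rw [h] <;> norm_num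
    simp [this]
  rw [hn] at hQ
  have hb : ∀ g ∈ pmOne n, |∑ j, (∑ i, θ i * w i j) * g j| ≤ ∑ j, |∑ i, θ i * w i j| := by
    intro g hg
    refine (Finset.abs_sum_le_sum_abs _ _).trans (Finset.sum_le_sum fun j _ => ?_)
    rw [abs_mul]
    rcases hg j with h | h <;> rw [h] <;> simp
  have k1 := hb h hh
  have k2 := hb η hη
  have k3 := aux_abs_le hh hη
  set c := ∑ j, h j * η j
  set A := ∑ j, (∑ i, θ i * w i j) * h j
  set B := ∑ j, (∑ i, θ i * w i j) * η j
  set T := ∑ j, |∑ i, θ i * w i j|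
  have hT : 0 ≤ T := (abs_nonneg _).trans k1
  have m1 : c * A ≤ n * T := (le_abs_self _).trans (by
    rw [abs_mul]; exact mul_le_mul k3 k1 (abs_nonneg _) (by positivity))
  have m2 : -(n * B) ≤ n * T := by
    have : -B ≤ T := (neg_le_abs _).trans k2
    have hn0 : (0 : ℝ) ≤ n := by positivity
    nlinarith
  nlinarith

/-- first absolute moment of a linear form -/
lemma aux_T (p n : ℕ) (σ : ℝ) (hσ : 0 < σ) (θ : Fin p → ℝ) (hθ : 0 < eucNorm θ) (j : Fin n) :
    Integrable (fun w : Fin p → Fin n → ℝ => |∑ i, θ i * w i j|) (lawW p n σ) ∧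
    ∫ w, |∑ i, θ i * w i j| ∂(lawW p n σ) ≤ 2 * σ * eucNorm θ := by
  classical
  have hsq : ∑ i, θ i ^ 2 = eucNorm θ ^ 2 := by
    unfold eucNorm; rw [Real.sq_sqrt (Finset.sum_nonneg fun i _ => sq_nonneg _)]
  set s := σ * eucNorm θ with hs
  have hs0 : 0 < s := mul_pos hσ hθ
  have key : ∀ ε : ℝ, ε ^ 2 = 1 →
      Integrable (fun w : Fin p → Fin n → ℝ => Real.exp (ε * (∑ i, θ i * w i j) / s)) (lawW p n σ) ∧
      ∫ w : Fin p → Fin n → ℝ, Real.exp (ε * (∑ i, θ i * w i j) / s) ∂(lawW p n σ)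
        = Real.exp (1 / 2) := by
    intro ε hε
    have h := aux_mat_exp p n σ (fun i k => if k = j then ε * θ i / s else 0)
    have e1 : ∀ w : Fin p → Fin n → ℝ,
        ∑ i, ∑ k, (if k = j then ε * θ i / s else 0) * w i k = ε * (∑ i, θ i * w i j) / s := by
      intro w
      simp only [ite_mul, zero_mul, Finset.sum_ite_eq', Finset.mem_univ, if_true]
      rw [Finset.mul_sum, Finset.sum_div]
      exact Finset.sum_congr rfl fun i _ => by ring
    have e2 : σ ^ 2 * (∑ i : Fin p, ∑ k : Fin n, (if k = j then ε * θ i / s else 0) ^ 2) / 2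
        = 1 / 2 := by
      have : ∀ i : Fin p, ∑ k : Fin n, (if k = j then ε * θ i / s else 0) ^ 2
          = θ i ^ 2 * (1 / s ^ 2) := by
        intro i
        simp only [ite_pow, ne_eq, OfNat.ofNat_ne_zero, not_false_eq_true, zero_pow,
          Finset.sum_ite_eq', Finset.mem_univ, if_true]
        rw [div_pow, mul_pow, hε]; ring
      simp_rw [this]
      rw [← Finset.sum_mul, hsq, hs]
      field_simp
    simp_rw [e1] at h
    rw [e2] at h
    exact h
  have h1 := key 1 (by norm_num)
  have h2 := key (-1) (by norm_num)
  have hdom : ∀ w : Fin p → Fin n → ℝ, |∑ i, θ i * w i j| ≤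
      s / 2 * (Real.exp (1 * (∑ i, θ i * w i j) / s) + Real.exp (-1 * (∑ i, θ i * w i j) / s)) := by
    intro w
    set x := ∑ i, θ i * w i j
    have hx : x = s * (x / s) := by field_simp
    have e1 : 1 * x / s = x / s := by ring
    have e2 : -1 * x / s = -(x / s) := by ring
    rw [e1, e2]
    rw [hx, abs_mul, abs_of_pos hs0, ← hx]
    have hc : |x / s| ≤ (Real.exp (x / s) + Real.exp (-(x / s))) / 2 := by
      rw [← Real.cosh_eq, ← Real.cosh_abs]
      have := Real.self_le_sinh_iff.2 (abs_nonneg (x / s))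
      exact this.trans (Real.sinh_lt_cosh _).le
    nlinarith
  have hI : Integrable (fun w : Fin p → Fin n → ℝ => s / 2 *
      (Real.exp (1 * (∑ i, θ i * w i j) / s) + Real.exp (-1 * (∑ i, θ i * w i j) / s)))
      (lawW p n σ) := (h1.1.add h2.1).const_mul _
  have hint : Integrable (fun w : Fin p → Fin n → ℝ => |∑ i, θ i * w i j|) (lawW p n σ) := by
    refine hI.mono' (continuous_abs.measurable.comp (by fun_prop)).aestronglyMeasurable (Eventually.of_forall fun w => ?_)
    rw [Real.norm_eq_abs, abs_abs]
    exact hdom w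
  refine ⟨hint, (integral_mono hint hI hdom).trans ?_⟩
  rw [integral_const_mul, integral_add h1.1 h2.1, h1.2, h2.2]
  have he : Real.exp (1 / 2) ≤ 2 := by
    have h3 : Real.exp (1 / 2) ^ 2 = Real.exp 1 := by
      rw [← Real.exp_nat_mul]; norm_num
    nlinarith [Real.exp_one_lt_d9, Real.exp_pos (1 / 2 : ℝ)]
  nlinarith

lemma aux_chi_gauss (v : ℝ) (hv : 0 < v) (l : ℝ) (_hl0 : 0 ≤ l) (hl : l ≤ 1 / 4) :
    Integrable (fun x : ℝ => Real.exp (l * (x ^ 2 / v - 1))) (gaussianReal 0 v.toNNReal) ∧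
    ∫ x, Real.exp (l * (x ^ 2 / v - 1)) ∂(gaussianReal 0 v.toNNReal) ≤ Real.exp (4 * l ^ 2) := by
  have hv0 : v.toNNReal ≠ 0 := by
    simp only [ne_eq, Real.toNNReal_eq_zero, not_le]; exact hv
  have hv' : ((v.toNNReal : NNReal) : ℝ) = v := Real.coe_toNNReal _ hv.le
  set b := (1 - 2 * l) / (2 * v) with hb
  have hb0 : 0 < b := div_pos (by linarith) (by linarith)
  have hpt : ∀ x : ℝ, gaussianPDFReal 0 v.toNNReal x * Real.exp (l * (x ^ 2 / v - 1))
      = (Real.exp (-l) * (Real.sqrt (2 * Real.pi * v))⁻¹) * Real.exp (-b * x ^ 2) := by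
    intro x
    unfold gaussianPDFReal
    rw [hv', mul_assoc, ← Real.exp_add]
    have : -(x - 0) ^ 2 / (2 * v) + l * (x ^ 2 / v - 1) = -l + (-b * x ^ 2) := by
      rw [hb]; field_simp; ring
    rw [this, Real.exp_add]; ring
  have hint : Integrable (fun x : ℝ => gaussianPDFReal 0 v.toNNReal x
      * Real.exp (l * (x ^ 2 / v - 1))) := by
    simp_rw [hpt]
    exact (integrable_exp_neg_mul_sq hb0).const_mul _
  constructor
  · rw [gaussianReal_of_var_ne_zero _ hv0]
    rw [integrable_withDensity_iff_integrable_smul' (measurable_gaussianPDF _ _)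
      (Eventually.of_forall fun x => by simp [gaussianPDF])]
    refine hint.congr (Eventually.of_forall fun x => ?_)
    simp [gaussianPDF, ENNReal.toReal_ofReal (gaussianPDFReal_nonneg _ _ _)]
  · rw [integral_gaussianReal_eq_integral_smul hv0]
    simp_rw [smul_eq_mul, hpt]
    rw [integral_const_mul, integral_gaussian]
    have h1 : (Real.sqrt (2 * Real.pi * v))⁻¹ * Real.sqrt (Real.pi / b)
        = (Real.sqrt (1 - 2 * l))⁻¹ := by
      rw [← Real.sqrt_inv, ← Real.sqrt_inv, ← Real.sqrt_mul (by positivity)]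
      congr 1
      rw [hb]
      have := Real.pi_pos
      have : 1 - 2 * l ≠ 0 := by linarith
      field_simp
    rw [mul_assoc, h1, ← Real.sqrt_inv]
    have h2 : (1 - 2 * l)⁻¹ ≤ Real.exp (2 * l + 8 * l ^ 2) := by
      rw [inv_le_iff_one_le_mul₀ (by linarith)]
      have := Real.add_one_le_exp (2 * l + 8 * l ^ 2)
      have h3 : 1 ≤ (2 * l + 8 * l ^ 2 + 1) * (1 - 2 * l) := by nlinarith [sq_nonneg l]
      nlinarith
    have h4 : Real.sqrt ((1 - 2 * l)⁻¹) ≤ Real.exp (l + 4 * l ^ 2) := by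
      rw [Real.sqrt_le_left (Real.exp_pos _).le, ← Real.exp_nat_mul]
      refine h2.trans (le_of_eq ?_)
      congr 1; push_cast; ring
    calc Real.exp (-l) * Real.sqrt ((1 - 2 * l)⁻¹) ≤ Real.exp (-l) * Real.exp (l + 4 * l ^ 2) := by
          gcongr
      _ = _ := by rw [← Real.exp_add]; congr 1; ring

lemma aux_chi (p n : ℕ) (hn : 1 ≤ n) (σ : ℝ) (hσ : 0 < σ) (u : Fin n → ℝ) (hu : u ∈ pmOne n)
    (l : ℝ) (hl0 : 0 ≤ l) (hl : l ≤ 1 / 4) :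
    Integrable (fun w : Fin p → Fin n → ℝ => Real.exp (l * (quadQ w u / (n * σ ^ 2) - p)))
      (lawW p n σ) ∧
    ∫ w : Fin p → Fin n → ℝ, Real.exp (l * (quadQ w u / (n * σ ^ 2) - p)) ∂(lawW p n σ)
      ≤ Real.exp (4 * p * l ^ 2) := by
  have hn' : (0 : ℝ) < n := by exact_mod_cast hn
  have hv : 0 < (n : ℝ) * σ ^ 2 := by positivity
  have h := aux_chi_gauss _ hv l hl0 hl
  have hm : Measurable (fun y : Fin n → ℝ => ∑ j, y j * u j) := by fun_prop
  rw [← aux_row_law n σ u hu] at h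
  rw [integrable_map_measure (by fun_prop) hm.aemeasurable,
    integral_map hm.aemeasurable (by fun_prop)] at h
  have hE : (fun w : Fin p → Fin n → ℝ => Real.exp (l * (quadQ w u / (n * σ ^ 2) - p)))
      = fun w => ∏ i, Real.exp (l * ((∑ j, w i j * u j) ^ 2 / (n * σ ^ 2) - 1)) := by
    ext w
    rw [← Real.exp_sum, ← Finset.mul_sum, Finset.sum_sub_distrib, ← Finset.sum_div]
    simp [quadQ]
  rw [hE]
  refine ⟨aux_mat_prod_int p n σ
    (fun _ y => Real.exp (l * ((∑ j, y j * u j) ^ 2 / (n * σ ^ 2) - 1))) (fun _ => h.1), ?_⟩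
  rw [aux_mat_prod p n σ
    (fun _ y => Real.exp (l * ((∑ j, y j * u j) ^ 2 / (n * σ ^ 2) - 1)))]
  rw [Finset.prod_const, Finset.card_univ, Fintype.card_fin]
  refine (pow_le_pow_left₀ (integral_nonneg fun y => (Real.exp_pos _).le) h.2 p).trans
    (le_of_eq ?_)
  rw [← Real.exp_nat_mul]
  congr 1; ring

lemma aux_second (p n : ℕ) (σ : ℝ) (u : Fin n → ℝ) (hu : u ∈ pmOne n) :
    Integrable (fun w : Fin p → Fin n → ℝ => quadQ w u) (lawW p n σ) ∧
    ∫ w : Fin p → Fin n → ℝ, quadQ w u ∂(lawW p n σ) = n * p * σ ^ 2 := by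
  have hv : 0 ≤ (n : ℝ) * σ ^ 2 := by positivity
  have h : Integrable (fun x : ℝ => x ^ 2) (gaussianReal 0 ((n : ℝ) * σ ^ 2).toNNReal) ∧
      ∫ x : ℝ, x ^ 2 ∂(gaussianReal 0 ((n : ℝ) * σ ^ 2).toNNReal) = n * σ ^ 2 := by
    have hml : MemLp (id : ℝ → ℝ) 2 (gaussianReal 0 ((n : ℝ) * σ ^ 2).toNNReal) :=
      memLp_id_gaussianReal 2
    refine ⟨hml.integrable_sq, ?_⟩
    have h1 := variance_id_gaussianReal (μ := 0) (v := ((n : ℝ) * σ ^ 2).toNNReal)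
    rw [variance_eq_sub hml] at h1
    have h2 := integral_id_gaussianReal (μ := 0) (v := ((n : ℝ) * σ ^ 2).toNNReal)
    simp only [id, Pi.pow_apply] at h1 h2
    rw [h2, Real.coe_toNNReal _ hv] at h1
    simpa using h1
  have hm : Measurable (fun y : Fin n → ℝ => ∑ j, y j * u j) := by fun_prop
  rw [← aux_row_law n σ u hu] at h
  rw [integrable_map_measure (by fun_prop) hm.aemeasurable,
    integral_map hm.aemeasurable (by fun_prop)] at h
  have hev : ∀ i : Fin p, MeasurePreserving (fun w : Fin p → Fin n → ℝ => w i) (lawW p n σ)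
      (rowM n σ) := fun i => by
    rw [aux_lawW_eq]
    exact measurePreserving_eval (fun _ : Fin p => rowM n σ) i
  have hi : ∀ i : Fin p, Integrable (fun w : Fin p → Fin n → ℝ => (∑ j, w i j * u j) ^ 2)
      (lawW p n σ) := fun i => by
    have := (hev i).integrable_comp_of_integrable h.1
    exact this
  have hI : ∀ i : Fin p, ∫ w : Fin p → Fin n → ℝ, (∑ j, w i j * u j) ^ 2 ∂(lawW p n σ)
      = n * σ ^ 2 := fun i => by
    rw [← h.2, ← (hev i).map_eq, integral_map (hev i).measurable.aemeasurable
      (hm.pow_const 2).aestronglyMeasurable]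
  unfold quadQ
  refine ⟨integrable_finsetSum _ fun i _ => hi i, ?_⟩
  rw [integral_finsetSum _ fun i _ => hi i]
  simp_rw [hI]
  simp only [sum_const, card_univ, Fintype.card_fin, nsmul_eq_mul]
  ring

/-- The main upper bound. -/
lemma aux_upper (p n : ℕ) (hp : 1 ≤ p) (hn : 1 ≤ n) (σ Δ : ℝ) (hσ : 0 < σ) (hΔ : 0 < Δ)
    (f : (Fin p → Fin n → ℝ) → Fin n → ℝ) (hf : Measurable f) (hfm : ∀ y, f y ∈ pmOne n)
    (hmax : ∀ y, ∀ h ∈ pmOne n, quadQ y h ≤ quadQ y (f y))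
    (θ : Fin p → ℝ) (η : Fin n → ℝ) (hθ : Δ ≤ eucNorm θ) (hη : η ∈ pmOne n) :
    (n : ℝ)⁻¹ * risk p n σ f θ η ≤
      8 * (σ / eucNorm θ) + 5 * (1 + Real.sqrt ((p : ℝ) / n)) * (σ / eucNorm θ) ^ 2 := by
  have hn' : (0 : ℝ) < n := by exact_mod_cast hn
  have hp' : (0 : ℝ) < p := by exact_mod_cast hp
  set q := Real.sqrt ((p : ℝ) / n) with hq
  have hq0 : 0 ≤ q := Real.sqrt_nonneg _
  have hq2 : (p : ℝ) = n * q ^ 2 := by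
    rw [hq, Real.sq_sqrt (by positivity)]; field_simp
  set N := eucNorm θ with hN
  have hN0 : 0 < N := hΔ.trans_le hθ
  have hsq : ∑ i, θ i ^ 2 = N ^ 2 := by
    rw [hN]; unfold eucNorm; rw [Real.sq_sqrt (Finset.sum_nonneg fun i _ => sq_nonneg _)]
  set l := 1 / 4 / (1 + q) with hl
  have hl0 : 0 < l := by positivity
  have hl1 : l ≤ 1 / 4 := by
    rw [hl, div_le_iff₀ (by positivity)]; linarith
  set L := n * Real.log 2 + 4 * p * l ^ 2 with hL
  set g : (Fin p → Fin n → ℝ) → Fin n → ℝ := fun w => f (fun i j => θ i * η j + w i j) with hg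
  have hgm : Measurable g := hf.comp (aux_shift_meas p n θ η)
  have hgp : ∀ w, g w ∈ pmOne n := fun w => hfm _
  have hrisk : risk p n σ f θ η = ∫ w, lossR (g w) η ∂(lawW p n σ) := by
    unfold risk
    rw [aux_lawY_map, integral_map (aux_shift_meas p n θ η).aemeasurable
      (aux_loss_meas hf η).aestronglyMeasurable]
  have hchi := fun b : Fin n → Bool => aux_chi p n hn σ hσ (sgV b) (aux_sgV_mem b) l hl0.le hl1
  have hsec := aux_second p n σ η hη
  have hT := fun j : Fin n => aux_T p n σ hσ θ hN0 j
  set S : (Fin p → Fin n → ℝ) → ℝ := fun w =>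
    ∑ b : Fin n → Bool, Real.exp (l * (quadQ w (sgV b) / (n * σ ^ 2) - p)) with hS
  have hSi : Integrable S (lawW p n σ) := integrable_finsetSum _ fun b _ => (hchi b).1
  have hSI : ∫ w, S w ∂(lawW p n σ) ≤ Real.exp L := by
    rw [hS, integral_finsetSum _ fun b _ => (hchi b).1]
    refine (Finset.sum_le_sum fun b _ => (hchi b).2).trans (le_of_eq ?_)
    simp only [sum_const, card_univ, Fintype.card_fun, Fintype.card_fin, Fintype.card_bool,
      nsmul_eq_mul]
    rw [hL, Real.exp_add, Real.exp_nat_mul, Real.exp_log (by norm_num)]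
    push_cast; ring
  have hQ : ∀ w, quadQ w (g w) ≤ n * σ ^ 2 * (p + (L - 1 + Real.exp (-L) * S w) / l) := by
    intro w
    obtain ⟨b, hb⟩ := aux_sgV_surj (hgp w)
    set X := quadQ w (g w) / (n * σ ^ 2) - p with hX
    have h1 : Real.exp (l * X) ≤ S w := by
      rw [hS, hX, ← hb]
      exact Finset.single_le_sum (f := fun b : Fin n → Bool =>
        Real.exp (l * (quadQ w (sgV b) / (n * σ ^ 2) - p))) (fun b _ => (Real.exp_pos _).le)
        (Finset.mem_univ b)
    have h2 := Real.add_one_le_exp (l * X - L)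
    have h3 : Real.exp (l * X - L) ≤ Real.exp (-L) * S w := by
      rw [sub_eq_add_neg, add_comm, Real.exp_add]; gcongr
    have h4 : X ≤ (L - 1 + Real.exp (-L) * S w) / l := by
      rw [le_div_iff₀ hl0]; linarith
    have h5 : quadQ w (g w) = n * σ ^ 2 * (p + X) := by rw [hX]; field_simp; ring
    rw [h5]
    gcongr
  set R : (Fin p → Fin n → ℝ) → ℝ := fun w => 4 * n * ∑ j, |∑ i, θ i * w i j| +
    (n * σ ^ 2 * (p + (L - 1 + Real.exp (-L) * S w) / l) - quadQ w η) with hR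
  have hpt : ∀ w, N ^ 2 * n * lossR (g w) η ≤ R w := by
    intro w
    have h1 := aux_argmax_ineq p n θ η (g w) hη (hgp w) w (hmax _ η hη)
    rw [hsq] at h1
    have h2 := aux_abs_le (hgp w) hη
    rw [aux_loss (hgp w) hη]
    have h3 := hQ w
    have h4 : (n : ℝ) * (n - |∑ j, g w j * η j|) ≤ n ^ 2 - (∑ j, g w j * η j) ^ 2 := by
      rw [← sq_abs (∑ j, g w j * η j)]
      nlinarith [abs_nonneg (∑ j, g w j * η j)]
    have h5 := mul_le_mul_of_nonneg_left h4 (sq_nonneg N)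
    rw [hR]
    simp only
    linarith
  have hTi : Integrable (fun w : Fin p → Fin n → ℝ => ∑ j : Fin n, |∑ i, θ i * w i j|)
      (lawW p n σ) := integrable_finsetSum _ fun j _ => (hT j).1
  have hTI : ∫ w : Fin p → Fin n → ℝ, ∑ j : Fin n, |∑ i, θ i * w i j| ∂(lawW p n σ)
      ≤ n * (2 * σ * N) := by
    rw [integral_finsetSum _ fun j _ => (hT j).1]
    refine (Finset.sum_le_sum fun j _ => (hT j).2).trans (le_of_eq ?_)
    simp [hN]
  have hUi : Integrable (fun w => n * σ ^ 2 * (p + (L - 1 + Real.exp (-L) * S w) / l))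
      (lawW p n σ) :=
    ((integrable_const _).add (((integrable_const _).add (hSi.const_mul _)).div_const _)).const_mul _
  have hUI : ∫ w, n * σ ^ 2 * (p + (L - 1 + Real.exp (-L) * S w) / l) ∂(lawW p n σ)
      ≤ n * σ ^ 2 * (p + L / l) := by
    have e1 : ∀ w, n * σ ^ 2 * (p + (L - 1 + Real.exp (-L) * S w) / l)
        = n * σ ^ 2 * (p + (L - 1) / l) + n * σ ^ 2 / l * Real.exp (-L) * S w := by
      intro w; field_simp; ring
    simp_rw [e1]
    rw [integral_add (integrable_const _) (hSi.const_mul _),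
      integral_const_mul (n * σ ^ 2 / l * Real.exp (-L)) S]
    simp only [integral_const, probReal_univ, one_smul]
    have e2 : Real.exp (-L) * ∫ w, S w ∂(lawW p n σ) ≤ 1 := by
      calc _ ≤ Real.exp (-L) * Real.exp L := by gcongr
        _ = 1 := by rw [← Real.exp_add]; simp
    have e3 : n * σ ^ 2 / l * (Real.exp (-L) * ∫ w, S w ∂(lawW p n σ)) ≤ n * σ ^ 2 / l * 1 := by
      gcongr
    have e4 : n * σ ^ 2 * (p + L / l) = n * σ ^ 2 * (p + (L - 1) / l) + n * σ ^ 2 / l * 1 := by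
      field_simp; ring
    rw [e4, mul_assoc (n * σ ^ 2 / l)]
    linarith
  have hRi : Integrable R (lawW p n σ) := (hTi.const_mul _).add (hUi.sub hsec.1)
  have hmain : N ^ 2 * n * risk p n σ f θ η ≤ 4 * n * (n * (2 * σ * N)) + n * σ ^ 2 * (L / l) := by
    rw [hrisk, ← integral_const_mul]
    refine (integral_mono ((aux_loss_int hgm hgp hη).const_mul _) hRi hpt).trans ?_
    have hUs : Integrable (fun w => n * σ ^ 2 * (p + (L - 1 + Real.exp (-L) * S w) / l)
      - quadQ w η) (lawW p n σ) := hUi.sub hsec.1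
    rw [hR, integral_add (hTi.const_mul _) hUs, integral_sub hUi hsec.1, hsec.2,
      integral_const_mul]
    have := mul_le_mul_of_nonneg_left hTI (by positivity : (0 : ℝ) ≤ 4 * n)
    linarith
  have hLl : L / l ≤ 5 * n * (1 + q) := by
    have e1 : L / l = 4 * Real.log 2 * n * (1 + q) + n * (q ^ 2 / (1 + q)) := by
      rw [hL, hq2, hl]; field_simp
    have e2 : q ^ 2 / (1 + q) ≤ 1 + q := by
      rw [div_le_iff₀ (by positivity)]; nlinarith
    have e3 : (n : ℝ) * (q ^ 2 / (1 + q)) ≤ n * (1 + q) := by gcongr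
    have e4 := Real.log_two_lt_d9
    have e5 : 4 * Real.log 2 * (n * (1 + q)) ≤ 4 * (n * (1 + q)) := by
      have : 0 ≤ n * (1 + q) := by positivity
      nlinarith
    rw [e1]; linarith
  have hfin : N ^ 2 * n * risk p n σ f θ η ≤ 4 * n * (n * (2 * σ * N))
      + n * σ ^ 2 * (5 * n * (1 + q)) := hmain.trans (by gcongr)
  have e6 : (n : ℝ)⁻¹ * risk p n σ f θ η
      = (N ^ 2 * n * risk p n σ f θ η) / (N ^ 2 * n ^ 2) := by field_simp
  rw [e6, div_le_iff₀ (by positivity)]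
  refine hfin.trans (le_of_eq ?_)
  field_simp
  ring

lemma aux_upper_snr (p n : ℕ) (hp : 1 ≤ p) (hn : 1 ≤ n) (σ Δ : ℝ) (hσ : 0 < σ) (hΔ : 0 < Δ)
    (N : ℝ) (hN : Δ ≤ N) :
    0 < snr p n σ Δ ∧ 8 * (σ / N) + 5 * (1 + Real.sqrt ((p : ℝ) / n)) * (σ / N) ^ 2
      ≤ 13 / snr p n σ Δ + 5 / snr p n σ Δ ^ 2 := by
  have hn' : (0 : ℝ) < n := by exact_mod_cast hn
  have hp' : (0 : ℝ) < p := by exact_mod_cast hp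
  set δ := Δ / σ with hδ
  have hδ0 : 0 < δ := div_pos hΔ hσ
  set q := Real.sqrt ((p : ℝ) / n) with hq
  have hq0 : 0 ≤ q := Real.sqrt_nonneg _
  have hq2 : q ^ 2 = (p : ℝ) / n := Real.sq_sqrt (by positivity)
  have hr : snr p n σ Δ = δ ^ 2 / Real.sqrt (δ ^ 2 + q ^ 2) := by
    unfold snr; rw [hδ, hq2, div_pow]
  set D := Real.sqrt (δ ^ 2 + q ^ 2) with hD
  have hD1 : δ ≤ D := Real.le_sqrt_of_sq_le (by nlinarith)
  have hD2 : q ≤ D := Real.le_sqrt_of_sq_le (by nlinarith)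
  have hD0 : 0 < D := by linarith
  rw [hr]
  refine ⟨by positivity, ?_⟩
  have h1 : σ / N ≤ 1 / δ := by
    rw [hδ, one_div_div]; gcongr
  have h0 : 0 ≤ σ / N := by have : 0 < N := by linarith
                            positivity
  have h2 : 1 / δ ≤ D / δ ^ 2 := by
    rw [div_le_div_iff₀ hδ0 (by positivity)]; nlinarith
  have e1 : 13 / (δ ^ 2 / D) = 13 * (D / δ ^ 2) := by field_simp
  have e2 : 5 / (δ ^ 2 / D) ^ 2 = 5 * (D / δ ^ 2) ^ 2 := by field_simp
  rw [e1, e2]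
  have h3 : (σ / N) ^ 2 ≤ (D / δ ^ 2) ^ 2 := by
    have := h1.trans h2
    gcongr
  have h4 : q * (σ / N) ^ 2 ≤ D / δ ^ 2 := by
    calc q * (σ / N) ^ 2 ≤ D * (1 / δ) ^ 2 := by gcongr
      _ = D / δ ^ 2 := by field_simp
  nlinarith [h1.trans h2]

lemma aux_phic_anti : Antitone Phic := by
  intro s t h
  unfold Phic
  refine ENNReal.toReal_mono (measure_ne_top _ _) (measure_mono fun x hx => ?_)
  exact lt_of_le_of_lt h hx

lemma aux_phic_pos (t : ℝ) : 0 < Phic t := by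
  unfold Phic
  refine ENNReal.toReal_pos (fun h => ?_) (measure_ne_top _ _)
  have h2 : (volume : Measure ℝ) (Set.Ioi t) = 0 :=
    gaussianReal_absolutelyContinuous' 0 (one_ne_zero) h
  simp at h2

lemma aux_phic_tendsto : Tendsto Phic atTop (nhds 0) := by
  have h1 : ∀ t, Phic t = 1 - cdf (gaussianReal 0 1) t := by
    intro t
    rw [cdf_eq_real]
    have : {x : ℝ | t < x} = (Set.Iic t)ᶜ := by ext x; simp
    unfold Phic
    rw [this, ← measureReal_def, probReal_compl_eq_one_sub measurableSet_Iic]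
  have h2 := (tendsto_cdf_atTop (gaussianReal 0 1)).const_sub 1
  rw [sub_self] at h2
  exact h2.congr fun t => (h1 t).symm

lemma aux_phic_iff (r : ℕ → ℝ) :
    Tendsto (fun n => Phic (r n)) atTop (nhds 0) ↔ Tendsto r atTop atTop := by
  constructor
  · intro h
    rw [tendsto_atTop]
    intro C
    filter_upwards [h.eventually (gt_mem_nhds (aux_phic_pos C))] with n hn
    by_contra hc
    exact absurd (aux_phic_anti (not_le.1 hc).le) (not_le.2 hn)
  · intro h
    exact aux_phic_tendsto.comp h

lemma aux_risk_bd (p n : ℕ) (hn : 1 ≤ n) (σ : ℝ) (G : (Fin p → Fin n → ℝ) → Fin n → ℝ)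
    (hG : Measurable G) (hGm : ∀ y, G y ∈ pmOne n) (θ : Fin p → ℝ) (η : Fin n → ℝ)
    (hη : η ∈ pmOne n) : 0 ≤ (n : ℝ)⁻¹ * risk p n σ G θ η ∧ (n : ℝ)⁻¹ * risk p n σ G θ η ≤ 1 := by
  have hn' : (0 : ℝ) < n := by exact_mod_cast hn
  unfold risk
  constructor
  · refine mul_nonneg (by positivity) (integral_nonneg fun y => ?_)
    simp only [Pi.zero_apply]
    rw [aux_loss (hGm y) hη]
    linarith [aux_abs_le (hGm y) hη]
  · rw [inv_mul_le_iff₀ hn', mul_one]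
    calc _ ≤ ∫ _, (n : ℝ) ∂(lawY p n σ θ η) := by
          refine integral_mono (aux_loss_int hG hGm hη) (integrable_const _) fun y => ?_
          simp only
          rw [aux_loss (hGm y) hη]
          linarith [abs_nonneg (∑ j, G y j * η j)]
      _ = n := by simp

/-- Theorem 6(i): almost full recovery is possible iff `Φᶜ(r_n) → 0`. -/
theorem statement10 (p : ℕ → ℕ) (σ Δ : ℕ → ℝ)
    (hp : ∀ n, 1 ≤ p n) (hσ : ∀ n, 0 < σ n) (hΔ : ∀ n, 0 < Δ n) :
    (∃ est : (n : ℕ) → (Fin (p n) → Fin n → ℝ) → Fin n → ℝ,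
        (∀ n, Measurable (est n)) ∧ (∀ n y, est n y ∈ pmOne n) ∧
        Tendsto (fun n => ⨆ x : Omega (p n) n (Δ n),
          (n : ℝ)⁻¹ * risk (p n) n (σ n) (est n) x.1.1 x.1.2) atTop (nhds 0))
      ↔ Tendsto (fun n => Phic (snr (p n) n (σ n) (Δ n))) atTop (nhds 0) := by
  rw [aux_phic_iff]
  constructor
  · rintro ⟨est, hm, hpm, hlim⟩
    rw [tendsto_atTop]
    intro C
    have hpos : 0 < Real.exp (-(4 * C ^ 2)) ^ 2 / 8 := by positivity
    filter_upwards [hlim.eventually (gt_mem_nhds hpos), eventually_ge_atTop 2] with n hn hn2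
    by_contra hc
    have hr0 := (aux_upper_snr (p n) n (hp n) (by omega) (σ n) (Δ n) (hσ n) (hΔ n) (Δ n) le_rfl).1
    have hb := aux_lower (p n) n (hp n) hn2 (σ n) (Δ n) _ (hσ n) (hΔ n) (est n) (hm n) (hpm n)
      (fun x => le_ciSup (f := fun x : Omega (p n) n (Δ n) =>
        (n : ℝ)⁻¹ * risk (p n) n (σ n) (est n) x.1.1 x.1.2)
        ⟨1, by
          rintro _ ⟨x, rfl⟩
          exact (aux_risk_bd (p n) n (by omega) (σ n) (est n) (hm n) (hpm n) _ _ x.2.2).2⟩ x)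
    have hlt := hb.trans_lt hn
    have hle : Real.exp (-(4 * C ^ 2)) ^ 2 / 8
        ≤ Real.exp (-(4 * snr (p n) n (σ n) (Δ n) ^ 2)) ^ 2 / 8 := by
      have : snr (p n) n (σ n) (Δ n) ^ 2 ≤ C ^ 2 := by
        have := (not_le.1 hc).le
        gcongr
      gcongr
    linarith
  · intro h
    choose est hm hprop using fun n => aux_argmax (p n) n
    refine ⟨est, hm, fun n y => (hprop n y).1, ?_⟩
    have hlim : Tendsto (fun n => 13 / snr (p n) n (σ n) (Δ n) + 5 / snr (p n) n (σ n) (Δ n) ^ 2)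
        atTop (nhds 0) := by
      have h1 := (tendsto_inv_atTop_zero.comp h)
      have h2 := (h1.const_mul 13).add ((h1.pow 2).const_mul 5)
      simp only [Function.comp_apply, mul_zero, ne_eq, OfNat.ofNat_ne_zero, not_false_eq_true,
        zero_pow, add_zero] at h2
      refine h2.congr fun n => ?_
      rw [inv_pow]; ring
    refine tendsto_of_tendsto_of_tendsto_of_le_of_le' tendsto_const_nhds hlim ?_ ?_
    · filter_upwards [eventually_ge_atTop 1] with n hn
      exact Real.iSup_nonneg fun x =>
        (aux_risk_bd (p n) n hn (σ n) (est n) (hm n) (fun y => (hprop n y).1) _ _ x.2.2).1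
    · filter_upwards [eventually_ge_atTop 1] with n hn
      refine Real.iSup_le (fun x => ?_) ?_
      · refine (aux_upper (p n) n (hp n) hn (σ n) (Δ n) (hσ n) (hΔ n) (est n) (hm n)
          (fun y => (hprop n y).1) (fun y => (hprop n y).2) _ _ x.2.1 x.2.2).trans ?_
        exact (aux_upper_snr (p n) n (hp n) hn (σ n) (Δ n) (hσ n) (hΔ n) _ x.2.1).2
      · have := (aux_upper_snr (p n) n (hp n) hn (σ n) (Δ n) (hσ n) (hΔ n) (Δ n) le_rfl).1
        positivity

end
end
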